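/- arXiv:1306.3315 — 2 statements merged into one kernel-verified Lean document; each statement's English description precedes it below -/
import Mathlib

section
/- (Fukuyama's theorem) Let θ ≥ 2 be an integer. Then for Lebesgue-almost every x ∈ [0,1], limsup_{N → ∞} N · D_N^*(⟨θ x⟩, ⟨θ² x⟩, …, ⟨θ^N x⟩) / √(2 N log log N) equals √42/9 if θ = 2; equals √((θ+1)θ(θ−2)) / (2 √((θ−1)³)) if θ ≥ 4 is even; and equals √(θ+1) / (2 √(θ−1)) if θ ≥ 3 is odd. -/
open MeasureTheory Filter Real

/-- The star-discrepancy of the points `x 1, …, x N` in the unit interval: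
`D_N^* = sup_{0 ≤ a ≤ 1} | (1/N) ∑_{k=1}^N 1_{[0,a)}(x_k) - a |`. -/
noncomputable def starDiscrepancy (N : ℕ) (x : ℕ → ℝ) : ℝ :=
  ⨆ a : Set.Icc (0 : ℝ) 1,
    |(∑ k ∈ Finset.Icc 1 N,
        (Set.Ico (0 : ℝ) (a : ℝ)).indicator (fun _ => (1 : ℝ)) (x k)) / N - (a : ℝ)|

namespace Fukuyama

/-- The uniform distribution on the unit interval. -/
noncomputable def unif : Measure ℝ := volume.restrict (Set.Ico (0 : ℝ) 1)

instance : IsProbabilityMeasure unif := ⟨by simp [unif]⟩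

/-- The `k`-th iterate of the map `x ↦ ⟨θ x⟩`. -/
noncomputable def shift (θ k : ℕ) (x : ℝ) : ℝ := Int.fract ((θ : ℝ) ^ k * x)

lemma shift_nonneg (θ k : ℕ) (x : ℝ) : 0 ≤ shift θ k x := Int.fract_nonneg _

lemma shift_lt_one (θ k : ℕ) (x : ℝ) : shift θ k x < 1 := Int.fract_lt_one _

lemma shift_mem (θ k : ℕ) (x : ℝ) : shift θ k x ∈ Set.Ico (0 : ℝ) 1 :=
  ⟨shift_nonneg θ k x, shift_lt_one θ k x⟩

lemma shift_zero_of_mem (θ : ℕ) {x : ℝ} (hx : x ∈ Set.Ico (0 : ℝ) 1) : shift θ 0 x = x := by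
  simp [shift, Int.fract_eq_self.2 hx]

lemma fract_nat_mul_fract (n : ℕ) (x : ℝ) :
    Int.fract ((n : ℝ) * Int.fract x) = Int.fract (n * x) := by
  rw [Int.fract_eq_fract]
  refine ⟨-(n * ⌊x⌋), ?_⟩
  rw [Int.fract]; push_cast; ring

lemma shift_shift (θ k l : ℕ) (x : ℝ) : shift θ k (shift θ l x) = shift θ (k + l) x := by
  unfold shift
  rw [← Nat.cast_pow, fract_nat_mul_fract, pow_add]
  push_cast
  rw [mul_assoc]

@[fun_prop]
lemma measurable_shift (θ k : ℕ) : Measurable (shift θ k) := by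
  unfold shift; fun_prop

lemma ae_unif_mem : ∀ᵐ x ∂unif, x ∈ Set.Ico (0 : ℝ) 1 := ae_restrict_mem measurableSet_Ico

/-- Bounded measurable functions. -/
structure BddMeas (u : ℝ → ℝ) : Prop where
  meas : Measurable u
  bdd : ∃ C, ∀ x, |u x| ≤ C

namespace BddMeas
variable {u v : ℝ → ℝ}

lemma integrable (hu : BddMeas u) : Integrable u unif := by
  obtain ⟨C, hC⟩ := hu.bdd
  exact Integrable.of_bound hu.meas.aestronglyMeasurable C (ae_of_all _ hC)

lemma const (c : ℝ) : BddMeas (fun _ => c) := ⟨measurable_const, |c|, fun _ => le_rfl⟩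

lemma add (hu : BddMeas u) (hv : BddMeas v) : BddMeas (fun x => u x + v x) := by
  obtain ⟨C, hC⟩ := hu.bdd
  obtain ⟨D, hD⟩ := hv.bdd
  exact ⟨hu.meas.add hv.meas, C + D, fun x => (abs_add_le _ _).trans (add_le_add (hC x) (hD x))⟩

lemma mul (hu : BddMeas u) (hv : BddMeas v) : BddMeas (fun x => u x * v x) := by
  obtain ⟨C, hC⟩ := hu.bdd
  obtain ⟨D, hD⟩ := hv.bdd
  refine ⟨hu.meas.mul hv.meas, C * D, fun x => ?_⟩
  rw [abs_mul]
  exact mul_le_mul (hC x) (hD x) (abs_nonneg _) ((abs_nonneg _).trans (hC x))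

lemma const_mul (hu : BddMeas u) (c : ℝ) : BddMeas (fun x => c * u x) := (const c).mul hu

lemma sub (hu : BddMeas u) (hv : BddMeas v) : BddMeas (fun x => u x - v x) := by
  simpa [sub_eq_add_neg] using hu.add (hv.const_mul (-1))

lemma comp (hu : BddMeas u) {g : ℝ → ℝ} (hg : Measurable g) : BddMeas (fun x => u (g x)) := by
  obtain ⟨C, hC⟩ := hu.bdd
  exact ⟨hu.meas.comp hg, C, fun x => hC _⟩

lemma sum {ι : Type*} (s : Finset ι) {w : ι → ℝ → ℝ} (h : ∀ i ∈ s, BddMeas (w i)) :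
    BddMeas (fun x => ∑ i ∈ s, w i x) := by
  classical
  induction s using Finset.induction_on with
  | empty => simpa using const 0
  | insert a s ha ih =>
    simp only [Finset.sum_insert ha]
    exact (h a (Finset.mem_insert_self _ _)).add
      (ih fun i hi => h i (Finset.mem_insert_of_mem hi))

lemma exp (hu : BddMeas u) : BddMeas (fun x => Real.exp (u x)) := by
  obtain ⟨C, hC⟩ := hu.bdd
  refine ⟨hu.meas.exp, Real.exp C, fun x => ?_⟩
  rw [abs_of_pos (exp_pos _)]
  exact exp_le_exp.2 ((le_abs_self _).trans (hC x))

lemma indicator {s : Set ℝ} (hs : MeasurableSet s) : BddMeas (s.indicator fun _ => (1 : ℝ)) := by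
  refine ⟨measurable_const.indicator hs, 1, fun x => ?_⟩
  by_cases h : x ∈ s <;> simp [h]

end BddMeas

lemma integral_unif (G : ℝ → ℝ) : ∫ x, G x ∂unif = ∫ x in (0 : ℝ)..1, G x := by
  rw [intervalIntegral.integral_of_le zero_le_one, unif, integral_Ico_eq_integral_Ioo,
    integral_Ioc_eq_integral_Ioo]

lemma BddMeas.intervalIntegrable {u : ℝ → ℝ} (hu : BddMeas u) (a b : ℝ) :
    IntervalIntegrable u volume a b := by
  obtain ⟨C, hC⟩ := hu.bdd
  exact (intervalIntegrable_const (c := C)).mono_fun hu.meas.aestronglyMeasurable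
    (ae_of_all _ fun x => (hC x).trans (le_abs_self C))

lemma integral_unif_eq_sum {b : ℕ} (hb : 0 < b) {G : ℝ → ℝ} (hG : BddMeas G) :
    ∫ x, G x ∂unif = (b : ℝ)⁻¹ * ∑ j ∈ Finset.range b, ∫ y, G ((y + j) / b) ∂unif := by
  have hb' : (b : ℝ) ≠ 0 := by positivity
  have h := intervalIntegral.sum_integral_adjacent_intervals (f := G) (μ := volume)
    (a := fun k : ℕ => (k : ℝ) / b) (n := b) (fun k _ => hG.intervalIntegrable _ _)
  rw [integral_unif]
  simp only [Nat.cast_zero, zero_div, div_self hb'] at h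
  rw [← h, Finset.mul_sum]
  refine Finset.sum_congr rfl fun j _ => ?_
  rw [integral_unif]
  have := intervalIntegral.integral_comp_div_add (a := 0) (b := 1) G hb' ((j : ℝ) / b)
  simp only [add_div]
  rw [this]
  simp only [smul_eq_mul, zero_div, zero_add]
  rw [← mul_assoc, inv_mul_cancel₀ hb', one_mul]
  congr 1
  push_cast; ring

lemma shift_preimage_div {θ : ℕ} (hθ : 0 < θ) (k j : ℕ) {y : ℝ} (hy : y ∈ Set.Ico (0 : ℝ) 1) :
    shift θ k ((y + j) / (θ ^ k : ℕ)) = y := by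
  have : (θ : ℝ) ^ k ≠ 0 := by positivity
  unfold shift
  push_cast
  rw [mul_div_cancel₀ _ this, Int.fract_add_natCast, Int.fract_eq_self.2 hy]

lemma integral_mul_shift {θ : ℕ} (hθ : 0 < θ) (k : ℕ) {u G : ℝ → ℝ} (hu : BddMeas u)
    (hG : BddMeas G) :
    ∫ x, u x * G (shift θ k x) ∂unif =
      ∫ y, (((θ ^ k : ℕ) : ℝ)⁻¹ * ∑ j ∈ Finset.range (θ ^ k), u ((y + j) / (θ ^ k : ℕ))) * G y
        ∂unif := by
  rw [integral_unif_eq_sum (b := θ ^ k) (by positivity) (hu.mul (hG.comp (measurable_shift θ k)))]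
  have h1 : ∀ j : ℕ, BddMeas fun y => u ((y + j) / (θ ^ k : ℕ)) * G y := fun j =>
    (hu.comp (by fun_prop)).mul hG
  simp only [Finset.mul_sum, Finset.sum_mul, mul_assoc]
  rw [integral_finsetSum]
  · refine Finset.sum_congr rfl fun j _ => ?_
    rw [integral_const_mul]
    congr 1
    refine integral_congr_ae ?_
    filter_upwards [ae_unif_mem] with y hy
    rw [shift_preimage_div hθ k j hy]
  · intro j _
    exact ((h1 j).const_mul _).integrable

lemma integral_comp_shift {θ : ℕ} (hθ : 0 < θ) (k : ℕ) {G : ℝ → ℝ} (hG : BddMeas G) :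
    ∫ x, G (shift θ k x) ∂unif = ∫ x, G x ∂unif := by
  have := integral_mul_shift hθ k (BddMeas.const 1) hG
  have h0 : (θ : ℝ) ≠ 0 := by positivity
  simpa [h0] using this

lemma measurePreserving_shift {θ : ℕ} (hθ : 0 < θ) (k : ℕ) :
    MeasurePreserving (shift θ k) unif unif := by
  refine ⟨measurable_shift θ k, Measure.ext fun s hs => ?_⟩
  rw [Measure.map_apply (measurable_shift θ k) hs]
  have := integral_comp_shift hθ k (BddMeas.indicator hs)
  have h2 : (fun x => s.indicator (fun _ => (1 : ℝ)) (shift θ k x)) =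
      (shift θ k ⁻¹' s).indicator fun _ => (1 : ℝ) := by
    rfl
  rw [h2, integral_indicator_const _ (measurable_shift θ k hs),
    integral_indicator_const _ hs] at this
  simpa [Measure.real, ENNReal.toReal_eq_toReal_iff', measure_ne_top] using this

/-- Functions which only depend on the first `m` digits in base `θ`. -/
def IsLevel (θ m : ℕ) {α : Sort*} (u : ℝ → α) : Prop :=
  ∀ x y : ℝ, ⌊(θ : ℝ) ^ m * x⌋ = ⌊(θ : ℝ) ^ m * y⌋ → u x = u y

lemma IsLevel.comp {θ m : ℕ} {α β : Sort*} {u : ℝ → α} (hu : IsLevel θ m u) (g : α → β) :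
    IsLevel θ m (fun x => g (u x)) := fun x y h => congrArg g (hu x y h)

lemma IsLevel.comp₂ {θ m : ℕ} {α β γ : Sort*} {u : ℝ → α} {v : ℝ → β} (hu : IsLevel θ m u)
    (hv : IsLevel θ m v) (g : α → β → γ) :
    IsLevel θ m (fun x => g (u x) (v x)) := fun x y h => by
  simp only [hu x y h, hv x y h]

lemma floor_pow_mul {θ : ℕ} (hθ : 0 < θ) (m k : ℕ) (x : ℝ) :
    ⌊(θ : ℝ) ^ m * x⌋ = ⌊(θ : ℝ) ^ (m + k) * x⌋ / ((θ ^ k : ℕ) : ℤ) := by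
  have h0 : (θ : ℝ) ^ k ≠ 0 := by positivity
  rw [← Int.floor_div_natCast]
  congr 1
  push_cast
  rw [pow_add]
  field_simp

lemma IsLevel.mono {θ m n : ℕ} (hθ : 0 < θ) {α : Sort*} {u : ℝ → α} (hu : IsLevel θ m u)
    (h : m ≤ n) : IsLevel θ n u := by
  intro x y hxy
  obtain ⟨k, rfl⟩ := Nat.exists_eq_add_of_le h
  apply hu
  rw [floor_pow_mul hθ m k, hxy, ← floor_pow_mul hθ m k]

lemma IsLevel.comp_shift {θ m : ℕ} (hθ : 0 < θ) (k : ℕ) {α : Sort*} {u : ℝ → α}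
    (hu : IsLevel θ m u) : IsLevel θ (k + m) (fun x => u (shift θ k x)) := by
  have key : ∀ z : ℝ, ⌊(θ : ℝ) ^ m * shift θ k z⌋ =
      ⌊(θ : ℝ) ^ (k + m) * z⌋ - (θ ^ m : ℕ) * ⌊(θ : ℝ) ^ k * z⌋ := by
    intro z
    rw [← Int.floor_sub_intCast]
    congr 1
    unfold shift
    rw [Int.fract]; push_cast; ring
  intro x y hxy
  apply hu
  rw [key, key, hxy, floor_pow_mul hθ k m x, floor_pow_mul hθ k m y, hxy]

lemma IsLevel.measurable {θ m : ℕ} (hθ : 0 < θ) {u : ℝ → ℝ}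
    (hu : IsLevel θ m u) : Measurable u := by
  have h0 : (θ : ℝ) ^ m ≠ 0 := by positivity
  have : u = (fun j : ℤ => u (j / (θ : ℝ) ^ m)) ∘ fun x => ⌊(θ : ℝ) ^ m * x⌋ := by
    ext x
    apply hu
    simp [mul_div_cancel₀ _ h0]
  rw [this]
  exact (measurable_of_countable _).comp (by fun_prop)

lemma IsLevel.apply_div {θ m : ℕ} (hθ : 0 < θ) {α : Sort*} {u : ℝ → α} (hu : IsLevel θ m u)
    (j : ℕ) {y : ℝ} (hy : y ∈ Set.Ico (0 : ℝ) 1) :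
    u ((y + j) / (θ ^ m : ℕ)) = u (j / (θ ^ m : ℕ)) := by
  have h0 : (θ : ℝ) ^ m ≠ 0 := by positivity
  apply hu
  push_cast
  rw [mul_div_cancel₀ _ h0, mul_div_cancel₀ _ h0]
  simp [Int.floor_eq_zero_iff.2 hy]

/-- Independence of the first `m` digits from the later ones. -/
lemma IsLevel.integral_mul_shift {θ m : ℕ} (hθ : 0 < θ) {u G : ℝ → ℝ} (hu : IsLevel θ m u)
    (hub : BddMeas u) (hG : BddMeas G) :
    ∫ x, u x * G (shift θ m x) ∂unif = (∫ x, u x ∂unif) * ∫ x, G x ∂unif := by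
  have key : ∀ F : ℝ → ℝ, BddMeas F → ∫ x, u x * F (shift θ m x) ∂unif =
      (((θ ^ m : ℕ) : ℝ)⁻¹ * ∑ j ∈ Finset.range (θ ^ m), u (j / (θ ^ m : ℕ))) *
        ∫ x, F x ∂unif := by
    intro F hF
    rw [Fukuyama.integral_mul_shift hθ m hub hF, ← integral_const_mul]
    refine integral_congr_ae ?_
    filter_upwards [ae_unif_mem] with y hy
    simp only [hu.apply_div hθ _ hy]
  have h1 := key _ (BddMeas.const 1)
  simp only [mul_one, integral_const, probReal_univ, smul_eq_mul] at h1
  rw [key G hG, h1]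

/-- The transfer operator of `x ↦ ⟨θ x⟩`. -/
noncomputable def transfer (θ : ℕ) (u : ℝ → ℝ) (y : ℝ) : ℝ :=
  (θ : ℝ)⁻¹ * ∑ j ∈ Finset.range θ, u ((y + j) / θ)

lemma integral_mul_shift_one {θ : ℕ} (hθ : 0 < θ) {u G : ℝ → ℝ} (hu : BddMeas u)
    (hG : BddMeas G) :
    ∫ x, u x * G (shift θ 1 x) ∂unif = ∫ y, transfer θ u y * G y ∂unif := by
  rw [integral_mul_shift hθ 1 hu hG]
  simp only [pow_one, transfer]

lemma BddMeas.transfer (θ : ℕ) {u : ℝ → ℝ} (hu : BddMeas u) : BddMeas (transfer θ u) := by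
  unfold Fukuyama.transfer
  exact (BddMeas.sum _ fun (j : ℕ) _ => hu.comp (g := fun y => (y + j) / θ) (by fun_prop)).const_mul _

lemma IsLevel.transfer {θ m : ℕ} (hθ : 0 < θ) {u : ℝ → ℝ} (hu : IsLevel θ (m + 1) u) :
    IsLevel θ m (transfer θ u) := by
  have h0 : (θ : ℝ) ≠ 0 := by positivity
  intro x y hxy
  unfold Fukuyama.transfer
  congr 1
  refine Finset.sum_congr rfl fun j _ => hu _ _ ?_
  have key : ∀ z : ℝ, ⌊(θ : ℝ) ^ (m + 1) * ((z + j) / θ)⌋ =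
      ⌊(θ : ℝ) ^ m * z⌋ + (θ ^ m * j : ℕ) := by
    intro z
    rw [← Int.floor_add_natCast]
    congr 1
    push_cast
    field_simp
    ring
  rw [key, key, hxy]

lemma integral_transfer {θ : ℕ} (hθ : 0 < θ) {u : ℝ → ℝ} (hu : BddMeas u) :
    ∫ x, transfer θ u x ∂unif = ∫ x, u x ∂unif := by
  simpa using (integral_mul_shift_one hθ hu (BddMeas.const 1)).symm

lemma transfer_add (θ : ℕ) (u v : ℝ → ℝ) (y : ℝ) :
    transfer θ (fun x => u x + v x) y = transfer θ u y + transfer θ v y := by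
  simp only [transfer, Finset.sum_add_distrib, mul_add]

lemma transfer_const_mul (θ : ℕ) (c : ℝ) (u : ℝ → ℝ) (y : ℝ) :
    transfer θ (fun x => c * u x) y = c * transfer θ u y := by
  simp only [transfer, ← Finset.mul_sum]; ring

lemma transfer_const {θ : ℕ} (hθ : 0 < θ) (c : ℝ) (y : ℝ) :
    transfer θ (fun _ => c) y = c := by
  have h0 : (θ : ℝ) ≠ 0 := by positivity
  simp [transfer, h0]

lemma div_mem_Ico {θ j : ℕ} (hj : j < θ) {y : ℝ} (hy : y ∈ Set.Ico (0 : ℝ) 1) :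
    (y + j) / θ ∈ Set.Ico (0 : ℝ) 1 := by
  have h0 : (0 : ℝ) < θ := by exact_mod_cast (Nat.zero_le j).trans_lt hj
  have h1 : (j : ℝ) + 1 ≤ θ := by exact_mod_cast hj
  have h2 : (0 : ℝ) ≤ j := by positivity
  obtain ⟨h3, h4⟩ := hy
  refine ⟨by positivity, ?_⟩
  rw [div_lt_one h0]; linarith

lemma transfer_congr {θ : ℕ} {u v : ℝ → ℝ} (h : ∀ x ∈ Set.Ico (0 : ℝ) 1, u x = v x) {y : ℝ}
    (hy : y ∈ Set.Ico (0 : ℝ) 1) : transfer θ u y = transfer θ v y := by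
  unfold transfer
  congr 1
  exact Finset.sum_congr rfl fun j hj => h _ (div_mem_Ico (Finset.mem_range.1 hj) hy)

lemma abs_transfer_le {θ : ℕ} (hθ : 0 < θ) {u : ℝ → ℝ} {C : ℝ} (h : ∀ x, |u x| ≤ C) (y : ℝ) :
    |transfer θ u y| ≤ C := by
  have h0 : (0 : ℝ) < θ := by positivity
  unfold transfer
  rw [abs_mul, abs_of_pos (inv_pos.2 h0), inv_mul_le_iff₀ h0]
  refine (Finset.abs_sum_le_sum_abs _ _).trans ?_
  refine (Finset.sum_le_sum fun j _ => h _).trans ?_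
  simp

/-- The Poisson equation `v - P v = P u` for the transfer operator `P`. -/
lemma exists_poisson {θ : ℕ} (hθ : 0 < θ) (m : ℕ) {u : ℝ → ℝ} (hu : IsLevel θ m u)
    (hub : BddMeas u) (h0 : ∫ x, u x ∂unif = 0) :
    ∃ v : ℝ → ℝ, BddMeas v ∧
      ∀ y ∈ Set.Ico (0 : ℝ) 1, transfer θ v y = v y - transfer θ u y := by
  induction m generalizing u with
  | zero =>
    have hc : ∀ x ∈ Set.Ico (0 : ℝ) 1, u x = u 0 := fun x hx => by
      apply hu
      simp [Int.floor_eq_zero_iff.2 hx]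
    have : u 0 = 0 := by
      rw [integral_congr_ae (g := fun _ => u 0)
        (by filter_upwards [ae_unif_mem] with x hx using hc x hx)] at h0
      simpa using h0
    refine ⟨fun _ => 0, BddMeas.const 0, fun y hy => ?_⟩
    rw [transfer_const hθ, transfer_congr (v := fun _ => 0) (fun x hx => by rw [hc x hx, this]) hy,
      transfer_const hθ, sub_zero]
  | succ m ih =>
    obtain ⟨v, hv, hv'⟩ := ih (hu.transfer hθ) (hub.transfer θ)
      (by rw [integral_transfer hθ hub, h0])
    refine ⟨fun x => v x + transfer θ u x, hv.add (hub.transfer θ), fun y hy => ?_⟩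
    rw [transfer_add, hv' y hy]
    ring

/-- Ergodic sums along the orbit of `x ↦ ⟨θ x⟩`. -/
noncomputable def ergSum (θ : ℕ) (f : ℝ → ℝ) (n : ℕ) (x : ℝ) : ℝ :=
  ∑ k ∈ Finset.range n, f (shift θ k x)

lemma ergSum_add (θ : ℕ) (f : ℝ → ℝ) (m n : ℕ) (x : ℝ) :
    ergSum θ f (m + n) x = ergSum θ f m x + ergSum θ f n (shift θ m x) := by
  unfold ergSum
  rw [Finset.sum_range_add]
  congr 1
  refine Finset.sum_congr rfl fun k _ => ?_
  rw [shift_shift, add_comm]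

lemma BddMeas.ergSum (θ : ℕ) {f : ℝ → ℝ} (hf : BddMeas f) (n : ℕ) : BddMeas (ergSum θ f n) :=
  BddMeas.sum _ fun k _ => hf.comp (measurable_shift θ k)

lemma IsLevel.ergSum {θ m : ℕ} (hθ : 0 < θ) {f : ℝ → ℝ} (hf : IsLevel θ m f) (n : ℕ) :
    IsLevel θ (n + m) (ergSum θ f n) := by
  intro x y h
  unfold Fukuyama.ergSum
  refine Finset.sum_congr rfl fun k hk => ?_
  exact ((hf.comp_shift hθ k).mono hθ (by have := Finset.mem_range.1 hk; lia)) x y h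

lemma abs_exp_sub_quadratic_le {t : ℝ} (ht : |t| ≤ 1) :
    |Real.exp t - (1 + t + t ^ 2 / 2)| ≤ |t| ^ 3 := by
  have := Real.exp_bound ht (n := 3) (by norm_num)
  simp only [Finset.sum_range_succ, Finset.sum_range_zero] at this
  norm_num [Nat.factorial] at this
  refine this.trans ?_
  have : 0 ≤ |t| ^ 3 := by positivity
  linarith

lemma abs_exp_sub_linear_le {t : ℝ} (ht : |t| ≤ 1) : |Real.exp t - (1 + t)| ≤ |t| ^ 2 := by
  have := Real.abs_exp_sub_one_sub_id_le ht
  rw [sq_abs]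
  convert this using 2
  ring

lemma abs_exp_mul_sub_le {f g v l B : ℝ} (hf : |f| ≤ 1) (hg : |g| ≤ B) (hv : |v| ≤ B)
    (hl : |l| ≤ 1) :
    |Real.exp (l * f) * (1 + l * g + l ^ 2 * v) -
      (1 + l * (f + g) + l ^ 2 * (f ^ 2 / 2 + f * g + v))| ≤ (1 + 4 * B) * |l| ^ 3 := by
  have hB : 0 ≤ B := (abs_nonneg _).trans hg
  have hlf : |l * f| ≤ |l| := by
    rw [abs_mul]; exact mul_le_of_le_one_right (abs_nonneg _) hf
  have h1 := abs_exp_sub_quadratic_le (hlf.trans hl)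
  have h1' : |Real.exp (l * f) - (1 + l * f + (l * f) ^ 2 / 2)| ≤ |l| ^ 3 :=
    h1.trans (pow_le_pow_left₀ (abs_nonneg _) hlf 3)
  have hw : |1 + l * g + l ^ 2 * v| ≤ 1 + 2 * B := by
    have a1 : |l * g| ≤ B := by
      rw [abs_mul]; calc _ ≤ 1 * B := mul_le_mul hl hg (abs_nonneg _) zero_le_one
        _ = B := one_mul B
    have a2 : |l ^ 2 * v| ≤ B := by
      rw [abs_mul, abs_pow]
      calc _ ≤ 1 * B := mul_le_mul (pow_le_one₀ (abs_nonneg _) hl) hv (abs_nonneg _) zero_le_one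
        _ = B := one_mul B
    have a3 := abs_add_three 1 (l * g) (l ^ 2 * v)
    rw [abs_one] at a3
    linarith
  have e : Real.exp (l * f) * (1 + l * g + l ^ 2 * v) -
      (1 + l * (f + g) + l ^ 2 * (f ^ 2 / 2 + f * g + v)) =
      (Real.exp (l * f) - (1 + l * f + (l * f) ^ 2 / 2)) * (1 + l * g + l ^ 2 * v) +
        l ^ 3 * (f * v + f ^ 2 / 2 * (g + l * v)) := by ring
  have h2 : |f * v + f ^ 2 / 2 * (g + l * v)| ≤ 2 * B := by
    have b1 : |f * v| ≤ B := by
      rw [abs_mul]; calc _ ≤ 1 * B := mul_le_mul hf hv (abs_nonneg _) zero_le_one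
        _ = B := one_mul B
    have b2 : |l * v| ≤ B := by
      rw [abs_mul]; calc _ ≤ 1 * B := mul_le_mul hl hv (abs_nonneg _) zero_le_one
        _ = B := one_mul B
    have b3 : |g + l * v| ≤ 2 * B := (abs_add_le _ _).trans (by linarith)
    have b4 : |f ^ 2 / 2| ≤ 1 / 2 := by
      rw [abs_div, abs_pow, abs_two]
      have := pow_le_one₀ (n := 2) (abs_nonneg _) hf
      linarith
    have b5 : |f ^ 2 / 2 * (g + l * v)| ≤ 1 / 2 * (2 * B) := by
      rw [abs_mul]; exact mul_le_mul b4 b3 (abs_nonneg _) (by norm_num)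
    exact (abs_add_le _ _).trans (by linarith)
  rw [e]
  refine (abs_add_le _ _).trans ?_
  rw [abs_mul, abs_mul, abs_pow]
  have c1 := mul_le_mul h1' hw (abs_nonneg _) (by positivity)
  have c2 := mul_le_mul_of_nonneg_left h2 (pow_nonneg (abs_nonneg l) 3)
  linarith

lemma abs_transfer_exp_sub_le {θ : ℕ} (hθ : 0 < θ) {f g v : ℝ → ℝ} {c B l : ℝ} (hB : 1 ≤ B)
    (hf : ∀ x, |f x| ≤ 1) (hg : ∀ x, |g x| ≤ B) (hv : ∀ x, |v x| ≤ B) (hc : |c| ≤ B)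
    (hfg : ∀ y ∈ Set.Ico (0 : ℝ) 1, transfer θ g y = g y - transfer θ f y)
    (hfv : ∀ y ∈ Set.Ico (0 : ℝ) 1, transfer θ v y =
      v y - transfer θ (fun x => f x ^ 2 / 2 + f x * g x + -c) y)
    (hl : |l| * B ≤ 1) {y : ℝ} (hy : y ∈ Set.Ico (0 : ℝ) 1) :
    |transfer θ (fun x => Real.exp (l * f x) * (1 + l * g x + l ^ 2 * v x)) y -
      Real.exp (l ^ 2 * c) * (1 + l * g y + l ^ 2 * v y)| ≤ 10 * B ^ 2 * |l| ^ 3 := by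
  have hl1 : |l| ≤ 1 := (le_mul_of_one_le_right (abs_nonneg _) hB).trans hl
  set R : ℝ → ℝ := fun x => Real.exp (l * f x) * (1 + l * g x + l ^ 2 * v x) -
      (1 + l * (f x + g x) + l ^ 2 * (f x ^ 2 / 2 + f x * g x + v x)) with hR
  have hRb : |transfer θ R y| ≤ (1 + 4 * B) * |l| ^ 3 :=
    abs_transfer_le hθ (fun x => abs_exp_mul_sub_le (hf x) (hg x) (hv x) hl1) y
  have e1 : transfer θ (fun x => Real.exp (l * f x) * (1 + l * g x + l ^ 2 * v x)) y =
      (1 + l * g y + l ^ 2 * v y) + l ^ 2 * c + transfer θ R y := by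
    have : (fun x => Real.exp (l * f x) * (1 + l * g x + l ^ 2 * v x)) = fun x =>
        ((1 + l ^ 2 * c) + (l * (f x + g x) +
          l ^ 2 * ((f x ^ 2 / 2 + f x * g x + -c) + v x))) + R x := by
      ext x; simp only [hR]; ring
    rw [this, transfer_add, transfer_add, transfer_const hθ, transfer_add, transfer_const_mul,
      transfer_const_mul, transfer_add, transfer_add, hfg y hy, hfv y hy]
    ring
  have hl2 : |l ^ 2 * c| ≤ |l| ^ 2 * B := by
    rw [abs_mul, abs_pow]
    exact mul_le_mul_of_nonneg_left hc (by positivity)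
  have hl3 : |l| ^ 2 * B ≤ 1 := by
    have := mul_le_mul hl1 hl (by positivity) zero_le_one
    nlinarith
  have h4 := abs_exp_sub_linear_le (hl2.trans hl3)
  have h4' : |Real.exp (l ^ 2 * c) - (1 + l ^ 2 * c)| ≤ B ^ 2 * |l| ^ 3 := by
    refine h4.trans ((pow_le_pow_left₀ (abs_nonneg _) hl2 2).trans ?_)
    have : (|l| ^ 2 * B) ^ 2 = (B ^ 2 * |l| ^ 3) * |l| := by ring
    rw [this]
    exact mul_le_of_le_one_right (by positivity) hl1
  have h5 : |Real.exp (l ^ 2 * c) - 1| ≤ 2 * (|l| ^ 2 * B) := by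
    refine (Real.abs_exp_sub_one_le (hl2.trans hl3)).trans ?_
    linarith
  have h6 : |l * g y + l ^ 2 * v y| ≤ |l| * (2 * B) := by
    have : l * g y + l ^ 2 * v y = l * (g y + l * v y) := by ring
    rw [this, abs_mul]
    refine mul_le_mul_of_nonneg_left ?_ (abs_nonneg _)
    refine (abs_add_le _ _).trans ?_
    have : |l * v y| ≤ 1 * B := by
      rw [abs_mul]; exact mul_le_mul hl1 (hv y) (abs_nonneg _) zero_le_one
    linarith [hg y]
  have h7 := mul_le_mul h5 h6 (abs_nonneg _) (by positivity)
  rw [← abs_mul] at h7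
  have e2 : transfer θ (fun x => Real.exp (l * f x) * (1 + l * g x + l ^ 2 * v x)) y -
      Real.exp (l ^ 2 * c) * (1 + l * g y + l ^ 2 * v y) =
      transfer θ R y - (Real.exp (l ^ 2 * c) - (1 + l ^ 2 * c))
        - (Real.exp (l ^ 2 * c) - 1) * (l * g y + l ^ 2 * v y) := by
    rw [e1]; ring
  rw [e2]
  refine (abs_sub _ _).trans ((add_le_add_left (abs_sub _ _) _).trans ?_)
  have h8 : 2 * (|l| ^ 2 * B) * (|l| * (2 * B)) = 4 * B ^ 2 * |l| ^ 3 := by ring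
  rw [h8] at h7
  have h9 : 0 ≤ |l| ^ 3 := by positivity
  have h10 : (1 + 4 * B) * |l| ^ 3 ≤ 5 * B ^ 2 * |l| ^ 3 :=
    mul_le_mul_of_nonneg_right (by nlinarith) h9
  linarith

/-- Two-sided bounds for the moment generating function of the ergodic sums of a function which
depends on finitely many digits. -/
lemma exists_mgf_ergSum_bounds {θ : ℕ} (hθ : 0 < θ) {m : ℕ} {f g : ℝ → ℝ} (hfl : IsLevel θ m f)
    (hgl : IsLevel θ m g) (hf : ∀ x, |f x| ≤ 1) (hgb : BddMeas g) {c : ℝ}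
    (hc : c = ∫ x, (f x ^ 2 / 2 + f x * g x) ∂unif)
    (hfg : ∀ y ∈ Set.Ico (0 : ℝ) 1, transfer θ g y = g y - transfer θ f y) :
    ∃ K : ℝ, 0 < K ∧ ∀ l : ℝ, |l| * K ≤ 1 → ∀ N : ℕ,
      1 / 4 * Real.exp (N * (l ^ 2 * c - K * |l| ^ 3)) ≤
          ∫ x, Real.exp (l * ergSum θ f N x) ∂unif ∧
        ∫ x, Real.exp (l * ergSum θ f N x) ∂unif ≤
          4 * Real.exp (N * (l ^ 2 * c + K * |l| ^ 3)) := by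
  have hfb : BddMeas f := ⟨hfl.measurable hθ, 1, hf⟩
  have hqb : BddMeas (fun x => f x ^ 2 / 2 + f x * g x) := by
    have := ((hfb.mul hfb).const_mul (1 / 2)).add (hfb.mul hgb)
    convert this using 2
    ring
  obtain ⟨v, hvb, hfv⟩ := exists_poisson hθ m
    (u := fun x => f x ^ 2 / 2 + f x * g x + -c)
    (hfl.comp₂ hgl fun a b => a ^ 2 / 2 + a * b + -c) (hqb.add (BddMeas.const _))
    (by rw [integral_add hqb.integrable (BddMeas.const _).integrable, ← hc]; simp)
  obtain ⟨B₁, hB₁⟩ := hgb.bdd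
  obtain ⟨B₂, hB₂⟩ := hvb.bdd
  obtain ⟨B, hB, hg, hv, hcB⟩ : ∃ B : ℝ, 1 ≤ B ∧ (∀ x, |g x| ≤ B) ∧ (∀ x, |v x| ≤ B) ∧
      |c| ≤ B := by
    have h1 : 0 ≤ B₁ := (abs_nonneg _).trans (hB₁ 0)
    have h2 : 0 ≤ B₂ := (abs_nonneg _).trans (hB₂ 0)
    have h3 := abs_nonneg c
    exact ⟨1 + B₁ + B₂ + |c|, by linarith, fun x => (hB₁ x).trans (by linarith),
      fun x => (hB₂ x).trans (by linarith), by linarith⟩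
  refine ⟨120 * B ^ 2, by positivity, fun l hl N => ?_⟩
  have hBB : B ≤ B ^ 2 := by nlinarith
  have hl0 := abs_nonneg l
  have hlB : |l| * B ≤ 1 / 120 := by nlinarith
  have hl1 : |l| ≤ 1 / 120 := by nlinarith
  set w : ℝ → ℝ := fun x => 1 + l * g x + l ^ 2 * v x with hw
  have hwb : BddMeas w := ((BddMeas.const 1).add (hgb.const_mul l)).add (hvb.const_mul (l ^ 2))
  have hw1 : ∀ x, |w x - 1| ≤ 1 / 2 := by
    intro x
    have a1 : |l * g x| ≤ |l| * B := by
      rw [abs_mul]; exact mul_le_mul_of_nonneg_left (hg x) hl0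
    have a2 : |l ^ 2 * v x| ≤ |l| * B := by
      rw [abs_mul, abs_pow]
      refine mul_le_mul ?_ (hv x) (abs_nonneg _) hl0
      nlinarith
    have : w x - 1 = l * g x + l ^ 2 * v x := by simp only [hw]; ring
    rw [this]
    exact (abs_add_le _ _).trans (by linarith)
  have hwl : ∀ x, 1 / 2 ≤ w x := fun x => by linarith [(abs_le.1 (hw1 x)).1]
  have hwu : ∀ x, w x ≤ 2 := fun x => by linarith [(abs_le.1 (hw1 x)).2]
  set D : ℝ := 40 * B ^ 2 * |l| ^ 3 with hD
  have hD0 : 0 ≤ D := by positivity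
  have hD1 : D ≤ 1 / 2 := by
    have : |l| ^ 2 ≤ 1 := pow_le_one₀ hl0 (by linarith)
    have : D = 1 / 3 * (|l| * (120 * B ^ 2)) * |l| ^ 2 := by rw [hD]; ring
    nlinarith [mul_nonneg hl0 (sq_nonneg B)]
  have hlc : |l ^ 2 * c| ≤ 1 / 2 := by
    rw [abs_mul, abs_pow]
    calc |l| ^ 2 * |c| ≤ |l| ^ 2 * B := mul_le_mul_of_nonneg_left hcB (by positivity)
      _ = |l| * (|l| * B) := by ring
      _ ≤ 1 / 120 * (1 / 120) := mul_le_mul hl1 hlB (by positivity) (by norm_num)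
      _ ≤ 1 / 2 := by norm_num
  have he : 1 / 2 ≤ Real.exp (l ^ 2 * c) := by
    linarith [Real.add_one_le_exp (l ^ 2 * c), (abs_le.1 hlc).1]
  have hwe : ∀ y, 10 * B ^ 2 * |l| ^ 3 ≤ D * (Real.exp (l ^ 2 * c) * w y) := by
    intro y
    have : 1 / 4 ≤ Real.exp (l ^ 2 * c) * w y := by nlinarith [hwl y]
    have := mul_le_mul_of_nonneg_left this hD0
    rw [hD] at this ⊢
    linarith
  have hstep : ∀ y ∈ Set.Ico (0 : ℝ) 1,
      transfer θ (fun x => Real.exp (l * f x) * w x) y ≤ Real.exp (l ^ 2 * c + D) * w y ∧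
      Real.exp (l ^ 2 * c - 2 * D) * w y ≤ transfer θ (fun x => Real.exp (l * f x) * w x) y := by
    intro y hy
    have h :=
      abs_le.1 (abs_transfer_exp_sub_le (l := l) hθ hB hf hg hv hcB hfg hfv (by linarith) hy)
    have h2 := hwe y
    have h3 : 0 < Real.exp (l ^ 2 * c) * w y := mul_pos (exp_pos _) (by linarith [hwl y])
    have h4 := Real.add_one_le_exp D
    have h5 : Real.exp (-(2 * D)) ≤ 1 - D := by
      have h6 := Real.add_one_le_exp (2 * D)
      rw [Real.exp_neg, inv_le_iff_one_le_mul₀ (exp_pos _)]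
      nlinarith
    rw [Real.exp_add, sub_eq_add_neg (l ^ 2 * c), Real.exp_add]
    constructor
    · nlinarith [h.2]
    · nlinarith [h.1]
  set A : ℕ → ℝ := fun N => ∫ x, w x * Real.exp (l * ergSum θ f N x) ∂unif with hA
  have hEb : ∀ N, BddMeas fun x => Real.exp (l * ergSum θ f N x) := fun N =>
    ((hfb.ergSum θ N).const_mul l).exp
  have hrec : ∀ N, A (N + 1) =
      ∫ y, transfer θ (fun x => Real.exp (l * f x) * w x) y *
        Real.exp (l * ergSum θ f N y) ∂unif := by
    intro N
    rw [← integral_mul_shift_one hθ (((hfb.const_mul l).exp).mul hwb) (hEb N)]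
    refine integral_congr_ae ?_
    filter_upwards [ae_unif_mem] with x hx
    rw [add_comm N 1, ergSum_add, mul_add, Real.exp_add]
    have : ergSum θ f 1 x = f x := by simp [ergSum, shift_zero_of_mem θ hx]
    rw [this]; ring
  have hAb : ∀ N : ℕ, A N ≤ Real.exp (N * (l ^ 2 * c + D)) * A 0 ∧
      Real.exp (N * (l ^ 2 * c - 2 * D)) * A 0 ≤ A N := by
    intro N
    induction N with
    | zero => simp
    | succ N ih =>
      have hi := (((hfb.const_mul l).exp.mul hwb).transfer θ).mul (hEb N)
      have hi2 := hwb.mul (hEb N)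
      have u1 : A (N + 1) ≤ Real.exp (l ^ 2 * c + D) * A N := by
        rw [hrec, hA, ← integral_const_mul]
        refine integral_mono_ae hi.integrable (hi2.const_mul _).integrable ?_
        filter_upwards [ae_unif_mem] with y hy
        rw [← mul_assoc]
        exact mul_le_mul_of_nonneg_right (hstep y hy).1 (exp_pos _).le
      have u2 : Real.exp (l ^ 2 * c - 2 * D) * A N ≤ A (N + 1) := by
        rw [hrec, hA, ← integral_const_mul]
        refine integral_mono_ae (hi2.const_mul _).integrable hi.integrable ?_
        filter_upwards [ae_unif_mem] with y hy
        rw [← mul_assoc]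
        exact mul_le_mul_of_nonneg_right (hstep y hy).2 (exp_pos _).le
      have e : ∀ z : ℝ, Real.exp (((N + 1 : ℕ) : ℝ) * z) = Real.exp z * Real.exp (N * z) := by
        intro z; rw [← Real.exp_add]; congr 1; push_cast; ring
      rw [e, e, mul_assoc, mul_assoc]
      exact ⟨u1.trans (mul_le_mul_of_nonneg_left ih.1 (exp_pos _).le),
        (mul_le_mul_of_nonneg_left ih.2 (exp_pos _).le).trans u2⟩
  have hA0 : A 0 = ∫ x, w x ∂unif := by simp [hA, ergSum]
  have hA0u : A 0 ≤ 2 := by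
    rw [hA0]
    refine (integral_mono hwb.integrable (BddMeas.const 2).integrable hwu).trans ?_
    simp
  have hA0l : 1 / 2 ≤ A 0 := by
    rw [hA0]
    refine le_trans ?_ (integral_mono (BddMeas.const (1 / 2)).integrable hwb.integrable hwl)
    simp
  have hI := (hEb N).integrable
  have hu : 1 / 2 * ∫ x, Real.exp (l * ergSum θ f N x) ∂unif ≤ A N := by
    rw [hA, ← integral_const_mul]
    exact integral_mono (hI.const_mul _) (hwb.mul (hEb N)).integrable fun x =>
      mul_le_mul_of_nonneg_right (hwl x) (exp_pos _).le
  have hl' : A N ≤ 2 * ∫ x, Real.exp (l * ergSum θ f N x) ∂unif := by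
    rw [hA, ← integral_const_mul]
    exact integral_mono (hwb.mul (hEb N)).integrable (hI.const_mul _) fun x =>
      mul_le_mul_of_nonneg_right (hwu x) (exp_pos _).le
  obtain ⟨b1, b2⟩ := hAb N
  have hN : (0 : ℝ) ≤ N := by positivity
  have m1 : Real.exp (N * (l ^ 2 * c - 120 * B ^ 2 * |l| ^ 3)) ≤
      Real.exp (N * (l ^ 2 * c - 2 * D)) := by
    refine exp_le_exp.2 (mul_le_mul_of_nonneg_left ?_ hN)
    have : 2 * D = 80 * B ^ 2 * |l| ^ 3 := by rw [hD]; ring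
    have : 0 ≤ B ^ 2 * |l| ^ 3 := by positivity
    linarith
  have m2 : Real.exp (N * (l ^ 2 * c + D)) ≤
      Real.exp (N * (l ^ 2 * c + 120 * B ^ 2 * |l| ^ 3)) := by
    refine exp_le_exp.2 (mul_le_mul_of_nonneg_left ?_ hN)
    have : 0 ≤ B ^ 2 * |l| ^ 3 := by positivity
    linarith
  have p1 := exp_pos (N * (l ^ 2 * c - 2 * D))
  have p2 := exp_pos (N * (l ^ 2 * c + D))
  constructor <;> nlinarith

/-- The centered indicator function of the `j`-th interval of length `θ ^ (-m)`. -/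
noncomputable def cell (θ m j : ℕ) (x : ℝ) : ℝ :=
  (if ⌊(θ : ℝ) ^ m * x⌋ = (j : ℤ) then 1 else 0) - ((θ : ℝ) ^ m)⁻¹

lemma isLevel_cell (θ m j : ℕ) : IsLevel θ m (cell θ m j) := fun x y h => by
  unfold cell; rw [h]

lemma abs_cell_le {θ : ℕ} (hθ : 0 < θ) (m j : ℕ) (x : ℝ) : |cell θ m j x| ≤ 1 := by
  have h1 : (1 : ℝ) ≤ (θ : ℝ) ^ m := one_le_pow₀ (by exact_mod_cast hθ)
  have h2 : ((θ : ℝ) ^ m)⁻¹ ≤ 1 := inv_le_one_of_one_le₀ h1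
  have h3 : 0 < ((θ : ℝ) ^ m)⁻¹ := by positivity
  unfold cell
  rw [abs_le]
  split_ifs <;> constructor <;> linarith

lemma bddMeas_cell {θ : ℕ} (hθ : 0 < θ) (m j : ℕ) : BddMeas (cell θ m j) :=
  ⟨(isLevel_cell θ m j).measurable hθ, 1, abs_cell_le hθ m j⟩

lemma integral_exp_cell_le {θ : ℕ} (hθ : 0 < θ) {m j : ℕ} (hj : j < θ ^ m) {s : ℝ}
    (hs : |s| ≤ 1) :
    ∫ x, Real.exp (s * cell θ m j x) ∂unif ≤ Real.exp (((θ : ℝ) ^ m)⁻¹ * s ^ 2) := by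
  have h0 : (θ : ℝ) ^ m ≠ 0 := by positivity
  set p : ℝ := ((θ : ℝ) ^ m)⁻¹ with hp
  have hp0 : 0 < p := by positivity
  have key : ∫ x, Real.exp (s * cell θ m j x) ∂unif =
      Real.exp (-(s * p)) * (1 + p * (Real.exp s - 1)) := by
    rw [integral_unif_eq_sum (b := θ ^ m) (by positivity) ((bddMeas_cell hθ m j).const_mul s).exp]
    have : ∀ i : ℕ, ∫ y, Real.exp (s * cell θ m j ((y + i) / (θ ^ m : ℕ))) ∂unif =
        Real.exp (-(s * p)) * (1 + if i = j then Real.exp s - 1 else 0) := by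
      intro i
      rw [integral_congr_ae
        (g := fun _ => Real.exp (-(s * p)) * (1 + if i = j then Real.exp s - 1 else 0))]
      · simp
      · filter_upwards [ae_unif_mem] with y hy
        have : ⌊(θ : ℝ) ^ m * ((y + i) / (θ ^ m : ℕ))⌋ = (i : ℤ) := by
          push_cast
          rw [mul_div_cancel₀ _ h0]
          simp [Int.floor_eq_zero_iff.2 hy]
        simp only [cell, this, Nat.cast_inj]
        split_ifs
        · rw [add_sub_cancel, ← Real.exp_add]; congr 1; rw [← hp]; ring
        · rw [add_zero, mul_one]; congr 1; rw [← hp]; ring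
    simp only [this, ← Finset.mul_sum, Finset.sum_add_distrib]
    simp only [Finset.sum_const, Finset.card_range, nsmul_eq_mul, mul_one, Finset.sum_ite_eq',
      Finset.mem_range, hj, if_true]
    push_cast
    rw [hp]
    field_simp
  rw [key]
  have h1 := abs_exp_sub_linear_le hs
  rw [sq_abs] at h1
  have h2 := Real.add_one_le_exp (p * (Real.exp s - 1))
  calc Real.exp (-(s * p)) * (1 + p * (Real.exp s - 1))
      ≤ Real.exp (-(s * p)) * Real.exp (p * (Real.exp s - 1)) :=
        mul_le_mul_of_nonneg_left (by linarith) (exp_pos _).le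
    _ = Real.exp (p * (Real.exp s - (1 + s))) := by rw [← Real.exp_add]; congr 1; ring
    _ ≤ Real.exp (p * s ^ 2) :=
        exp_le_exp.2 (mul_le_mul_of_nonneg_left ((le_abs_self _).trans h1) hp0.le)

lemma integral_exp_sum_skip {θ : ℕ} (hθ : 0 < θ) {m : ℕ} {u : ℝ → ℝ} (hu : IsLevel θ m u)
    (hub : BddMeas u) (s : ℝ) (n : ℕ) :
    ∫ x, Real.exp (s * ∑ i ∈ Finset.range n, u (shift θ (m * i) x)) ∂unif =
      (∫ x, Real.exp (s * u x) ∂unif) ^ n := by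
  induction n with
  | zero => simp
  | succ n ih =>
    have hb : BddMeas fun x => Real.exp (s * ∑ i ∈ Finset.range n, u (shift θ (m * i) x)) :=
      ((BddMeas.sum _ fun i _ => hub.comp (measurable_shift θ (m * i))).const_mul s).exp
    rw [pow_succ', ← ih, ← (hu.comp fun a => Real.exp (s * a)).integral_mul_shift hθ
      (hub.const_mul s).exp hb]
    refine integral_congr_ae ?_
    filter_upwards [ae_unif_mem] with x hx
    rw [Finset.sum_range_succ', mul_zero, shift_zero_of_mem θ hx, mul_add, Real.exp_add, mul_comm]
    simp only [shift_shift, Nat.mul_succ]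

lemma sum_range_mul (f : ℕ → ℝ) (m n : ℕ) :
    ∑ k ∈ Finset.range (m * n), f k =
      ∑ r ∈ Finset.range m, ∑ i ∈ Finset.range n, f (m * i + r) := by
  rw [Finset.sum_comm]
  induction n with
  | zero => simp
  | succ n ih => rw [Nat.mul_succ, Finset.sum_range_add, ih, Finset.sum_range_succ]

lemma integral_exp_ergSum_mul_le {θ : ℕ} (hθ : 0 < θ) {m : ℕ} (hm : 0 < m) {u : ℝ → ℝ}
    (hu : IsLevel θ m u) (hub : BddMeas u) (l : ℝ) (n : ℕ) :
    ∫ x, Real.exp (l * ergSum θ u (m * n) x) ∂unif ≤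
      (∫ x, Real.exp (l * m * u x) ∂unif) ^ n := by
  have hm0 : (m : ℝ) ≠ 0 := by positivity
  set A : ℝ → ℝ := fun x => ∑ i ∈ Finset.range n, u (shift θ (m * i) x) with hA
  have hAb : BddMeas A := BddMeas.sum _ fun i _ => hub.comp (measurable_shift θ (m * i))
  have hEb : BddMeas fun x => Real.exp (l * m * A x) := (hAb.const_mul _).exp
  have e : ∀ x, l * ergSum θ u (m * n) x =
      ∑ r ∈ Finset.range m, (m : ℝ)⁻¹ • (l * m * A (shift θ r x)) := by
    intro x
    simp only [hA, ergSum, sum_range_mul, shift_shift, smul_eq_mul, Finset.mul_sum]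
    refine Finset.sum_congr rfl fun r _ => Finset.sum_congr rfl fun i _ => ?_
    field_simp
  have hJ : ∀ x, Real.exp (l * ergSum θ u (m * n) x) ≤
      ∑ r ∈ Finset.range m, (m : ℝ)⁻¹ * Real.exp (l * m * A (shift θ r x)) := by
    intro x
    rw [e]
    exact convexOn_exp.map_sum_le (fun _ _ => by positivity) (by simp [hm0]) (fun _ _ => trivial)
  refine (integral_mono ((hub.ergSum θ _).const_mul l).exp.integrable
    (BddMeas.sum _ fun r _ => (hEb.comp (measurable_shift θ r)).const_mul _).integrable hJ).trans ?_
  rw [integral_finsetSum _ fun r _ => ((hEb.comp (measurable_shift θ r)).const_mul _).integrable]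
  simp only [integral_const_mul]
  have h1 : ∀ r : ℕ, ∫ x, Real.exp (l * m * A (shift θ r x)) ∂unif =
      (∫ x, Real.exp (l * m * u x) ∂unif) ^ n := fun r => by
    rw [integral_comp_shift hθ r hEb, hA, integral_exp_sum_skip hθ hu hub]
  simp [h1, hm0]

lemma integral_exp_ergSum_cell_le {θ : ℕ} (hθ : 0 < θ) {m j : ℕ} (hm : 0 < m) (hj : j < θ ^ m)
    {l : ℝ} (hl : |l| * m ≤ 1) (N : ℕ) :
    ∫ x, Real.exp (l * ergSum θ (cell θ m j) N x) ∂unif ≤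
      3 * Real.exp (N * m * ((θ : ℝ) ^ m)⁻¹ * l ^ 2) := by
  have hlm : |l * m| ≤ 1 := by rwa [abs_mul, Nat.abs_cast]
  have hb := bddMeas_cell hθ m j
  set n := N / m
  have hN : N = m * n + N % m := (Nat.div_add_mod N m).symm
  have h1 : ∀ x, Real.exp (l * ergSum θ (cell θ m j) N x) ≤
      3 * Real.exp (l * ergSum θ (cell θ m j) (m * n) x) := by
    intro x
    rw [hN, ergSum_add, mul_add, Real.exp_add, mul_comm]
    refine mul_le_mul_of_nonneg_right ?_ (exp_pos _).le
    refine le_trans (exp_le_exp.2 (?_ : _ ≤ (1 : ℝ))) (Real.exp_one_lt_d9.le.trans (by norm_num))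
    refine (le_abs_self _).trans ?_
    rw [abs_mul]
    refine le_trans (mul_le_mul_of_nonneg_left ?_ (abs_nonneg _)) hl
    refine (Finset.abs_sum_le_sum_abs _ _).trans
      ((Finset.sum_le_sum fun k _ => abs_cell_le hθ m j _).trans ?_)
    simp only [Finset.sum_const, Finset.card_range, nsmul_eq_mul, mul_one]
    exact_mod_cast (Nat.mod_lt N hm).le
  refine (integral_mono ((hb.ergSum θ _).const_mul l).exp.integrable
    (((hb.ergSum θ _).const_mul l).exp.const_mul 3).integrable h1).trans ?_
  rw [integral_const_mul]
  refine mul_le_mul_of_nonneg_left ?_ (by norm_num)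
  refine (integral_exp_ergSum_mul_le hθ hm (isLevel_cell θ m j) hb l n).trans ?_
  refine (pow_le_pow_left₀ (integral_nonneg fun x => (exp_pos _).le)
    (integral_exp_cell_le hθ hj hlm) n).trans ?_
  rw [← Real.exp_nat_mul]
  refine exp_le_exp.2 ?_
  have : (m : ℝ) * n ≤ N := by exact_mod_cast Nat.mul_div_le N m
  have h3 : 0 ≤ m * ((θ : ℝ) ^ m)⁻¹ * l ^ 2 := by positivity
  nlinarith

lemma measureReal_abs_ge_le {X : ℝ → ℝ} (hX : BddMeas X) {l t C : ℝ} (hl : 0 ≤ l)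
    (h1 : ∫ x, Real.exp (l * X x) ∂unif ≤ C) (h2 : ∫ x, Real.exp (-l * X x) ∂unif ≤ C) :
    unif.real {x | t ≤ |X x|} ≤ 2 * (Real.exp (-l * t) * C) := by
  have a1 := ProbabilityTheory.measure_ge_le_exp_mul_mgf (μ := unif) (X := X) t hl
    (hX.const_mul l).exp.integrable
  have a2 := ProbabilityTheory.measure_ge_le_exp_mul_mgf (μ := unif) (X := fun x => -1 * X x) t hl
    ((hX.const_mul (-1)).const_mul l).exp.integrable
  have e : ProbabilityTheory.mgf (fun x => -1 * X x) unif l =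
      ∫ x, Real.exp (-l * X x) ∂unif := by
    refine integral_congr_ae (ae_of_all _ fun x => ?_)
    change Real.exp (l * (-1 * X x)) = Real.exp (-l * X x)
    congr 1; ring
  rw [e] at a2
  have hsub : {x | t ≤ |X x|} ⊆ {x | t ≤ X x} ∪ {x | t ≤ -1 * X x} := by
    intro x hx
    rcases le_abs.1 (show t ≤ |X x| from hx) with h | h
    · exact Or.inl h
    · exact Or.inr (by simpa using h)
  refine (measureReal_mono hsub).trans ((measureReal_union_le _ _).trans ?_)
  have b1 := mul_le_mul_of_nonneg_left h1 (exp_pos (-l * t)).le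
  have b2 := mul_le_mul_of_nonneg_left h2 (exp_pos (-l * t)).le
  unfold ProbabilityTheory.mgf at a1
  linarith

lemma measureReal_ergSum_cell_le {θ : ℕ} (hθ : 0 < θ) {m j : ℕ} (hm : 0 < m) (hj : j < θ ^ m)
    {N : ℕ} (hN : 0 < N) {t : ℝ} (ht : 0 ≤ t) (htN : t * (θ : ℝ) ^ m ≤ 2 * N) :
    unif.real {x | t ≤ |ergSum θ (cell θ m j) N x|} ≤
      6 * Real.exp (-(t ^ 2 * (θ : ℝ) ^ m / (4 * N * m))) := by
  set l : ℝ := t * (θ : ℝ) ^ m / (2 * N * m) with hl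
  have hl0 : 0 ≤ l := by positivity
  have hlm : |l| * m ≤ 1 := by
    rw [abs_of_nonneg hl0, hl]
    have : t * (θ : ℝ) ^ m / (2 * N * m) * m = t * (θ : ℝ) ^ m / (2 * N) := by
      field_simp
    rw [this]
    exact div_le_one_of_le₀ htN (by positivity)
  have h1 := integral_exp_ergSum_cell_le hθ hm hj hlm N
  have h2 := integral_exp_ergSum_cell_le hθ hm hj (l := -l) (by rwa [abs_neg]) N
  rw [neg_sq] at h2
  refine (measureReal_abs_ge_le ((bddMeas_cell hθ m j).ergSum θ N) hl0 h1 h2).trans (le_of_eq ?_)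
  have e : -(t ^ 2 * (θ : ℝ) ^ m / (4 * N * m)) = -l * t + N * m * ((θ : ℝ) ^ m)⁻¹ * l ^ 2 := by
    rw [hl]
    field_simp
    ring
  rw [e, Real.exp_add]
  ring

/-- The centered indicator function of `[0, a)`. -/
noncomputable def cent (a x : ℝ) : ℝ := (Set.Ico (0 : ℝ) a).indicator (fun _ => (1 : ℝ)) x - a

lemma abs_cent_le {a : ℝ} (ha : a ∈ Set.Icc (0 : ℝ) 1) (x : ℝ) : |cent a x| ≤ 1 := by
  obtain ⟨h0, h1⟩ := ha
  unfold cent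
  rw [abs_le]
  by_cases h : x ∈ Set.Ico (0 : ℝ) a <;> simp only [h, Set.indicator_of_mem,
    Set.indicator_of_notMem, not_false_eq_true] <;> constructor <;> linarith

lemma cent_of_nonneg (a : ℝ) {x : ℝ} (hx : 0 ≤ x) : cent a x = (if x < a then 1 else 0) - a := by
  unfold cent
  simp [Set.indicator, hx]

/-- The lower approximation of `a` by `m`-digit numbers. -/
noncomputable def gridFloor (θ m : ℕ) (a : ℝ) : ℝ := (⌊(θ : ℝ) ^ m * a⌋₊ : ℝ) / (θ : ℝ) ^ m

lemma gridFloor_nonneg (θ m : ℕ) (a : ℝ) : 0 ≤ gridFloor θ m a := by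
  unfold gridFloor; positivity

lemma gridFloor_le {θ : ℕ} (hθ : 0 < θ) (m : ℕ) {a : ℝ} (ha : 0 ≤ a) : gridFloor θ m a ≤ a := by
  unfold gridFloor
  rw [div_le_iff₀ (by positivity), mul_comm a]
  exact Nat.floor_le (by positivity)

lemma lt_gridFloor_add {θ : ℕ} (hθ : 0 < θ) (m : ℕ) (a : ℝ) :
    a < gridFloor θ m a + ((θ : ℝ) ^ m)⁻¹ := by
  unfold gridFloor
  rw [inv_eq_one_div, ← add_div, lt_div_iff₀ (by positivity), mul_comm a]
  exact Nat.lt_floor_add_one _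

lemma floor_lt_pow {θ : ℕ} (hθ : 0 < θ) (m : ℕ) {a : ℝ} (ha : a ∈ Set.Ico (0 : ℝ) 1) :
    ⌊(θ : ℝ) ^ m * a⌋₊ < θ ^ m := by
  have h0 : (0 : ℝ) < (θ : ℝ) ^ m := by positivity
  rw [Nat.floor_lt (mul_nonneg h0.le ha.1)]
  push_cast
  nlinarith [ha.2]

lemma cent_eq_sum_cell {θ : ℕ} (hθ : 0 < θ) (m j : ℕ) {x : ℝ} (hx : 0 ≤ x) :
    cent (j / (θ : ℝ) ^ m) x = ∑ i ∈ Finset.range j, cell θ m i x := by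
  have h0 : (0 : ℝ) < (θ : ℝ) ^ m := by positivity
  have hf : 0 ≤ ⌊(θ : ℝ) ^ m * x⌋ := Int.floor_nonneg.2 (by positivity)
  obtain ⟨n, hn⟩ := Int.eq_ofNat_of_zero_le hf
  have hlt : x < j / (θ : ℝ) ^ m ↔ n < j := by
    have := Int.floor_lt (a := (θ : ℝ) ^ m * x) (z := (j : ℤ))
    rw [hn, Int.cast_natCast] at this
    rw [lt_div_iff₀ h0, mul_comm, ← this, Int.ofNat_lt]
  rw [cent_of_nonneg _ hx]
  simp only [cell, hn, hlt, Finset.sum_sub_distrib]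
  have : ∀ i : ℕ, ((Int.ofNat n = (i : ℤ)) ↔ n = i) := fun i => by
    rw [Int.ofNat_eq_natCast, Nat.cast_inj]
  simp [div_eq_mul_inv]

lemma ergSum_cent_grid {θ : ℕ} (hθ : 0 < θ) (m j N : ℕ) (x : ℝ) :
    ergSum θ (cent (j / (θ : ℝ) ^ m)) N x =
      ∑ i ∈ Finset.range j, ergSum θ (cell θ m i) N x := by
  unfold ergSum
  rw [Finset.sum_comm]
  exact Finset.sum_congr rfl fun k _ => cent_eq_sum_cell hθ m j (shift_nonneg θ k x)

lemma abs_ergSum_gridFloor_succ_sub_le {θ : ℕ} (hθ : 0 < θ) {m N : ℕ} {x τ a : ℝ}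
    (ha : a ∈ Set.Ico (0 : ℝ) 1) (h : ∀ i < θ ^ (m + 1), |ergSum θ (cell θ (m + 1) i) N x| ≤ τ) :
    |ergSum θ (cent (gridFloor θ (m + 1) a)) N x - ergSum θ (cent (gridFloor θ m a)) N x| ≤
      θ * τ := by
  have h0 : (0 : ℝ) < (θ : ℝ) ^ m := by positivity
  have hθ' : (0 : ℝ) < θ := by positivity
  set j := ⌊(θ : ℝ) ^ m * a⌋₊ with hj
  set j' := ⌊(θ : ℝ) ^ (m + 1) * a⌋₊ with hj'
  have e : gridFloor θ m a = ((θ * j : ℕ) : ℝ) / (θ : ℝ) ^ (m + 1) := by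
    unfold gridFloor
    push_cast
    rw [pow_succ', mul_div_mul_left _ _ hθ'.ne']
  have hpos : 0 ≤ (θ : ℝ) ^ m * a := mul_nonneg h0.le ha.1
  have hpos' : 0 ≤ (θ : ℝ) ^ (m + 1) * a := mul_nonneg (by positivity) ha.1
  have l1 : θ * j ≤ j' := by
    rw [hj', Nat.le_floor_iff hpos']
    push_cast
    rw [pow_succ', mul_assoc]
    exact mul_le_mul_of_nonneg_left (Nat.floor_le hpos) hθ'.le
  have l2 : j' ≤ θ * j + θ := by
    have : j' < θ * j + θ := by
      rw [hj', Nat.floor_lt hpos']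
      push_cast
      rw [pow_succ', mul_assoc]
      have := mul_lt_mul_of_pos_left (Nat.lt_floor_add_one ((θ : ℝ) ^ m * a)) hθ'
      linarith
    exact this.le
  have e' : gridFloor θ (m + 1) a = (j' : ℝ) / (θ : ℝ) ^ (m + 1) := rfl
  rw [e, e', ergSum_cent_grid hθ, ergSum_cent_grid hθ, ← Finset.sum_Ico_eq_sub _ l1]
  have hτ : 0 ≤ τ := (abs_nonneg _).trans (h 0 (by positivity))
  have hlt : j' < θ ^ (m + 1) := floor_lt_pow hθ (m + 1) ha
  calc |∑ i ∈ Finset.Ico (θ * j) j', ergSum θ (cell θ (m + 1) i) N x|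
      ≤ ∑ i ∈ Finset.Ico (θ * j) j', τ := (Finset.abs_sum_le_sum_abs _ _).trans
        (Finset.sum_le_sum fun i hi => h i ((Finset.mem_Ico.1 hi).2.trans hlt))
    _ = ((j' - θ * j : ℕ) : ℝ) * τ := by simp
    _ ≤ θ * τ := mul_le_mul_of_nonneg_right (by exact_mod_cast (by lia : j' - θ * j ≤ θ)) hτ

lemma abs_ergSum_sub_gridFloor_le {θ : ℕ} (hθ : 0 < θ) {m N : ℕ} {x a : ℝ}
    (ha : a ∈ Set.Ico (0 : ℝ) 1) :
    |ergSum θ (cent a) N x - ergSum θ (cent (gridFloor θ m a)) N x| ≤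
      |ergSum θ (cell θ m ⌊(θ : ℝ) ^ m * a⌋₊) N x| + N * ((θ : ℝ) ^ m)⁻¹ := by
  have h0 : (0 : ℝ) < (θ : ℝ) ^ m := by positivity
  set p : ℝ := ((θ : ℝ) ^ m)⁻¹ with hp
  set b := gridFloor θ m a with hb
  have hba : b ≤ a := gridFloor_le hθ m ha.1
  have hab : a < b + p := lt_gridFloor_add hθ m a
  have hp0 : 0 < p := by positivity
  have key : ∀ y : ℝ, 0 ≤ y → -p ≤ cent a y - cent b y ∧
      cent a y - cent b y ≤ cell θ m ⌊(θ : ℝ) ^ m * a⌋₊ y + p := by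
    intro y hy
    rw [cent_of_nonneg _ hy, cent_of_nonneg _ hy]
    unfold cell
    rw [← hp]
    by_cases h1 : y < b
    · have h2 : y < a := h1.trans_le hba
      simp only [h1, h2, if_true]
      split_ifs <;> constructor <;> linarith
    · by_cases h2 : y < a
      · have h3 : ⌊(θ : ℝ) ^ m * y⌋ = (⌊(θ : ℝ) ^ m * a⌋₊ : ℤ) := by
          rw [Int.floor_eq_iff]
          constructor
          · have := not_lt.1 h1
            rw [hb, gridFloor, div_le_iff₀ h0] at this
            push_cast
            linarith
          · push_cast
            exact (mul_lt_mul_of_pos_left h2 h0).trans (Nat.lt_floor_add_one _)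
        simp only [h1, h2, h3, if_true, if_false]
        constructor <;> linarith
      · simp only [h1, h2, if_false]
        split_ifs <;> constructor <;> linarith
  have e : ergSum θ (cent a) N x - ergSum θ (cent b) N x =
      ∑ k ∈ Finset.range N, (cent a (shift θ k x) - cent b (shift θ k x)) := by
    simp only [ergSum, Finset.sum_sub_distrib]
  have up : ergSum θ (cent a) N x - ergSum θ (cent b) N x ≤
      ergSum θ (cell θ m ⌊(θ : ℝ) ^ m * a⌋₊) N x + N * p := by
    rw [e]
    refine (Finset.sum_le_sum fun k _ => (key _ (shift_nonneg θ k x)).2).trans (le_of_eq ?_)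
    simp [ergSum, Finset.sum_add_distrib]
  have lo : -(N * p) ≤ ergSum θ (cent a) N x - ergSum θ (cent b) N x := by
    rw [e]
    refine le_trans (le_of_eq ?_) (Finset.sum_le_sum fun k _ => (key _ (shift_nonneg θ k x)).1)
    simp
  rw [abs_le]
  have := le_abs_self (ergSum θ (cell θ m ⌊(θ : ℝ) ^ m * a⌋₊) N x)
  have := abs_nonneg (ergSum θ (cell θ m ⌊(θ : ℝ) ^ m * a⌋₊) N x)
  constructor <;> linarith

lemma abs_ergSum_sub_gridFloor_le_sum {θ : ℕ} (hθ : 0 < θ) {M N : ℕ} {x : ℝ} {τ : ℕ → ℝ}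
    (h : ∀ m, 0 < m → m ≤ M → ∀ i < θ ^ m, |ergSum θ (cell θ m i) N x| ≤ τ m) {a : ℝ}
    (ha : a ∈ Set.Ico (0 : ℝ) 1) {m₀ : ℕ} (hm₀ : m₀ < M) :
    |ergSum θ (cent a) N x - ergSum θ (cent (gridFloor θ m₀ a)) N x| ≤
      (∑ m ∈ Finset.Ico m₀ M, (θ + 1) * τ (m + 1)) + N * ((θ : ℝ) ^ M)⁻¹ := by
  have hτ : ∀ m, 0 < m → m ≤ M → 0 ≤ τ m := fun m h1 h2 =>
    (abs_nonneg _).trans (h m h1 h2 0 (by positivity))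
  have h1 : ∀ n, m₀ ≤ n → n ≤ M →
      |ergSum θ (cent (gridFloor θ n a)) N x - ergSum θ (cent (gridFloor θ m₀ a)) N x| ≤
        ∑ m ∈ Finset.Ico m₀ n, θ * τ (m + 1) := by
    intro n hn
    induction n, hn using Nat.le_induction with
    | base => simp
    | succ n hn ih =>
      intro hM
      rw [Finset.sum_Ico_succ_top hn]
      have := abs_ergSum_gridFloor_succ_sub_le (m := n) hθ ha (h (n + 1) n.succ_pos hM)
      have := ih (by lia)
      have := abs_sub_le (ergSum θ (cent (gridFloor θ (n + 1) a)) N x)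
        (ergSum θ (cent (gridFloor θ n a)) N x) (ergSum θ (cent (gridFloor θ m₀ a)) N x)
      linarith
  have h2 := h1 M hm₀.le le_rfl
  have h3 := abs_ergSum_sub_gridFloor_le (m := M) (N := N) (x := x) hθ ha
  have h4 := h M (by lia) le_rfl _ (floor_lt_pow hθ M ha)
  have h5 := abs_sub_le (ergSum θ (cent a) N x)
        (ergSum θ (cent (gridFloor θ M a)) N x) (ergSum θ (cent (gridFloor θ m₀ a)) N x)
  have h6 : τ M ≤ ∑ m ∈ Finset.Ico m₀ M, τ (m + 1) := by
    have := Finset.single_le_sum (f := fun m => τ (m + 1)) (s := Finset.Ico m₀ M) (fun m hm =>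
      hτ (m + 1) m.succ_pos (Finset.mem_Ico.1 hm).2)
      (Finset.mem_Ico.2 ⟨by lia, by lia⟩ : M - 1 ∈ Finset.Ico m₀ M)
    simpa [Nat.sub_add_cancel (by lia : 1 ≤ M)] using this
  simp only [add_mul, one_mul, Finset.sum_add_distrib]
  linarith

lemma sum_half_pow_le (M : ℕ) : ∑ m ∈ Finset.Icc 1 M, (1 / 2 : ℝ) ^ m ≤ 1 := by
  have : ∑ m ∈ Finset.Icc 1 M, (1 / 2 : ℝ) ^ m = 1 - (1 / 2) ^ M := by
    induction M with
    | zero => simp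
    | succ M ih => rw [Finset.sum_Icc_succ_top (by lia), ih, pow_succ]; ring
  rw [this]
  have : (0 : ℝ) ≤ (1 / 2) ^ M := by positivity
  linarith

/-- The chaining thresholds. -/
noncomputable def threshold (θ : ℕ) (m : ℕ) : ℝ := 2 * θ * m * (√(θ : ℝ))⁻¹ ^ m

lemma exists_chaining_set {θ : ℕ} (hθ : 2 ≤ θ) {N : ℕ} (hN : 0 < N) {s : ℝ} (hs : 1 ≤ s) {M : ℕ}
    (hM : θ * M * s * √(θ : ℝ) ^ M ≤ √N) :
    ∃ B : Set ℝ, MeasurableSet B ∧ unif.real B ≤ 6 * Real.exp (-s ^ 2) ∧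
      ∀ x ∉ B, ∀ a ∈ Set.Ico (0 : ℝ) 1, ∀ m₀ < M,
        |ergSum θ (cent a) N x - ergSum θ (cent (gridFloor θ m₀ a)) N x| ≤
          (∑ m ∈ Finset.Ico m₀ M, (θ + 1) * threshold θ (m + 1)) * (s * √N) +
            N * ((θ : ℝ) ^ M)⁻¹ := by
  have hθ0 : 0 < θ := by lia
  have hθ' : (2 : ℝ) ≤ θ := by exact_mod_cast hθ
  have hq : 0 < √(θ : ℝ) := Real.sqrt_pos.2 (by positivity)
  have hq2 : √(θ : ℝ) ^ 2 = θ := Real.sq_sqrt (by positivity)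
  have hq1 : 1 ≤ √(θ : ℝ) := Real.one_le_sqrt.2 (by linarith)
  have hN' : (0 : ℝ) < N := by positivity
  have hNs : √(N : ℝ) ^ 2 = N := Real.sq_sqrt hN'.le
  have hNp : 0 < √(N : ℝ) := Real.sqrt_pos.2 hN'
  set τ : ℕ → ℝ := fun m => threshold θ m * (s * √N) with hτ
  have hτ0 : ∀ m, 0 ≤ τ m := fun m => by simp only [hτ, threshold]; positivity
  refine ⟨⋃ m ∈ Finset.Icc 1 M, ⋃ i ∈ Finset.range (θ ^ m),
    {x | τ m ≤ |ergSum θ (cell θ m i) N x|}, ?_, ?_, ?_⟩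
  · refine Finset.measurableSet_biUnion _ fun m _ => Finset.measurableSet_biUnion _ fun i _ => ?_
    exact measurableSet_le measurable_const ((bddMeas_cell hθ0 m i).ergSum θ N).meas.abs
  · have hterm : ∀ m ∈ Finset.Icc 1 M, unif.real (⋃ i ∈ Finset.range (θ ^ m),
        {x | τ m ≤ |ergSum θ (cell θ m i) N x|}) ≤ 6 * Real.exp (-s ^ 2) * (1 / 2) ^ m := by
      intro m hm
      obtain ⟨hm1, hmM⟩ := Finset.mem_Icc.1 hm
      have hm1' : (1 : ℝ) ≤ m := by exact_mod_cast hm1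
      have hcond : τ m * (θ : ℝ) ^ m ≤ 2 * N := by
        have e : τ m * (θ : ℝ) ^ m = 2 * √N * (θ * m * s * √(θ : ℝ) ^ m) := by
          simp only [hτ, threshold]
          have : (θ : ℝ) ^ m = √(θ : ℝ) ^ m * √(θ : ℝ) ^ m := by rw [← mul_pow, ← sq, hq2]
          rw [this, inv_pow]
          field_simp
        have : θ * m * s * √(θ : ℝ) ^ m ≤ √N := by
          refine le_trans ?_ hM
          gcongr
        rw [e]
        calc _ ≤ 2 * √N * √N := mul_le_mul_of_nonneg_left this (by positivity)
          _ = 2 * N := by rw [mul_assoc, ← sq, hNs]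
      have hi : ∀ i ∈ Finset.range (θ ^ m), unif.real {x | τ m ≤ |ergSum θ (cell θ m i) N x|} ≤
          6 * Real.exp (-(θ ^ 2 * m * s ^ 2)) := by
        intro i hi
        refine (measureReal_ergSum_cell_le hθ0 hm1 (Finset.mem_range.1 hi) hN (hτ0 m) hcond).trans
          (le_of_eq ?_)
        congr 3
        simp only [hτ, threshold]
        have : (θ : ℝ) ^ m = √(θ : ℝ) ^ m * √(θ : ℝ) ^ m := by rw [← mul_pow, ← sq, hq2]
        rw [this, mul_pow (_ * _), mul_pow s, hNs, inv_pow]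
        field_simp
        norm_num
      refine (measureReal_biUnion_finset_le _ _).trans ((Finset.sum_le_sum hi).trans ?_)
      rw [Finset.sum_const, Finset.card_range, nsmul_eq_mul]
      have h1 : ((θ ^ m : ℕ) : ℝ) ≤ Real.exp (θ * m) := by
        push_cast
        rw [mul_comm, Real.exp_nat_mul]
        exact pow_le_pow_left₀ (by positivity) (by linarith [Real.add_one_le_exp (θ : ℝ)]) m
      have h2 : Real.exp (-(m : ℝ)) ≤ (1 / 2) ^ m := by
        rw [← mul_one (m : ℝ), ← mul_neg, Real.exp_nat_mul]
        refine pow_le_pow_left₀ (exp_pos _).le ?_ m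
        rw [Real.exp_neg, one_div]
        exact inv_anti₀ (by norm_num) (by linarith [Real.add_one_le_exp (1 : ℝ)])
      have h3 : θ * m + -(θ ^ 2 * m * s ^ 2) ≤ -s ^ 2 + -(m : ℝ) := by
        have a1 : (1 : ℝ) ≤ s ^ 2 := one_le_pow₀ hs
        have a2 : (θ : ℝ) + 2 ≤ θ ^ 2 := by nlinarith
        have a3 : ((θ : ℝ) + 2) * (m * s ^ 2) ≤ θ ^ 2 * (m * s ^ 2) :=
          mul_le_mul_of_nonneg_right a2 (by positivity)
        have a4 : (m : ℝ) ≤ m * s ^ 2 := le_mul_of_one_le_right (by positivity) a1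
        have a5 : s ^ 2 ≤ m * s ^ 2 := le_mul_of_one_le_left (by positivity) hm1'
        have a6 : (θ : ℝ) * m ≤ θ * (m * s ^ 2) := mul_le_mul_of_nonneg_left a4 (by positivity)
        nlinarith
      calc ((θ ^ m : ℕ) : ℝ) * (6 * Real.exp (-(θ ^ 2 * m * s ^ 2)))
          ≤ Real.exp (θ * m) * (6 * Real.exp (-(θ ^ 2 * m * s ^ 2))) :=
            mul_le_mul_of_nonneg_right h1 (by positivity)
        _ = 6 * Real.exp (θ * m + -(θ ^ 2 * m * s ^ 2)) := by rw [Real.exp_add]; ring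
        _ ≤ 6 * Real.exp (-s ^ 2 + -(m : ℝ)) := by gcongr
        _ = 6 * Real.exp (-s ^ 2) * Real.exp (-(m : ℝ)) := by rw [Real.exp_add]; ring
        _ ≤ _ := mul_le_mul_of_nonneg_left h2 (by positivity)
    refine (measureReal_biUnion_finset_le _ _).trans ((Finset.sum_le_sum hterm).trans ?_)
    rw [← Finset.mul_sum]
    exact mul_le_of_le_one_right (by positivity) (sum_half_pow_le M)
  · intro x hx a ha m₀ hm₀
    have := abs_ergSum_sub_gridFloor_le_sum (τ := τ) hθ0 (N := N) (x := x) (M := M)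
      (fun m h1 h2 i hi => by
        by_contra! hc
        refine hx (Set.mem_biUnion (x := m) (Finset.mem_Icc.2 ⟨h1, h2⟩)
          (Set.mem_biUnion (x := i) (Finset.mem_range.2 hi) hc.le))) ha hm₀
    refine this.trans (le_of_eq ?_)
    rw [Finset.sum_mul]
    simp only [hτ, mul_assoc]

/-- The constant in the chaining estimate with initial scale `m₀`. -/
noncomputable def chainTail (θ m₀ : ℕ) : ℝ := ∑' m, (θ + 1) * threshold θ (m + m₀ + 1)

lemma threshold_nonneg (θ m : ℕ) : 0 ≤ threshold θ m := by unfold threshold; positivity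

lemma summable_threshold {θ : ℕ} (hθ : 2 ≤ θ) : Summable fun m => (θ + 1) * threshold θ m := by
  have hθ' : (2 : ℝ) ≤ θ := by exact_mod_cast hθ
  have h1 : 1 < √(θ : ℝ) := by rw [Real.lt_sqrt] <;> linarith
  have : ‖(√(θ : ℝ))⁻¹‖ < 1 := by
    rw [Real.norm_of_nonneg (by positivity)]
    exact inv_lt_one_of_one_lt₀ h1
  have := summable_pow_mul_geometric_of_norm_lt_one 1 this
  refine (this.mul_left (((θ : ℝ) + 1) * (2 * θ))).congr fun m => ?_
  simp only [threshold]
  ring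

lemma chainTail_nonneg (θ m₀ : ℕ) : 0 ≤ chainTail θ m₀ :=
  tsum_nonneg fun m => mul_nonneg (by positivity) (threshold_nonneg θ _)

lemma tendsto_chainTail (θ : ℕ) : Tendsto (chainTail θ) atTop (nhds 0) :=
  tendsto_sum_nat_add fun m => (θ + 1) * threshold θ (m + 1)

lemma sum_threshold_le {θ : ℕ} (hθ : 2 ≤ θ) (m₀ M : ℕ) :
    ∑ m ∈ Finset.Ico m₀ M, (θ + 1) * threshold θ (m + 1) ≤ chainTail θ m₀ := by
  rw [Finset.sum_Ico_eq_sum_range]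
  have hs : Summable fun m => (θ + 1) * threshold θ (m + m₀ + 1) :=
    (summable_nat_add_iff (m₀ + 1)).2 (summable_threshold hθ)
  refine le_trans (le_of_eq ?_) (hs.sum_le_tsum (Finset.range (M - m₀))
    fun m _ => mul_nonneg (by positivity) (threshold_nonneg θ _))
  exact Finset.sum_congr rfl fun m _ => by rw [add_comm m₀]

lemma eventually_log_le (C : ℝ) : ∀ᶠ N : ℕ in atTop, C * log N ^ 3 * √√(N : ℝ) ≤ √N := by
  have ht : Tendsto (fun N : ℕ => √√(N : ℝ)) atTop atTop :=
    Real.tendsto_sqrt_atTop.comp (Real.tendsto_sqrt_atTop.comp tendsto_natCast_atTop_atTop)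
  have h := (Real.isLittleO_pow_log_id_atTop (n := 3)).bound
    (c := (64 * (|C| + 1))⁻¹) (by positivity)
  filter_upwards [ht.eventually h, eventually_ge_atTop 1] with N hN h1
  have h0 : (0 : ℝ) < N := by exact_mod_cast h1
  have e1 : log √√(N : ℝ) = log N / 4 := by
    rw [Real.log_sqrt (by positivity), Real.log_sqrt h0.le]; ring
  have e2 : √(N : ℝ) = √√(N : ℝ) * √√(N : ℝ) := (Real.mul_self_sqrt (by positivity)).symm
  rw [e1, id, Real.norm_of_nonneg (by have := Real.log_natCast_nonneg N; positivity), 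
    Real.norm_of_nonneg (by positivity), ← div_eq_inv_mul, le_div_iff₀ (by positivity)] at hN
  conv_rhs => rw [e2]
  refine mul_le_mul_of_nonneg_right ?_ (by positivity)
  have h3 : (0 : ℝ) ≤ log N ^ 3 := by have := Real.log_natCast_nonneg N; positivity
  have := mul_le_mul_of_nonneg_right (le_abs_self C) h3
  nlinarith

lemma exists_chaining {θ : ℕ} (hθ : 2 ≤ θ) (m₀ : ℕ) :
    ∃ N₀ : ℕ, ∀ N ≥ N₀, ∀ s : ℝ, 1 ≤ s → s ≤ log N ^ 2 →
      ∃ B : Set ℝ, MeasurableSet B ∧ unif.real B ≤ 6 * Real.exp (-s ^ 2) ∧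
        ∀ x ∉ B, ∀ a ∈ Set.Ico (0 : ℝ) 1,
          |ergSum θ (cent a) N x - ergSum θ (cent (gridFloor θ m₀ a)) N x| ≤
            chainTail θ m₀ * (s * √N) + θ * √N := by
  have hθ' : (2 : ℝ) ≤ θ := by exact_mod_cast hθ
  obtain ⟨N₁, hN₁⟩ := eventually_atTop.1 (eventually_log_le θ)
  refine ⟨max N₁ ((θ ^ (m₀ + 1)) ^ 2), fun N hN s hs1 hs2 => ?_⟩
  have hNpos : 0 < N := lt_of_lt_of_le (by positivity) (le_trans (le_max_right _ _) hN)
  set R := Nat.sqrt N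
  have hR : θ ^ (m₀ + 1) ≤ R := by
    rw [Nat.le_sqrt']; exact (le_max_right _ _).trans hN
  have hR0 : R ≠ 0 := by
    have : 0 < θ ^ (m₀ + 1) := by positivity
    lia
  set M := Nat.log θ R
  have hM1 : θ ^ M ≤ R := Nat.pow_log_le_self θ hR0
  have hM2 : R < θ ^ (M + 1) := Nat.lt_pow_succ_log_self (by lia) R
  have hm₀ : m₀ < M := (Nat.le_log_iff_pow_le (by lia) hR0).2 hR
  have hRs : (R : ℝ) ≤ √N := Real.nat_sqrt_le_real_sqrt
  have hsR : √N ≤ (θ : ℝ) ^ (M + 1) := by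
    refine Real.real_sqrt_le_nat_sqrt_succ.trans ?_
    exact_mod_cast hM2
  have hM1' : (θ : ℝ) ^ M ≤ √N := le_trans (by exact_mod_cast hM1) hRs
  have hq : √(θ : ℝ) ^ M ≤ √√N := by
    refine Real.le_sqrt_of_sq_le ?_
    rw [← pow_mul, mul_comm, pow_mul, Real.sq_sqrt (by positivity)]
    exact hM1'
  have hML : (M : ℝ) ≤ log N := by
    have h1 : (2 : ℝ) ^ M ≤ √N := le_trans (pow_le_pow_left₀ (by norm_num) hθ' M) hM1'
    have h2 := Real.log_le_log (by positivity) h1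
    rw [Real.log_pow, Real.log_sqrt (by positivity)] at h2
    have := Real.log_two_gt_d9
    have h0 : (0 : ℝ) ≤ M := by positivity
    nlinarith
  have hcond : θ * M * s * √(θ : ℝ) ^ M ≤ √N := by
    have h1 := hN₁ N ((le_max_left _ _).trans hN)
    refine le_trans ?_ h1
    have : (0 : ℝ) ≤ log N := Real.log_natCast_nonneg N
    calc θ * M * s * √(θ : ℝ) ^ M ≤ θ * log N * log N ^ 2 * √√N := by gcongr
      _ = _ := by ring
  obtain ⟨B, hB, hBm, h⟩ := exists_chaining_set hθ hNpos hs1 hcond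
  refine ⟨B, hB, hBm, fun x hx a ha => (h x hx a ha m₀ hm₀).trans ?_⟩
  refine add_le_add (mul_le_mul_of_nonneg_right (sum_threshold_le hθ m₀ M) (by positivity)) ?_
  rw [← div_eq_mul_inv, div_le_iff₀ (by positivity)]
  have e : (N : ℝ) = √N * √N := (Real.mul_self_sqrt (by positivity)).symm
  calc (N : ℝ) = √N * √N := e
    _ ≤ √N * (θ : ℝ) ^ (M + 1) := by gcongr
    _ = _ := by rw [pow_succ]; ring

lemma abs_ergSum_le_card (θ : ℕ) {f : ℝ → ℝ} (hf : ∀ y, |f y| ≤ 1) (n : ℕ) (x : ℝ) :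
    |ergSum θ f n x| ≤ n := by
  unfold ergSum
  refine (Finset.abs_sum_le_sum_abs _ _).trans ((Finset.sum_le_sum fun k _ => hf _).trans ?_)
  simp

lemma abs_ergSum_le_dyadic {θ : ℕ} {f : ℝ → ℝ} {x : ℝ} (hf : ∀ y, |f y| ≤ 1) {J j₀ : ℕ}
    (hj : j₀ ≤ J) {τ : ℕ → ℝ} (hτ : ∀ j, j₀ ≤ j → j < J → ∀ i < 2 ^ (J - j),
      |ergSum θ f (2 ^ j) (shift θ (i * 2 ^ j) x)| ≤ τ j) {l : ℕ} (hl : l < 2 ^ J) :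
    |ergSum θ f l x| ≤ 2 ^ j₀ + ∑ j ∈ Finset.Ico j₀ J, τ j := by
  set A : ℕ → ℝ := fun j => |ergSum θ f (l / 2 ^ j * 2 ^ j) x| with hA
  have step : ∀ j, j₀ ≤ j → j < J → A j ≤ A (j + 1) + τ j := by
    intro j h1 h2
    have hq : l / 2 ^ (j + 1) = l / 2 ^ j / 2 := by rw [pow_succ, Nat.div_div_eq_div_mul]
    have hlt : l / 2 ^ j < 2 ^ (J - j) := by
      rw [Nat.div_lt_iff_lt_mul (by positivity), ← pow_add, Nat.sub_add_cancel h2.le]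
      exact hl
    set i := l / 2 ^ j with hi
    have hmod := Nat.div_add_mod i 2
    have hτ' := hτ j h1 h2 (2 * (i / 2)) (by lia)
    have e1 : l / 2 ^ (j + 1) * 2 ^ (j + 1) = 2 * (i / 2) * 2 ^ j := by rw [hq, pow_succ]; ring
    simp only [hA]
    rw [← hi, e1]
    rcases Nat.mod_two_eq_zero_or_one i with h | h
    · have e2 : i = 2 * (i / 2) := by lia
      rw [← e2]
      have := (abs_nonneg _).trans hτ'
      linarith
    · have e2 : i * 2 ^ j = 2 * (i / 2) * 2 ^ j + 2 ^ j := by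
        rw [h] at hmod
        nth_rewrite 1 [← hmod]
        ring
      rw [e2, ergSum_add]
      exact (abs_add_le _ _).trans (by linarith)
  have main : ∀ j, j₀ ≤ j → j ≤ J → A j₀ ≤ A j + ∑ k ∈ Finset.Ico j₀ j, τ k := by
    intro j h1
    induction j, h1 using Nat.le_induction with
    | base => simp
    | succ n hn ih =>
      intro h
      rw [Finset.sum_Ico_succ_top hn]
      have := ih (by lia)
      have := step n hn (by lia)
      linarith
  have hJ := main J hj le_rfl
  have h0 : A J = 0 := by simp [hA, Nat.div_eq_of_lt hl, ergSum]
  have e : l = l / 2 ^ j₀ * 2 ^ j₀ + l % 2 ^ j₀ := by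
    rw [mul_comm]; exact (Nat.div_add_mod l _).symm
  have h3 : |ergSum θ f l x| ≤
      A j₀ + |ergSum θ f (l % 2 ^ j₀) (shift θ (l / 2 ^ j₀ * 2 ^ j₀) x)| := by
    conv_lhs => rw [e, ergSum_add]
    exact abs_add_le _ _
  have h4 := abs_ergSum_le_card θ hf (l % 2 ^ j₀) (shift θ (l / 2 ^ j₀ * 2 ^ j₀) x)
  have h5 : ((l % 2 ^ j₀ : ℕ) : ℝ) ≤ 2 ^ j₀ := by
    exact_mod_cast (Nat.mod_lt l (by positivity)).le
  linarith

lemma gridFloor_zero (θ : ℕ) {a : ℝ} (ha : a ∈ Set.Ico (0 : ℝ) 1) : gridFloor θ 0 a = 0 := by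
  have := ha.2
  simp [gridFloor, Nat.floor_eq_zero.2 this]

lemma cent_zero (y : ℝ) : cent 0 y = 0 := by simp [cent]

lemma exists_sup_bound {θ : ℕ} (hθ : 2 ≤ θ) :
    ∃ C : ℝ, 0 < C ∧ ∃ N₀ : ℕ, ∀ N ≥ N₀, ∀ s : ℝ, 1 ≤ s → s ≤ log N ^ 2 →
      ∃ B : Set ℝ, MeasurableSet B ∧ unif.real B ≤ 6 * Real.exp (-s ^ 2) ∧
        ∀ x ∉ B, ∀ a ∈ Set.Ico (0 : ℝ) 1, |ergSum θ (cent a) N x| ≤ C * (s * √N) := by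
  obtain ⟨N₀, h⟩ := exists_chaining hθ 0
  refine ⟨chainTail θ 0 + θ, by have := chainTail_nonneg θ 0; positivity, N₀,
    fun N hN s h1 h2 => ?_⟩
  obtain ⟨B, hB, hBm, hx⟩ := h N hN s h1 h2
  refine ⟨B, hB, hBm, fun x hxB a ha => ?_⟩
  have := hx x hxB a ha
  have e : ergSum θ (cent 0) N x = 0 := by simp [ergSum, cent_zero]
  rw [gridFloor_zero θ ha, e, sub_zero] at this
  have h3 : √(N : ℝ) ≤ s * √N := le_mul_of_one_le_left (by positivity) h1
  have h4 := mul_le_mul_of_nonneg_left h3 (Nat.cast_nonneg (α := ℝ) θ)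
  rw [add_mul]
  linarith

lemma measureReal_preimage_shift {θ : ℕ} (hθ : 0 < θ) (k : ℕ) {B : Set ℝ} (hB : MeasurableSet B) :
    unif.real (shift θ k ⁻¹' B) = unif.real B := by
  rw [Measure.real, Measure.real,
    (measurePreserving_shift hθ k).measure_preimage hB.nullMeasurableSet]

lemma exists_maximal_bound {θ : ℕ} (hθ : 2 ≤ θ) :
    ∃ C : ℝ, 0 < C ∧ ∃ J₀ : ℕ, ∀ J ≥ J₀,
      ∃ B : Set ℝ, MeasurableSet B ∧ unif.real B ≤ 6 * ((J : ℝ) ^ 2)⁻¹ ∧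
        ∀ x ∉ B, ∀ a ∈ Set.Ico (0 : ℝ) 1, ∀ l < 2 ^ J,
          |ergSum θ (cent a) l x| ≤ C * √(2 ^ J * log J) := by
  have hθ0 : 0 < θ := by lia
  obtain ⟨C₀, hC₀, N₀, h⟩ := exists_sup_bound hθ
  set q : ℝ := √2 with hq
  have hq0 : 0 < q := by positivity
  have hq1 : 1 < q := by rw [hq, Real.lt_sqrt] <;> norm_num
  have hqs : Summable fun d : ℕ => 2 * (1 + (d : ℝ)) * q⁻¹ ^ d := by
    have hn : ‖q⁻¹‖ < 1 := by
      rw [Real.norm_of_nonneg (by positivity)]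
      exact inv_lt_one_of_one_lt₀ hq1
    refine (((summable_pow_mul_geometric_of_norm_lt_one 0 hn).add
      (summable_pow_mul_geometric_of_norm_lt_one 1 hn)).mul_left 2).congr fun d => ?_
    ring
  set C₁ := ∑' d : ℕ, 2 * (1 + (d : ℝ)) * q⁻¹ ^ d with hC₁
  have hC₁0 : 0 ≤ C₁ := tsum_nonneg fun d => by positivity
  refine ⟨C₀ * C₁ + 1, by positivity, max 10000 (2 * N₀ + 2), fun J hJ => ?_⟩
  have hJ1 : 10000 ≤ J := (le_max_left _ _).trans hJ
  have hJ2 : 2 * N₀ + 2 ≤ J := (le_max_right _ _).trans hJ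
  have hJ1' : (10000 : ℝ) ≤ J := by exact_mod_cast hJ1
  have hL1 : 1 ≤ log J := by
    rw [Real.le_log_iff_exp_le (by positivity)]
    linarith [Real.exp_one_lt_d9]
  have hLs : 1 ≤ √(log J) := Real.one_le_sqrt.2 hL1
  set s : ℕ → ℝ := fun j => 2 * (1 + ((J - j : ℕ) : ℝ)) * √(log J) with hs
  have hblock : ∀ j, J / 2 ≤ j → ∃ B : Set ℝ, MeasurableSet B ∧
      unif.real B ≤ 6 * Real.exp (-s j ^ 2) ∧
        ∀ x ∉ B, ∀ a ∈ Set.Ico (0 : ℝ) 1, |ergSum θ (cent a) (2 ^ j) x| ≤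
          C₀ * (s j * q ^ j) := by
    intro j hj
    have e : q ^ j = √((2 ^ j : ℕ) : ℝ) := by
      push_cast
      rw [hq, Real.sqrt_eq_rpow, Real.sqrt_eq_rpow, ← Real.rpow_natCast, ← Real.rpow_natCast,
        ← Real.rpow_mul (by norm_num), ← Real.rpow_mul (by norm_num), mul_comm]
    rw [e]
    refine h (2 ^ j) ?_ (s j) ?_ ?_
    · exact le_trans (by lia) (Nat.lt_two_pow_self (n := j)).le
    · have : (0 : ℝ) ≤ ((J - j : ℕ) : ℝ) := by positivity
      simp only [hs]
      nlinarith
    · push_cast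
      rw [Real.log_pow]
      have h1 : s j ≤ 2 * (1 + J) * √J := by
        simp only [hs]
        gcongr
        · exact_mod_cast Nat.sub_le _ _
        · exact (Real.log_le_sub_one_of_pos (by linarith)).trans (by linarith)
      have h2 : (J : ℝ) - 1 ≤ 2 * j := by
        have : J ≤ 2 * j + 1 := by lia
        have : (J : ℝ) ≤ 2 * j + 1 := by exact_mod_cast this
        linarith
      have h3 : (100 : ℝ) ≤ √J := Real.le_sqrt_of_sq_le (by norm_num; linarith)
      have h4 : √(J : ℝ) * √J = J := Real.mul_self_sqrt (by positivity)
      have h5 := Real.log_two_gt_d9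
      have h6 : (J - 1 : ℝ) / 3 ≤ j * log 2 := by nlinarith
      have h7 : ((J - 1 : ℝ) / 3) ^ 2 ≤ (j * log 2) ^ 2 := pow_le_pow_left₀ (by linarith) h6 2
      have h8 : √(J : ℝ) * 100 ≤ J := by nlinarith
      have h9 : 2 * (1 + J) * √J * 100 ≤ 2 * (1 + J) * (J : ℝ) := by nlinarith
      nlinarith
  choose! D hDm hDμ hD using hblock
  refine ⟨⋃ j ∈ Finset.Ico (J / 2) J, ⋃ i ∈ Finset.range (2 ^ (J - j)),
    shift θ (i * 2 ^ j) ⁻¹' D j, ?_, ?_, ?_⟩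
  · refine Finset.measurableSet_biUnion _ fun j hj => Finset.measurableSet_biUnion _ fun i _ => ?_
    exact measurable_shift θ _ (hDm j (Finset.mem_Ico.1 hj).1)
  · have hterm : ∀ j ∈ Finset.Ico (J / 2) J, unif.real (⋃ i ∈ Finset.range (2 ^ (J - j)),
        shift θ (i * 2 ^ j) ⁻¹' D j) ≤ 6 * ((J : ℝ) ^ 2)⁻¹ * (1 / 2) ^ (J - j) := by
      intro j hj
      obtain ⟨hj1, hj2⟩ := Finset.mem_Ico.1 hj
      refine (measureReal_biUnion_finset_le _ _).trans ?_
      simp only [measureReal_preimage_shift hθ0 _ (hDm j hj1)]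
      rw [Finset.sum_const, Finset.card_range, nsmul_eq_mul]
      set d := J - j with hd
      have hd1 : (1 : ℝ) ≤ d := by exact_mod_cast (by lia : 1 ≤ d)
      have a1 : Real.exp (-s j ^ 2) ≤ ((J : ℝ) ^ 2)⁻¹ * (1 / 4) ^ d := by
        have e1 : ((J : ℝ) ^ 2)⁻¹ = Real.exp (-(2 * log J)) := by
          rw [Real.exp_neg, mul_comm, Real.exp_mul, Real.exp_log (by linarith)]
          norm_num
        have e2 : Real.exp (-(2 * (d : ℝ))) ≤ (1 / 4) ^ d := by
          rw [show -(2 * (d : ℝ)) = d * (-2) by ring, Real.exp_nat_mul]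
          refine pow_le_pow_left₀ (exp_pos _).le ?_ d
          rw [Real.exp_neg, one_div]
          refine inv_anti₀ (by norm_num) ?_
          have := Real.add_one_le_exp (1 : ℝ)
          have e3 : Real.exp (2 : ℝ) = Real.exp 1 * Real.exp 1 := by rw [← Real.exp_add]; norm_num
          nlinarith
        have e4 : s j ^ 2 = 4 * (1 + (d : ℝ)) ^ 2 * log J := by
          simp only [hs]
          rw [mul_pow, Real.sq_sqrt (by linarith)]; ring
        rw [e1]
        refine le_trans ?_ (mul_le_mul_of_nonneg_left e2 (exp_pos _).le)
        rw [← Real.exp_add, Real.exp_le_exp, e4]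
        have e5 : (0 : ℝ) ≤ 4 * (1 + (d : ℝ)) ^ 2 - 2 := by nlinarith
        have e6 := le_mul_of_one_le_right e5 hL1
        nlinarith
      calc ((2 ^ d : ℕ) : ℝ) * unif.real (D j)
          ≤ ((2 ^ d : ℕ) : ℝ) * (6 * (((J : ℝ) ^ 2)⁻¹ * (1 / 4) ^ d)) := by
            gcongr
            exact (hDμ j hj1).trans (by linarith)
        _ = 6 * ((J : ℝ) ^ 2)⁻¹ * (1 / 2) ^ d := by
            push_cast
            rw [show (1 / 2 : ℝ) ^ d = 2 ^ d * (1 / 4) ^ d by rw [← mul_pow]; norm_num]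
            ring
    refine (measureReal_biUnion_finset_le _ _).trans ((Finset.sum_le_sum hterm).trans ?_)
    rw [← Finset.mul_sum]
    refine mul_le_of_le_one_right (by positivity) ?_
    refine le_trans (le_of_eq ?_) (sum_half_pow_le (J - J / 2))
    refine Finset.sum_nbij' (fun j => J - j) (fun d => J - d) ?_ ?_ ?_ ?_ ?_ <;>
      intro j hj <;> simp only [Finset.mem_Ico, Finset.mem_Icc] at hj ⊢ <;> lia
  · intro x hx a ha l hl
    have := abs_ergSum_le_dyadic (θ := θ) (f := cent a) (x := x) (J := J) (j₀ := J / 2)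
      (abs_cent_le ⟨ha.1, ha.2.le⟩) (by lia) (τ := fun j => C₀ * (s j * q ^ j))
      (fun j h1 h2 i hi => by
        refine hD j h1 _ (fun hc => hx ?_) a ha
        exact Set.mem_biUnion (x := j) (Finset.mem_Ico.2 ⟨h1, h2⟩)
          (Set.mem_biUnion (x := i) (Finset.mem_range.2 hi) hc)) hl
    refine this.trans ?_
    have e : √(2 ^ J * log J) = q ^ J * √(log J) := by
      rw [Real.sqrt_mul (by positivity), hq, Real.sqrt_eq_rpow, Real.sqrt_eq_rpow 2,
        ← Real.rpow_natCast, ← Real.rpow_natCast,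
        ← Real.rpow_mul (by norm_num), ← Real.rpow_mul (by norm_num), mul_comm (J : ℝ)]
    have b1 : (2 : ℝ) ^ (J / 2) ≤ q ^ J * √(log J) := by
      have e2 : (2 : ℝ) = q ^ 2 := (Real.sq_sqrt (by norm_num)).symm
      have : (2 : ℝ) ^ (J / 2) ≤ q ^ J := by
        rw [e2, ← pow_mul]
        exact pow_le_pow_right₀ hq1.le (by lia)
      exact this.trans (le_mul_of_one_le_right (by positivity) hLs)
    have b2 : ∑ j ∈ Finset.Ico (J / 2) J, C₀ * (s j * q ^ j) ≤ C₀ * C₁ * (q ^ J * √(log J)) := by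
      have : ∀ j ∈ Finset.Ico (J / 2) J, C₀ * (s j * q ^ j) =
          C₀ * (q ^ J * √(log J)) * (2 * (1 + ((J - j : ℕ) : ℝ)) * q⁻¹ ^ (J - j)) := by
        intro j hj
        have hj2 := (Finset.mem_Ico.1 hj).2.le
        have : q ^ j = q ^ J * q⁻¹ ^ (J - j) := by
          rw [inv_pow, ← div_eq_mul_inv, eq_div_iff (by positivity), ← pow_add,
            Nat.add_sub_cancel' hj2]
        simp only [hs]
        rw [this]
        ring
      rw [Finset.sum_congr rfl this, ← Finset.mul_sum, mul_assoc C₀, mul_assoc C₀, mul_comm C₁]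
      refine mul_le_mul_of_nonneg_left (mul_le_mul_of_nonneg_left ?_ (by positivity)) hC₀.le
      refine le_trans (le_of_eq ?_) (hqs.sum_le_tsum (Finset.Icc 1 (J - J / 2))
        fun d _ => by positivity)
      refine Finset.sum_nbij' (fun j => J - j) (fun d => J - d) ?_ ?_ ?_ ?_ ?_ <;>
        intro j hj <;> simp only [Finset.mem_Ico, Finset.mem_Icc] at hj ⊢ <;> lia
    rw [e]
    linarith

/-- The covariance of the indicators of `[0, a)` and `[0, b)`. -/
noncomputable def covar (a b : ℝ) : ℝ := min a b - a * b

/-- The asymptotic variance of the sums of `cent a` when `a` is an `M`-digit number. -/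
noncomputable def asympVar (θ M : ℕ) (a : ℝ) : ℝ :=
  covar a a + 2 * ∑ n ∈ Finset.range M, ((θ : ℝ) ^ (n + 1))⁻¹ * covar a (shift θ (n + 1) a)

lemma bddMeas_cent (a : ℝ) : BddMeas (cent a) :=
  (BddMeas.indicator measurableSet_Ico).sub (BddMeas.const a)

lemma integral_indicator_Ico {a : ℝ} (ha : a ∈ Set.Icc (0 : ℝ) 1) :
    ∫ x, (Set.Ico (0 : ℝ) a).indicator (fun _ => (1 : ℝ)) x ∂unif = a := by
  rw [integral_indicator measurableSet_Ico, setIntegral_const, smul_eq_mul, mul_one, unif,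
    measureReal_restrict_apply measurableSet_Ico, Set.Ico_inter_Ico]
  simp [ha.1, ha.2]

lemma integral_cent_mul_cent {a b : ℝ} (ha : a ∈ Set.Icc (0 : ℝ) 1) (hb : b ∈ Set.Icc (0 : ℝ) 1) :
    ∫ x, cent a x * cent b x ∂unif = covar a b := by
  have hm : min a b ∈ Set.Icc (0 : ℝ) 1 := ⟨le_min ha.1 hb.1, (min_le_left _ _).trans ha.2⟩
  have hi : ∀ t : ℝ, Integrable (fun x => (Set.Ico (0 : ℝ) t).indicator (fun _ => (1 : ℝ)) x)
      unif :=
    fun t => (BddMeas.indicator measurableSet_Ico).integrable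
  have e : ∀ x, cent a x * cent b x = (Set.Ico (0 : ℝ) (min a b)).indicator (fun _ => (1 : ℝ)) x -
      b * (Set.Ico (0 : ℝ) a).indicator (fun _ => (1 : ℝ)) x -
      a * (Set.Ico (0 : ℝ) b).indicator (fun _ => (1 : ℝ)) x + a * b := by
    intro x
    have : (Set.Ico (0 : ℝ) (min a b)).indicator (fun _ => (1 : ℝ)) x =
        (Set.Ico (0 : ℝ) a).indicator (fun _ => (1 : ℝ)) x *
          (Set.Ico (0 : ℝ) b).indicator (fun _ => (1 : ℝ)) x := by
      by_cases h0 : 0 ≤ x <;> by_cases h1 : x < a <;> by_cases h2 : x < b <;>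
        simp [Set.indicator, h0, h1, h2]
    rw [this]
    simp only [cent]
    ring
  simp only [e]
  rw [integral_add, integral_sub, integral_sub, integral_const_mul, integral_const_mul,
    integral_indicator_Ico ha, integral_indicator_Ico hb, integral_indicator_Ico hm, covar]
  · simp
    ring
  · exact hi _
  · exact (hi _).const_mul _
  · exact (hi _).sub ((hi _).const_mul _)
  · exact (hi _).const_mul _
  · exact ((hi _).sub ((hi _).const_mul _)).sub ((hi _).const_mul _)
  · exact integrable_const _

lemma isLevel_cent {θ : ℕ} (hθ : 0 < θ) (M j : ℕ) : IsLevel θ M (cent (j / (θ : ℝ) ^ M)) := by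
  have h0 : (0 : ℝ) < (θ : ℝ) ^ M := by positivity
  have key : ∀ x : ℝ, x ∈ Set.Ico (0 : ℝ) (j / (θ : ℝ) ^ M) ↔
      0 ≤ ⌊(θ : ℝ) ^ M * x⌋ ∧ ⌊(θ : ℝ) ^ M * x⌋ < (j : ℤ) := by
    intro x
    rw [Int.floor_lt, Int.floor_nonneg, Set.mem_Ico, lt_div_iff₀ h0, mul_nonneg_iff_of_pos_left h0,
      mul_comm x, Int.cast_natCast]
  intro x y h
  unfold cent
  congr 1
  by_cases hx : x ∈ Set.Ico (0 : ℝ) (j / (θ : ℝ) ^ M)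
  · have hy := (key y).2 (h ▸ (key x).1 hx)
    rw [Set.indicator_of_mem hx, Set.indicator_of_mem hy]
  · have hy : y ∉ Set.Ico (0 : ℝ) (j / (θ : ℝ) ^ M) := fun hy => hx ((key x).2 (h ▸ (key y).1 hy))
    rw [Set.indicator_of_notMem hx, Set.indicator_of_notMem hy]

lemma shift_grid (θ M n j : ℕ) :
    shift θ n (j / (θ : ℝ) ^ M) = ((θ ^ n * j % θ ^ M : ℕ) : ℝ) / (θ : ℝ) ^ M := by
  have := Int.fract_div_natCast_eq_div_natCast_mod (k := ℝ) (m := θ ^ n * j) (n := θ ^ M)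
  unfold shift
  push_cast at this
  rw [← mul_div_assoc, this]

lemma shift_grid_eq_zero {θ : ℕ} (M n j : ℕ) (h : M ≤ n) : shift θ n (j / (θ : ℝ) ^ M) = 0 := by
  rw [shift_grid, Nat.mod_eq_zero_of_dvd ((pow_dvd_pow θ h).mul_right j)]
  simp

lemma transfer_cent {θ : ℕ} (hθ : 0 < θ) {a : ℝ} (ha : a ∈ Set.Ico (0 : ℝ) 1) {y : ℝ}
    (hy : y ∈ Set.Ico (0 : ℝ) 1) : transfer θ (cent a) y = (θ : ℝ)⁻¹ * cent (shift θ 1 a) y := by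
  have hθ' : (0 : ℝ) < θ := by positivity
  set k := ⌊(θ : ℝ) * a⌋₊ with hk
  have hpos : 0 ≤ (θ : ℝ) * a := mul_nonneg hθ'.le ha.1
  have hr : shift θ 1 a = θ * a - k := by
    unfold shift
    rw [pow_one, Int.fract, ← natCast_floor_eq_intCast_floor hpos]
  have hkθ : k < θ := by
    have := floor_lt_pow hθ 1 ha
    simpa using this
  have h1 := Nat.floor_le hpos
  have h2 := Nat.lt_floor_add_one ((θ : ℝ) * a)
  rw [← hk] at h1 h2
  unfold transfer
  congr 1
  have e : ∀ j ∈ Finset.range θ, cent a ((y + j) / θ) =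
      (if j < k + (if y < shift θ 1 a then 1 else 0) then 1 else 0) - a := by
    intro j hj
    rw [cent_of_nonneg _ (div_mem_Ico (Finset.mem_range.1 hj) hy).1]
    congr 1
    refine if_congr ?_ rfl rfl
    rw [div_lt_iff₀ hθ']
    obtain ⟨hy0, hy1⟩ := hy
    split_ifs with hc <;> rw [hr] at hc
    · constructor
      · intro h
        by_contra! h'
        have : (k : ℝ) + 1 ≤ j := by exact_mod_cast h'
        linarith
      · intro h
        have : (j : ℝ) ≤ k := by exact_mod_cast (by lia : j ≤ k)
        linarith
    · constructor
      · intro h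
        by_contra! h'
        have : (k : ℝ) ≤ j := by exact_mod_cast h'
        linarith
      · intro h
        have : (j : ℝ) + 1 ≤ k := by exact_mod_cast (by lia : j + 1 ≤ k)
        linarith
  rw [Finset.sum_congr rfl e, cent_of_nonneg _ hy.1, Finset.sum_sub_distrib, ← Finset.sum_filter]
  have hle : k + (if y < shift θ 1 a then 1 else 0) ≤ θ := by split_ifs <;> lia
  have hf : (Finset.range θ).filter (fun j => j < k + (if y < shift θ 1 a then 1 else 0)) =
      Finset.range (k + (if y < shift θ 1 a then 1 else 0)) := by
    ext j
    simp only [Finset.mem_filter, Finset.mem_range]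
    lia
  rw [hf]
  simp only [Finset.sum_const, Finset.card_range, nsmul_eq_mul, mul_one]
  simp only [hr]
  push_cast
  ring

lemma transfer_sum (θ : ℕ) {ι : Type*} (s : Finset ι) (u : ι → ℝ → ℝ) (y : ℝ) :
    transfer θ (fun x => ∑ i ∈ s, u i x) y = ∑ i ∈ s, transfer θ (u i) y := by
  simp only [transfer, ← Finset.mul_sum]
  rw [Finset.sum_comm]

lemma exists_mgf_cent_bounds {θ : ℕ} (hθ : 0 < θ) {M j : ℕ} (hj : j < θ ^ M) :
    ∃ K > 0, ∀ l : ℝ, |l| * K ≤ 1 → ∀ N : ℕ,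
      1 / 4 * Real.exp (N * (l ^ 2 * (asympVar θ M (j / (θ : ℝ) ^ M) / 2) - K * |l| ^ 3)) ≤
        ∫ x, Real.exp (l * ergSum θ (cent (j / (θ : ℝ) ^ M)) N x) ∂unif ∧
      ∫ x, Real.exp (l * ergSum θ (cent (j / (θ : ℝ) ^ M)) N x) ∂unif ≤
        4 * Real.exp (N * (l ^ 2 * (asympVar θ M (j / (θ : ℝ) ^ M) / 2) + K * |l| ^ 3)) := by
  have h0 : (0 : ℝ) < (θ : ℝ) ^ M := by positivity
  set a : ℝ := j / (θ : ℝ) ^ M with ha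
  have ham : a ∈ Set.Ico (0 : ℝ) 1 := by
    refine ⟨by positivity, ?_⟩
    rw [ha, div_lt_one h0]
    exact_mod_cast hj
  set G : ℕ → ℝ → ℝ := fun n x => ((θ : ℝ) ^ n)⁻¹ * cent (shift θ n a) x with hG
  set g : ℝ → ℝ := fun x => ∑ n ∈ Finset.range M, G (n + 1) x with hg
  have hGb : ∀ n, BddMeas (G n) := fun n => (bddMeas_cent _).const_mul _
  have hGl : ∀ n, IsLevel θ M (G n) := by
    intro n
    have := isLevel_cent hθ M (θ ^ n * j % θ ^ M)
    rw [← shift_grid] at this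
    exact this.comp fun t => ((θ : ℝ) ^ n)⁻¹ * t
  have hgl : IsLevel θ M g := fun x y h => Finset.sum_congr rfl fun n _ => hGl (n + 1) x y h
  have hgb : BddMeas g := BddMeas.sum _ fun n _ => hGb (n + 1)
  have hTG : ∀ n, ∀ y ∈ Set.Ico (0 : ℝ) 1, transfer θ (G n) y = G (n + 1) y := by
    intro n y hy
    simp only [hG]
    rw [transfer_const_mul, transfer_cent hθ (shift_mem θ n a) hy, shift_shift, add_comm 1 n,
      pow_succ, mul_inv, mul_assoc]
  refine exists_mgf_ergSum_bounds hθ (isLevel_cent hθ M j) hgl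
    (abs_cent_le ⟨ham.1, ham.2.le⟩) hgb ?_ ?_
  · have e : ∀ x, cent a x ^ 2 / 2 + cent a x * g x = (1 / 2) * (cent a x * cent a x) +
        ∑ n ∈ Finset.range M, ((θ : ℝ) ^ (n + 1))⁻¹ * (cent a x * cent (shift θ (n + 1) a) x) := by
      intro x
      simp only [hg, hG, Finset.mul_sum]
      congr 1
      · ring
      · exact Finset.sum_congr rfl fun n _ => by ring
    have hI : ∀ b : ℝ, ∀ c : ℝ, Integrable (fun x => c * (cent a x * cent b x)) unif := fun b c =>
      (((bddMeas_cent a).mul (bddMeas_cent b)).const_mul c).integrable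
    rw [integral_congr_ae (ae_of_all unif e),
      integral_add (hI a _) (integrable_finsetSum _ fun n _ => hI _ _),
      integral_finsetSum _ fun n _ => hI _ _]
    simp only [integral_const_mul]
    have ham' : a ∈ Set.Icc (0 : ℝ) 1 := ⟨ham.1, ham.2.le⟩
    rw [integral_cent_mul_cent ham' ham']
    have : ∀ n, ∫ x, cent a x * cent (shift θ n a) x ∂unif = covar a (shift θ n a) := fun n =>
      integral_cent_mul_cent ham' ⟨shift_nonneg _ _ _, (shift_lt_one _ _ _).le⟩
    simp only [this, asympVar]
    ring
  · intro y hy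
    have h1 : transfer θ (cent a) y = G 1 y := by
      simp only [hG]
      rw [transfer_cent hθ ham hy, pow_one]
    have h2 : G (M + 1) y = 0 := by
      simp only [hG]
      rw [ha, shift_grid_eq_zero M (M + 1) j (by lia), cent_zero, mul_zero]
    have h3 := Finset.sum_range_succ (fun n => G (n + 1) y) M
    have h4 := Finset.sum_range_succ' (fun n => G (n + 1) y) M
    simp only [hg]
    rw [transfer_sum, Finset.sum_congr rfl fun n _ => hTG (n + 1) y hy, h1]
    linarith

/-- The square of the limsup in the theorem. -/
noncomputable def limVar (θ : ℕ) : ℝ :=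
  if θ = 2 then 14 / 27
  else if Even θ then ((θ : ℝ) + 1) * θ * (θ - 2) / (4 * (θ - 1) ^ 3)
  else ((θ : ℝ) + 1) / (4 * (θ - 1))

lemma covar_le_left {a b : ℝ} : covar a b ≤ b * (1 - a) := by
  have := min_le_right a b
  unfold covar; linarith

lemma covar_le_right {a b : ℝ} : covar a b ≤ a * (1 - b) := by
  have := min_le_left a b
  unfold covar; linarith

lemma covar_nonneg {a b : ℝ} (ha : a ∈ Set.Icc (0 : ℝ) 1) (hb : b ∈ Set.Icc (0 : ℝ) 1) :
    0 ≤ covar a b := by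
  obtain ⟨h1, h2⟩ := ha
  obtain ⟨h3, h4⟩ := hb
  unfold covar
  rcases min_cases a b with ⟨h, _⟩ | ⟨h, _⟩ <;> rw [h] <;> nlinarith

lemma covar_self (a : ℝ) : covar a a = a * (1 - a) := by simp [covar]; ring

lemma covar_le_self {a b : ℝ} (ha : a ∈ Set.Icc (0 : ℝ) 1) : covar a b ≤ a * (1 - a) := by
  rcases le_total a b with h | h
  · exact covar_le_right.trans (mul_le_mul_of_nonneg_left (by linarith) ha.1)
  · exact covar_le_left.trans (mul_le_mul_of_nonneg_right h (by linarith [ha.2]))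

lemma covar_one_sub (a b : ℝ) : covar (1 - a) (1 - b) = covar a b := by
  unfold covar
  rcases le_total a b with h | h
  · rw [min_eq_left h, min_eq_right (by linarith)]; ring
  · rw [min_eq_right h, min_eq_left (by linarith)]; ring

lemma covar_le_of_int {a b x k : ℝ} (ha : a ∈ Set.Icc (0 : ℝ) 1) {D n : ℤ} (hb : b = x - D)
    (hk : k = n) (hx : x ≤ k) : covar a b ≤ a * (k - x) := by
  obtain ⟨h1, h2⟩ := ha
  rcases lt_or_ge D n with h | h
  · have h' : (D : ℝ) + 1 ≤ n := by exact_mod_cast h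
    exact covar_le_right.trans (mul_le_mul_of_nonneg_left (by linarith) h1)
  · have h' : (n : ℝ) ≤ D := by exact_mod_cast h
    have : b * (1 - a) ≤ 0 := mul_nonpos_of_nonpos_of_nonneg (by linarith) (by linarith)
    have : 0 ≤ a * (k - x) := mul_nonneg h1 (by linarith)
    linarith [covar_le_left (a := a) (b := b)]

lemma covar_add_half_le {a b c : ℝ} (ha : 0 ≤ a) (ha' : a ≤ 1 / 2) (hb : b ∈ Set.Icc (0 : ℝ) 1)
    (hc : c ∈ Set.Icc (0 : ℝ) 1) {D : ℤ} (hD : c = 2 * b - D) :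
    covar a b + covar a c / 2 ≤ a * (3 - 4 * a) / 2 := by
  obtain ⟨hb0, hb1⟩ := hb
  obtain ⟨hc0, hc1⟩ := hc
  have b1 := covar_le_left (a := a) (b := b)
  have b2 := covar_le_right (a := a) (b := b)
  have c1 := covar_le_left (a := a) (b := c)
  have c2 := covar_le_right (a := a) (b := c)
  have hu : a * (1 - a) ≤ a * (3 - 4 * a) / 2 := by nlinarith
  rcases lt_trichotomy D 0 with h | h | h
  · have h' : (D : ℝ) + 1 ≤ 0 := by exact_mod_cast h
    have e1 : b = 0 := by linarith
    have e2 : c = 1 := by linarith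
    have b3 : covar a b ≤ 0 := b1.trans (by rw [e1, zero_mul])
    have c3 : covar a c ≤ 0 := c2.trans (by rw [e2, sub_self, mul_zero])
    nlinarith
  · subst h
    simp only [Int.cast_zero, sub_zero] at hD
    subst hD
    rcases le_total b (a / 2) with h1 | h1
    · nlinarith
    · rcases le_total b a with h2 | h2 <;> nlinarith
  · rcases eq_or_lt_of_le (Int.add_one_le_iff.2 h) with h1 | h1
    · have : (D : ℝ) = 1 := by exact_mod_cast h1.symm
      rw [this] at hD
      subst hD
      rcases le_total (2 * b - 1) a with h2 | h2 <;> nlinarith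
    · have h' : (2 : ℝ) ≤ D := by exact_mod_cast h1
      have e1 : b = 1 := by linarith
      have e2 : c = 0 := by linarith
      have b3 : covar a b ≤ 0 := b2.trans (by rw [e1, sub_self, mul_zero])
      have c3 : covar a c ≤ 0 := c1.trans (by rw [e2, zero_mul])
      nlinarith

lemma sum_geom_succ (r : ℝ) (v : ℕ → ℝ) (M : ℕ) :
    ∑ n ∈ Finset.range (M + 1), (r ^ (n + 1))⁻¹ * v n =
      r⁻¹ * (v 0 + ∑ n ∈ Finset.range M, (r ^ (n + 1))⁻¹ * v (n + 1)) := by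
  rw [Finset.sum_range_succ', mul_add, Finset.mul_sum, add_comm]
  congr 1
  · simp
  · exact Finset.sum_congr rfl fun n _ => by rw [pow_succ r (n + 1), mul_inv]; ring

lemma sum_geom_le {r c : ℝ} (hr : 1 < r) (hc : 0 ≤ c) (M : ℕ) :
    ∀ v : ℕ → ℝ, (∀ n, v n ≤ c) → ∑ n ∈ Finset.range M, (r ^ (n + 1))⁻¹ * v n ≤ c / (r - 1) := by
  have hr' : 0 < r - 1 := by linarith
  induction M with
  | zero => intro v _; simpa using by positivity
  | succ M ih =>
    intro v hv
    rw [sum_geom_succ, inv_mul_le_iff₀ (by linarith)]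
    have h1 := ih (fun n => v (n + 1)) fun n => hv _
    have h2 := hv 0
    have : r * (c / (r - 1)) = c + c / (r - 1) := by field_simp; ring
    linarith

lemma sum_geom_two_le {c : ℝ} (M : ℕ) : ∀ v : ℕ → ℝ, (∀ n, 0 ≤ v n) →
    (∀ n, v n + v (n + 1) / 2 ≤ c) →
    ∑ n ∈ Finset.range M, ((2 : ℝ) ^ (n + 1))⁻¹ * v n ≤ 2 * c / 3 := by
  induction M using Nat.twoStepInduction with
  | zero =>
    intro v h0 h1
    have := h0 0; have := h0 1; have := h1 0
    simp at *; linarith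
  | one =>
    intro v h0 h1
    have := h0 0; have := h0 1; have := h1 0
    simp at *; linarith
  | more M ih _ =>
    intro v h0 h1
    rw [sum_geom_succ, sum_geom_succ]
    have := ih (fun n => v (n + 1 + 1)) (fun n => h0 _) (fun n => h1 _)
    have := h1 0
    simp only [zero_add] at *
    linarith

lemma variance_le_odd {θ : ℕ} (hθ : 2 ≤ θ) {a : ℝ} (ha : a ∈ Set.Icc (0 : ℝ) 1) (b : ℕ → ℝ)
    (M : ℕ) : covar a a + 2 * ∑ n ∈ Finset.range M, ((θ : ℝ) ^ (n + 1))⁻¹ * covar a (b (n + 1)) ≤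
      a * (1 - a) * ((θ + 1) / (θ - 1)) := by
  have hθ' : (2 : ℝ) ≤ θ := by exact_mod_cast hθ
  have h0 : 0 ≤ a * (1 - a) := mul_nonneg ha.1 (by linarith [ha.2])
  have := sum_geom_le (r := θ) (c := a * (1 - a)) (by linarith) h0 M
    (fun n => covar a (b (n + 1))) fun n => covar_le_self ha
  rw [covar_self]
  have e : a * (1 - a) * (((θ : ℝ) + 1) / (θ - 1)) =
      a * (1 - a) + 2 * (a * (1 - a) / (θ - 1)) := by
    have : (θ : ℝ) - 1 ≠ 0 := by linarith
    field_simp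
    ring
  rw [e]
  linarith

lemma variance_le_even {θ : ℕ} (hθ : 2 ≤ θ) {h : ℤ} (he : (θ : ℝ) = 2 * h) {a : ℝ} (ha : 0 ≤ a)
    (ha' : a ≤ 1 / 2) {b : ℕ → ℝ} {D : ℕ → ℤ} (hb : ∀ n, b n = θ ^ n * a - D n) (M : ℕ) :
    covar a a + 2 * ∑ n ∈ Finset.range (M + 1), ((θ : ℝ) ^ (n + 1))⁻¹ * covar a (b (n + 1)) ≤
      a * (1 - a) * (1 + 2 / (θ * (θ - 1))) + a * (1 - 2 * a) := by
  have hθ' : (2 : ℝ) ≤ θ := by exact_mod_cast hθ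
  have ham : a ∈ Set.Icc (0 : ℝ) 1 := ⟨ha, by linarith⟩
  have h0 : 0 ≤ a * (1 - a) := mul_nonneg ha (by linarith)
  have h1 := sum_geom_le (r := θ) (c := a * (1 - a)) (by linarith) h0 M
    (fun n => covar a (b (n + 1 + 1))) fun n => covar_le_self ham
  have h2 : covar a (b 1) ≤ a * (h - θ * a) :=
    covar_le_of_int ham (x := θ * a) (k := h) (D := D 1) (by rw [hb, pow_one]) rfl (by nlinarith)
  rw [sum_geom_succ (θ : ℝ) (fun n => covar a (b (n + 1))), covar_self, zero_add]
  have hpos : (0 : ℝ) < θ := by linarith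
  have hpos' : (0 : ℝ) < θ - 1 := by linarith
  have e : a * (1 - a) * (1 + 2 / ((θ : ℝ) * (θ - 1))) + a * (1 - 2 * a) =
      a * (1 - a) + 2 * ((θ : ℝ)⁻¹ * (a * (h - θ * a) + a * (1 - a) / (θ - 1))) := by
    have : (h : ℝ) = θ / 2 := by linarith
    rw [this]
    field_simp
    ring
  rw [e]
  gcongr

lemma variance_le_four {a : ℝ} (ha : 0 ≤ a) (ha' : a ≤ 3 / 8) {b : ℕ → ℝ} {D : ℕ → ℤ}
    (hb : ∀ n, b n = 4 ^ n * a - D n) (M : ℕ) :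
    covar a a + 2 * ∑ n ∈ Finset.range (M + 2), ((4 : ℝ) ^ (n + 1))⁻¹ * covar a (b (n + 1)) ≤
      a * (67 / 24 - 121 / 24 * a) := by
  have ham : a ∈ Set.Icc (0 : ℝ) 1 := ⟨ha, by linarith⟩
  have h0 : 0 ≤ a * (1 - a) := mul_nonneg ha (by linarith)
  have h1 := sum_geom_le (r := 4) (c := a * (1 - a)) (by norm_num) h0 M
    (fun n => covar a (b (n + 1 + 1 + 1))) fun n => covar_le_self ham
  have h2 : covar a (b 1) ≤ a * (2 - 4 * a) :=
    covar_le_of_int ham (x := 4 * a) (n := 2) (D := D 1) (by rw [hb, pow_one]) (by norm_num)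
      (by linarith)
  have h3 : covar a (b 2) ≤ a * (6 - 16 * a) :=
    covar_le_of_int ham (x := 16 * a) (n := 6) (D := D 2) (by rw [hb]; norm_num) (by norm_num)
      (by linarith)
  rw [sum_geom_succ (4 : ℝ) (fun n => covar a (b (n + 1))),
    sum_geom_succ (4 : ℝ) (fun n => covar a (b (n + 1 + 1))), covar_self]
  simp only [zero_add, one_add_one_eq_two] at *
  linarith

lemma variance_le_two {a : ℝ} (ha : 0 ≤ a) (ha' : a ≤ 1 / 2) {b : ℕ → ℝ} {D : ℕ → ℤ}
    (hb : ∀ n, b n = 2 ^ n * a - D n) (hb1 : ∀ n, b n ∈ Set.Icc (0 : ℝ) 1) (M : ℕ) :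
    covar a a + 2 * ∑ n ∈ Finset.range (M + 1), ((2 : ℝ) ^ (n + 1))⁻¹ * covar a (b (n + 1)) ≤
      3 * a - 13 / 3 * a ^ 2 := by
  have ham : a ∈ Set.Icc (0 : ℝ) 1 := ⟨ha, by linarith⟩
  have h1 := sum_geom_two_le (c := a * (3 - 4 * a) / 2) M (fun n => covar a (b (n + 1 + 1)))
    (fun n => covar_nonneg ham (hb1 _)) (fun n => covar_add_half_le ha ha' (hb1 _) (hb1 _)
      (D := D (n + 1 + 1 + 1) - 2 * D (n + 1 + 1)) (by rw [hb, hb]; push_cast; ring))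
  have h2 : covar a (b 1) ≤ a * (1 - 2 * a) :=
    covar_le_of_int ham (x := 2 * a) (n := 1) (D := D 1) (by rw [hb, pow_one]) (by norm_num)
      (by linarith)
  rw [sum_geom_succ (2 : ℝ) (fun n => covar a (b (n + 1))), covar_self]
  simp only [zero_add] at *
  nlinarith

lemma variance_le_two_mid {a : ℝ} (ha : 0 ≤ a) (ha' : a ≤ 3 / 8) {b : ℕ → ℝ} {D : ℕ → ℤ}
    (hb : ∀ n, b n = 2 ^ n * a - D n) (hb1 : ∀ n, b n ∈ Set.Icc (0 : ℝ) 1) (M : ℕ) :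
    covar a a + 2 * ∑ n ∈ Finset.range (M + 3), ((2 : ℝ) ^ (n + 1))⁻¹ * covar a (b (n + 1)) ≤
      a * (4 - 22 / 3 * a) := by
  have ham : a ∈ Set.Icc (0 : ℝ) 1 := ⟨ha, by linarith⟩
  have h1 := sum_geom_two_le (c := a * (3 - 4 * a) / 2) M
    (fun n => covar a (b (n + 1 + 1 + 1 + 1)))
    (fun n => covar_nonneg ham (hb1 _)) (fun n => covar_add_half_le ha (by linarith) (hb1 _) (hb1 _)
      (D := D (n + 1 + 1 + 1 + 1 + 1) - 2 * D (n + 1 + 1 + 1 + 1))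
      (by rw [hb, hb]; push_cast; ring))
  have h2 : covar a (b 1) ≤ a * (1 - 2 * a) :=
    covar_le_of_int ham (x := 2 * a) (n := 1) (D := D 1) (by rw [hb, pow_one]) (by norm_num)
      (by linarith)
  have h3 : covar a (b 2) ≤ a * (2 - 4 * a) :=
    covar_le_of_int ham (x := 4 * a) (n := 2) (D := D 2) (by rw [hb]; norm_num) (by norm_num)
      (by linarith)
  have h4 : covar a (b 3) ≤ a * (3 - 8 * a) :=
    covar_le_of_int ham (x := 8 * a) (n := 3) (D := D 3) (by rw [hb]; norm_num) (by norm_num)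
      (by linarith)
  rw [sum_geom_succ (2 : ℝ) (fun n => covar a (b (n + 1))),
    sum_geom_succ (2 : ℝ) (fun n => covar a (b (n + 1 + 1))),
    sum_geom_succ (2 : ℝ) (fun n => covar a (b (n + 1 + 1 + 1))), covar_self]
  simp only [zero_add, one_add_one_eq_two, two_add_one_eq_three] at *
  nlinarith

lemma variance_le_of_le_half {θ : ℕ} (hθ : 2 ≤ θ) {a : ℝ} (ha : 0 ≤ a) (ha' : a ≤ 1 / 2)
    {b : ℕ → ℝ} {D : ℕ → ℤ} (hb : ∀ n, b n = θ ^ n * a - D n)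
    (hb1 : ∀ n, b n ∈ Set.Icc (0 : ℝ) 1) (M : ℕ) :
    covar a a + 2 * ∑ n ∈ Finset.range M, ((θ : ℝ) ^ (n + 1))⁻¹ * covar a (b (n + 1)) ≤
      limVar θ := by
  have ham : a ∈ Set.Icc (0 : ℝ) 1 := ⟨ha, by linarith⟩
  have hθ' : (2 : ℝ) ≤ θ := by exact_mod_cast hθ
  have hmono : ∀ k, covar a a + 2 * ∑ n ∈ Finset.range M, ((θ : ℝ) ^ (n + 1))⁻¹ *
      covar a (b (n + 1)) ≤ covar a a + 2 * ∑ n ∈ Finset.range (M + k), ((θ : ℝ) ^ (n + 1))⁻¹ *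
      covar a (b (n + 1)) := by
    intro k
    have := Finset.sum_le_sum_of_subset_of_nonneg (f := fun n => ((θ : ℝ) ^ (n + 1))⁻¹ *
      covar a (b (n + 1))) (Finset.range_mono (by lia : M ≤ M + k))
      (fun n _ _ => mul_nonneg (by positivity) (covar_nonneg ham (hb1 (n + 1))))
    linarith
  unfold limVar
  split_ifs with h2 he
  · subst h2
    simp only [Nat.cast_ofNat] at *
    rcases le_total a (1 / 3) with h | h
    · have := variance_le_two ha ha' hb hb1 M
      have := hmono 1
      nlinarith
    · rcases le_total a (3 / 8) with h' | h'
      · have := variance_le_two_mid ha h' hb hb1 M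
        have := hmono 3
        nlinarith
      · have := variance_le_two ha ha' hb hb1 M
        have := hmono 1
        nlinarith
  · obtain ⟨h, hh⟩ := he
    have hh' : (θ : ℝ) = 2 * h := by rw [hh]; push_cast; ring
    have h4 : 4 ≤ θ := by lia
    have h4' : (4 : ℝ) ≤ θ := by exact_mod_cast h4
    have hp : (0 : ℝ) < θ - 1 := by linarith
    rcases le_total a ((θ - 2) / (2 * (θ - 1))) with h5 | h5
    · refine (variance_le_odd hθ ham b M).trans ?_
      set t : ℝ := (θ - 2) / (2 * (θ - 1)) with ht
      have ht1 : t ≤ 1 / 2 := by rw [ht, div_le_iff₀ (by positivity)]; linarith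
      have e : ((θ : ℝ) + 1) * θ * (θ - 2) / (4 * (θ - 1) ^ 3) =
          t * (1 - t) * ((θ + 1) / (θ - 1)) := by
        rw [ht]; field_simp; ring
      rw [e]
      refine mul_le_mul_of_nonneg_right ?_ (by positivity)
      nlinarith
    · have hF := variance_le_even hθ (h := h) (by exact_mod_cast hh') ha ha' hb M
      have hF1 := hmono 1
      rcases eq_or_lt_of_le h4 with h6 | h6
      · subst h6
        simp only [Nat.cast_ofNat] at *
        norm_num at h5 hF ⊢
        rcases le_total a (3 / 8) with h7 | h7
        · have := variance_le_four ha h7 hb M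
          have := hmono 2
          nlinarith
        · nlinarith
      · have h6' : (6 : ℝ) ≤ θ := by exact_mod_cast (by lia : 6 ≤ θ)
        refine (hF1.trans hF).trans ?_
        obtain ⟨t, ht⟩ : ∃ t : ℝ, a = (θ - 2) / (2 * (θ - 1)) + t :=
          ⟨a - (θ - 2) / (2 * (θ - 1)), by abel⟩
        have ht0 : 0 ≤ t := by linarith
        have e : ((θ : ℝ) + 1) * θ * (θ - 2) / (4 * (θ - 1) ^ 3) -
            (a * (1 - a) * (1 + 2 / (θ * (θ - 1))) + a * (1 - 2 * a)) =
            t * (1 - 3 / (θ - 1) - 2 / (θ * (θ - 1) ^ 2)) / 1 +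
              t ^ 2 * (3 + 2 / (θ * (θ - 1))) := by
          have : (θ : ℝ) ≠ 0 := by linarith
          rw [ht]; field_simp; ring
        have h8 : 3 / ((θ : ℝ) - 1) ≤ 3 / 5 := by
          rw [div_le_div_iff₀ (by linarith) (by norm_num)]; linarith
        have h9 : 2 / (θ * ((θ : ℝ) - 1) ^ 2) ≤ 2 / 5 := by
          rw [div_le_div_iff₀ (by positivity) (by norm_num)]
          nlinarith
        have h10 : 0 ≤ t * (1 - 3 / (θ - 1) - 2 / (θ * (θ - 1) ^ 2)) / 1 +
              t ^ 2 * (3 + 2 / (θ * (θ - 1))) :=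
          add_nonneg (div_nonneg (mul_nonneg ht0 (by linarith)) zero_le_one) (by positivity)
        linarith
  · refine (variance_le_odd hθ ham b M).trans ?_
    have hp : (0 : ℝ) < θ - 1 := by linarith
    have e : ((θ : ℝ) + 1) / (4 * (θ - 1)) = 1 / 4 * ((θ + 1) / (θ - 1)) := by field_simp
    rw [e]
    refine mul_le_mul_of_nonneg_right ?_ (by positivity)
    nlinarith [sq_nonneg (a - 1 / 2)]

lemma asympVar_le {θ : ℕ} (hθ : 2 ≤ θ) (M : ℕ) {a : ℝ} (ha : a ∈ Set.Ico (0 : ℝ) 1) :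
    asympVar θ M a ≤ limVar θ := by
  have hs : ∀ n, shift θ n a = θ ^ n * a - (⌊(θ : ℝ) ^ n * a⌋ : ℤ) := fun n => rfl
  have hm : ∀ n, shift θ n a ∈ Set.Icc (0 : ℝ) 1 := fun n =>
    ⟨shift_nonneg _ _ _, (shift_lt_one _ _ _).le⟩
  unfold asympVar
  rcases le_total a (1 / 2) with h | h
  · exact variance_le_of_le_half hθ ha.1 h hs hm M
  · have := variance_le_of_le_half hθ (a := 1 - a) (by linarith [ha.2]) (by linarith)
      (b := fun n => 1 - shift θ n a) (D := fun n => θ ^ n - 1 - ⌊(θ : ℝ) ^ n * a⌋)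
      (fun n => by rw [hs]; push_cast; ring)
      (fun n => ⟨by linarith [(hm n).2], by linarith [(hm n).1]⟩) M
    simpa only [covar_one_sub] using this

lemma limVar_pos {θ : ℕ} (hθ : 2 ≤ θ) : 0 < limVar θ := by
  have hθ' : (2 : ℝ) ≤ θ := by exact_mod_cast hθ
  have hp : (0 : ℝ) < θ - 1 := by linarith
  unfold limVar
  split_ifs with h2 he
  · norm_num
  · have h3 : (3 : ℝ) ≤ θ := by exact_mod_cast (by lia : 3 ≤ θ)
    have : (0 : ℝ) < θ - 2 := by linarith
    positivity
  · positivity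

lemma covar_sub_le {a b a' b' : ℝ} (ha : a' ∈ Set.Icc (0 : ℝ) 1) (hb : b ∈ Set.Icc (0 : ℝ) 1)
    (h1 : a' ≤ a) (h2 : b' ≤ b) : covar a b - covar a' b' ≤ (a - a') + (b - b') := by
  have h3 : min a b ≤ min a' b' + (a - a') + (b - b') := by
    rcases min_cases a' b' with ⟨h, _⟩ | ⟨h, _⟩ <;> rw [h]
    · linarith [min_le_left a b]
    · linarith [min_le_right a b]
  have h4 : a' * b' ≤ a * b := by
    nlinarith [mul_nonneg ha.1 (sub_nonneg.2 h2), mul_nonneg hb.1 (sub_nonneg.2 h1)]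
  unfold covar
  linarith

lemma shift_gridFloor {θ : ℕ} (hθ : 0 < θ) {M n : ℕ} (hn : n ≤ M) {a : ℝ} (ha : 0 ≤ a) :
    shift θ n (gridFloor θ M a) ≤ shift θ n a ∧
      shift θ n a - shift θ n (gridFloor θ M a) ≤ (θ : ℝ) ^ n * ((θ : ℝ) ^ M)⁻¹ := by
  have h0 : (0 : ℝ) < (θ : ℝ) ^ n := by positivity
  have hM : (0 : ℝ) < (θ : ℝ) ^ M := by positivity
  have h1 := mul_le_mul_of_nonneg_left (gridFloor_le hθ M ha) h0.le
  have h2 := mul_lt_mul_of_pos_left (lt_gridFloor_add hθ M a) h0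
  have h3 : ⌊(θ : ℝ) ^ n * gridFloor θ M a⌋ = ⌊(θ : ℝ) ^ n * a⌋ := by
    refine le_antisymm (Int.floor_mono h1) ?_
    have hf : (0 : ℤ) ≤ ⌊(θ : ℝ) ^ n * a⌋ := Int.floor_nonneg.2 (by positivity)
    obtain ⟨k, hk⟩ := Int.eq_ofNat_of_zero_le hf
    rw [Int.le_floor, hk]
    have h4 := Int.floor_le ((θ : ℝ) ^ n * a)
    rw [hk] at h4
    push_cast at h4 ⊢
    have h5 : k * θ ^ (M - n) ≤ ⌊(θ : ℝ) ^ M * a⌋₊ := by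
      rw [Nat.le_floor_iff (by positivity)]
      push_cast
      calc (k : ℝ) * θ ^ (M - n) ≤ θ ^ n * a * θ ^ (M - n) := by gcongr
        _ = θ ^ (n + (M - n)) * a := by rw [pow_add]; ring
        _ = θ ^ M * a := by rw [Nat.add_sub_cancel' hn]
    unfold gridFloor
    rw [← mul_div_assoc, le_div_iff₀ hM]
    have h6 : (k : ℝ) * θ ^ (M - n) ≤ ⌊(θ : ℝ) ^ M * a⌋₊ := by exact_mod_cast h5
    calc (k : ℝ) * θ ^ M = θ ^ n * (k * θ ^ (M - n)) := by
          rw [← Nat.add_sub_cancel' hn, pow_add, Nat.add_sub_cancel' hn]; ring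
      _ ≤ _ := by gcongr
  unfold shift Int.fract
  rw [h3]
  constructor <;> linarith

lemma asympVar_gridFloor_ge {θ : ℕ} (hθ : 0 < θ) (M : ℕ) {a : ℝ} (ha : a ∈ Set.Ico (0 : ℝ) 1) :
    asympVar θ M a - (2 + 4 * M) * ((θ : ℝ) ^ M)⁻¹ ≤ asympVar θ M (gridFloor θ M a) := by
  set b := gridFloor θ M a with hb
  set p := ((θ : ℝ) ^ M)⁻¹ with hp
  have hba : b ≤ a := gridFloor_le hθ M ha.1
  have hab : a < b + p := lt_gridFloor_add hθ M a
  have hbm : b ∈ Set.Icc (0 : ℝ) 1 := ⟨gridFloor_nonneg _ _ _, hba.trans ha.2.le⟩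
  have h1 := covar_sub_le hbm ⟨ha.1, ha.2.le⟩ hba hba
  have h2 : ∀ n ∈ Finset.range M, ((θ : ℝ) ^ (n + 1))⁻¹ * covar a (shift θ (n + 1) a) -
      2 * p ≤ ((θ : ℝ) ^ (n + 1))⁻¹ * covar b (shift θ (n + 1) b) := by
    intro n hn
    have hn' : n + 1 ≤ M := Finset.mem_range.1 hn
    obtain ⟨h3, h4⟩ := shift_gridFloor (n := n + 1) hθ hn' ha.1
    rw [← hb] at h3 h4
    rw [← hp] at h4
    have h5 := covar_sub_le hbm ⟨shift_nonneg θ (n + 1) a, (shift_lt_one _ _ _).le⟩ hba h3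
    have h0 : (0 : ℝ) < (θ : ℝ) ^ (n + 1) := by positivity
    have hpos : 0 < p := by positivity
    have h6 : (1 : ℝ) ≤ (θ : ℝ) ^ (n + 1) := one_le_pow₀ (by exact_mod_cast hθ)
    have h7 : covar a (shift θ (n + 1) a) - covar b (shift θ (n + 1) b) ≤
        2 * p * (θ : ℝ) ^ (n + 1) := by nlinarith
    have h8 := mul_le_mul_of_nonneg_left h7 (inv_nonneg.2 h0.le)
    have h9 : ((θ : ℝ) ^ (n + 1))⁻¹ * (2 * p * (θ : ℝ) ^ (n + 1)) = 2 * p := by field_simp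
    rw [h9] at h8
    linarith
  have h3 := Finset.sum_le_sum h2
  rw [Finset.sum_sub_distrib] at h3
  simp only [Finset.sum_const, Finset.card_range, nsmul_eq_mul] at h3
  unfold asympVar
  linarith

lemma hasSum_geom_inv {r : ℝ} (hr : 1 < |r|) :
    HasSum (fun n : ℕ => (r ^ (n + 1))⁻¹) (r - 1)⁻¹ := by
  have h0 : r ≠ 0 := by rintro rfl; simp at hr; linarith
  have h1 : r ≠ 1 := by rintro rfl; simp at hr
  have := (hasSum_geometric_of_norm_lt_one (ξ := r⁻¹) (by
    rw [norm_inv, Real.norm_eq_abs]; exact inv_lt_one_of_one_lt₀ hr)).mul_left r⁻¹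
  have e : r⁻¹ * (1 - r⁻¹)⁻¹ = (r - 1)⁻¹ := by
    have : r - 1 ≠ 0 := sub_ne_zero.2 h1
    field_simp
  rw [e] at this
  refine this.congr_fun fun n => ?_
  rw [inv_pow, pow_succ, mul_inv, mul_comm]

lemma tendsto_asympVar_of_fixed {θ : ℕ} (hθ : 2 ≤ θ) {a : ℝ} (ha : a ∈ Set.Ico (0 : ℝ) 1)
    (h : shift θ 1 a = a) :
    Tendsto (fun M => asympVar θ M a) atTop (nhds (a * (1 - a) * ((θ + 1) / (θ - 1)))) := by
  have hθ' : (2 : ℝ) ≤ θ := by exact_mod_cast hθ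
  have hfix : ∀ n, shift θ n a = a := by
    intro n
    induction n with
    | zero => exact shift_zero_of_mem θ ha
    | succ n ih => rw [← shift_shift, h, ih]
  have h1 := (hasSum_geom_inv (r := θ) (by rw [abs_of_nonneg] <;> linarith)).tendsto_sum_nat
  have h2 := ((h1.mul_const (a * (1 - a))).const_mul 2).const_add (a * (1 - a))
  have e : a * (1 - a) + 2 * (((θ : ℝ) - 1)⁻¹ * (a * (1 - a))) =
      a * (1 - a) * ((θ + 1) / (θ - 1)) := by
    have : (θ : ℝ) - 1 ≠ 0 := by linarith
    field_simp
    ring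
  rw [e] at h2
  refine h2.congr fun M => ?_
  simp only [asympVar, hfix, covar_self, Finset.sum_mul]

lemma shift_eq_of {θ n : ℕ} {a b : ℝ} (k : ℤ) (hb : b ∈ Set.Ico (0 : ℝ) 1)
    (h : (θ : ℝ) ^ n * a = b + k) : shift θ n a = b := by
  unfold shift
  rw [h, Int.fract_add_intCast, Int.fract_eq_self.2 hb]

lemma tendsto_asympVar_two : Tendsto (fun M => asympVar 2 M (1 / 3)) atTop (nhds (14 / 27)) := by
  have h1 : shift 2 1 (1 / 3) = 2 / 3 := shift_eq_of 0 (by norm_num) (by norm_num)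
  have h2 : shift 2 1 (2 / 3) = 1 / 3 := shift_eq_of 1 (by norm_num) (by norm_num)
  have hs : ∀ n : ℕ, shift 2 (n + 1) (1 / 3) = 1 / 2 + (-1) ^ n / 6 := by
    intro n
    induction n with
    | zero => rw [zero_add, h1]; norm_num
    | succ n ih =>
      rw [add_comm (n + 1) 1, ← shift_shift, ih]
      rcases neg_one_pow_eq_or ℝ n with h | h <;> rw [pow_succ, h]
      · rw [show (1 / 2 + 1 / 6 : ℝ) = 2 / 3 by norm_num, h2]; norm_num
      · rw [show (1 / 2 + -1 / 6 : ℝ) = 1 / 3 by norm_num, h1]; norm_num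
  have hv : ∀ n : ℕ, covar (1 / 3) (shift 2 (n + 1) (1 / 3)) = 1 / 6 - (-1) ^ n / 18 := by
    intro n
    rw [hs]
    unfold covar
    rcases neg_one_pow_eq_or ℝ n with h | h <;> rw [h] <;> norm_num
  have g1 := (hasSum_geom_inv (r := 2) (by norm_num)).mul_right (1 / 6)
  have g2 := (hasSum_geom_inv (r := -2) (by norm_num)).mul_right (1 / 18)
  have g := (((g1.add g2).tendsto_sum_nat).const_mul 2).const_add (2 / 9)
  norm_num at g
  refine g.congr fun M => ?_
  unfold asympVar
  rw [covar_self]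
  norm_num
  refine Finset.sum_congr rfl fun n _ => ?_
  have := hv n
  norm_num at this
  rw [this, neg_pow (2 : ℝ) (n + 1), pow_succ (-1 : ℝ) n]
  rcases neg_one_pow_eq_or ℝ n with h | h <;> rw [h] <;> field_simp <;> norm_num

lemma exists_tendsto_asympVar {θ : ℕ} (hθ : 2 ≤ θ) : ∃ a ∈ Set.Ico (0 : ℝ) 1,
    Tendsto (fun M => asympVar θ M a) atTop (nhds (limVar θ)) := by
  have hθ' : (2 : ℝ) ≤ θ := by exact_mod_cast hθ
  have hp : (0 : ℝ) < θ - 1 := by linarith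
  unfold limVar
  split_ifs with h2 he
  · subst h2
    exact ⟨1 / 3, by norm_num, tendsto_asympVar_two⟩
  · obtain ⟨h, hh⟩ := he
    have hh' : (θ : ℝ) = 2 * h := by rw [hh]; push_cast; ring
    set a : ℝ := (θ - 2) / (2 * (θ - 1)) with ha
    have ham : a ∈ Set.Ico (0 : ℝ) 1 := by
      refine ⟨div_nonneg (by linarith) (by linarith), ?_⟩
      rw [ha, div_lt_one (by linarith)]
      linarith
    refine ⟨a, ham, ?_⟩
    have e : ((θ : ℝ) + 1) * θ * (θ - 2) / (4 * (θ - 1) ^ 3) =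
        a * (1 - a) * ((θ + 1) / (θ - 1)) := by
      rw [ha]; field_simp; ring
    rw [e]
    refine tendsto_asympVar_of_fixed hθ ham (shift_eq_of (h - 1) ham ?_)
    have : (h : ℝ) = θ / 2 := by linarith
    push_cast
    rw [this, ha]
    field_simp
    ring
  · obtain ⟨h, hh⟩ := Nat.not_even_iff_odd.1 he
    have hh' : (θ : ℝ) = 2 * h + 1 := by rw [hh]; push_cast; ring
    refine ⟨1 / 2, by norm_num, ?_⟩
    have e : ((θ : ℝ) + 1) / (4 * (θ - 1)) = 1 / 2 * (1 - 1 / 2) * ((θ + 1) / (θ - 1)) := by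
      field_simp; norm_num
    rw [e]
    refine tendsto_asympVar_of_fixed hθ (by norm_num) (shift_eq_of h (by norm_num) ?_)
    rw [pow_one, hh']
    push_cast
    ring

lemma exists_grid_asympVar_gt {θ : ℕ} (hθ : 2 ≤ θ) {v : ℝ} (hv : v < limVar θ) :
    ∃ M j : ℕ, j < θ ^ M ∧ v < asympVar θ M (j / (θ : ℝ) ^ M) := by
  have hθ' : (2 : ℝ) ≤ θ := by exact_mod_cast hθ
  obtain ⟨a, ha, ht⟩ := exists_tendsto_asympVar hθ
  have hn : ‖(θ : ℝ)⁻¹‖ < 1 := by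
    rw [Real.norm_of_nonneg (by positivity)]
    exact inv_lt_one_of_one_lt₀ (by linarith)
  have h0 := (summable_pow_mul_geometric_of_norm_lt_one 0 hn).tendsto_atTop_zero
  have h1 := (summable_pow_mul_geometric_of_norm_lt_one 1 hn).tendsto_atTop_zero
  have h2 := ht.sub ((h0.const_mul 2).add (h1.const_mul 4))
  norm_num at h2
  obtain ⟨M, hM⟩ := (h2.eventually (lt_mem_nhds hv)).exists
  refine ⟨M, ⌊(θ : ℝ) ^ M * a⌋₊, floor_lt_pow (by lia) M ha, ?_⟩
  have := asympVar_gridFloor_ge (by lia : 0 < θ) M ha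
  refine lt_of_lt_of_le hM (le_trans (le_of_eq ?_) this)
  ring

lemma ae_eventually_notMem_of_summable {s : ℕ → Set ℝ} {b : ℕ → ℝ} (hb : Summable b)
    (h : ∀ᶠ n in atTop, unif.real (s n) ≤ b n) : ∀ᵐ x ∂unif, ∀ᶠ n in atTop, x ∉ s n := by
  obtain ⟨N, hN⟩ := eventually_atTop.1 h
  have h1 : ∀ᵐ x ∂unif, ∀ᶠ n in atTop, x ∉ s (n + N) := by
    refine ae_eventually_notMem ?_
    have hs : Summable fun n => unif.real (s (n + N)) :=
      Summable.of_nonneg_of_le (fun _ => measureReal_nonneg) (fun n => hN _ (by lia))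
        ((summable_nat_add_iff N).2 hb)
    have := hs.tsum_ofReal_ne_top
    simpa [Measure.real, ENNReal.ofReal_toReal (measure_ne_top _ _)] using this
  filter_upwards [h1] with x hx
  obtain ⟨M, hM⟩ := eventually_atTop.1 hx
  filter_upwards [eventually_ge_atTop (M + N)] with n hn
  have := hM (n - N) (by lia)
  rwa [Nat.sub_add_cancel (by lia)] at this

lemma tendsto_log_natCast : Tendsto (fun J : ℕ => log (J : ℝ)) atTop atTop :=
  tendsto_log_atTop.comp tendsto_natCast_atTop_atTop

lemma tendsto_two_pow_mul_log (C : ℝ) (k : ℕ) :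
    Tendsto (fun J : ℕ => C * log (J : ℝ) ^ k / 2 ^ J) atTop (nhds 0) := by
  have h1 : Tendsto (fun J : ℕ => |C| * ((J : ℝ) ^ k / 2 ^ J)) atTop (nhds 0) := by
    simpa using (tendsto_pow_const_div_const_pow_of_one_lt k (r := 2) (by norm_num)).const_mul |C|
  refine squeeze_zero_norm (fun J => ?_) h1
  rw [norm_div, norm_mul, norm_pow, norm_pow, Real.norm_eq_abs, Real.norm_eq_abs, mul_div_assoc]
  have h0 : (0 : ℝ) ≤ log J := log_natCast_nonneg J
  rw [Real.norm_eq_abs, abs_of_nonneg h0]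
  have h2 : log (J : ℝ) ≤ J := log_le_self (by positivity)
  norm_num
  gcongr

lemma exists_tail_bound {θ : ℕ} (hθ : 2 ≤ θ) {M j : ℕ} (hj : j < θ ^ M) {c : ℝ}
    (hc : limVar θ < c) :
    ∃ J₀ : ℕ, ∀ J ≥ J₀, ∀ N : ℕ, 2 ^ J ≤ N →
      unif.real {x | √(2 * c * N * log J) ≤ |ergSum θ (cent (j / (θ : ℝ) ^ M)) N x|} ≤
        8 * Real.exp 1 * (J : ℝ) ^ (-(c / limVar θ)) := by
  have hV := limVar_pos hθ
  set V := limVar θ with hVd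
  have hc0 : 0 < c := hV.trans hc
  obtain ⟨K, hK, h⟩ := exists_mgf_cent_bounds (by lia : 0 < θ) hj
  have e1 := (tendsto_two_pow_mul_log (2 * c * K ^ 2 / V ^ 2) 1).eventually_le_const
    (by norm_num : (0 : ℝ) < 1)
  have e2 := (tendsto_two_pow_mul_log ((2 * c) ^ 3 * K ^ 2 / V ^ 6) 3).eventually_le_const
    (by norm_num : (0 : ℝ) < 1)
  obtain ⟨J₀, hJ₀⟩ := eventually_atTop.1 (e1.and (e2.and (eventually_ge_atTop 2)))
  refine ⟨J₀, fun J hJ N hN => ?_⟩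
  obtain ⟨b1, b2, b3⟩ := hJ₀ J hJ
  have hN2 : (2 : ℝ) ^ J ≤ N := by exact_mod_cast hN
  have hN0 : (0 : ℝ) < N := lt_of_lt_of_le (by positivity) hN2
  have hJ1 : (1 : ℝ) < J := by exact_mod_cast b3
  have hlog : 0 < log (J : ℝ) := log_pos hJ1
  set t := √(2 * c * N * log J) with ht
  have ht2 : t ^ 2 = 2 * c * N * log J := Real.sq_sqrt (by positivity)
  have ht0 : 0 ≤ t := Real.sqrt_nonneg _
  set l := t / (N * V) with hl
  have hl0 : 0 ≤ l := by positivity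
  have hlK : l * K ≤ 1 := by
    rw [← sq_le_one_iff₀ (by positivity)]
    calc (l * K) ^ 2 = 2 * c * K ^ 2 / V ^ 2 * log J ^ 1 / N := by
          rw [hl, mul_pow, div_pow, ht2]; field_simp
      _ ≤ 2 * c * K ^ 2 / V ^ 2 * log J ^ 1 / 2 ^ J := by gcongr
      _ ≤ 1 := b1
  have hlN : N * (K * l ^ 3) ≤ 1 := by
    rw [← sq_le_one_iff₀ (by positivity)]
    calc (N * (K * l ^ 3)) ^ 2 = (2 * c) ^ 3 * K ^ 2 / V ^ 6 * log J ^ 3 / N := by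
          have : (N * (K * l ^ 3)) ^ 2 = N ^ 2 * K ^ 2 * (t ^ 2) ^ 3 / (N * V) ^ 6 := by
            rw [hl]; ring
          rw [this, ht2]; field_simp
      _ ≤ (2 * c) ^ 3 * K ^ 2 / V ^ 6 * log J ^ 3 / 2 ^ J := by gcongr
      _ ≤ 1 := b2
  have hvar : asympVar θ M (j / (θ : ℝ) ^ M) ≤ V := by
    refine asympVar_le hθ M ⟨by positivity, ?_⟩
    rw [div_lt_one (by positivity)]
    exact_mod_cast hj
  have hexp : (4 : ℝ) * Real.exp (N * (l ^ 2 * (asympVar θ M (j / (θ : ℝ) ^ M) / 2) + K * l ^ 3)) ≤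
      4 * Real.exp (N * l ^ 2 * (V / 2) + 1) := by
    gcongr
    have : N * (l ^ 2 * (asympVar θ M (j / (θ : ℝ) ^ M) / 2)) ≤ N * (l ^ 2 * (V / 2)) := by gcongr
    linarith
  have m1 := (h l (by rwa [abs_of_nonneg hl0]) N).2
  have m2 := (h (-l) (by rwa [abs_neg, abs_of_nonneg hl0]) N).2
  rw [abs_of_nonneg hl0] at m1
  rw [abs_neg, abs_of_nonneg hl0, neg_sq] at m2
  refine (measureReal_abs_ge_le ((bddMeas_cent _).ergSum θ N) hl0 (m1.trans hexp)
    (m2.trans hexp)).trans (le_of_eq ?_)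
  have e3 : -l * t = -(2 * (c / V) * log J) := by
    have : -l * t = -(t ^ 2 / (N * V)) := by rw [hl]; ring
    rw [this, ht2]; field_simp
  have e4 : N * l ^ 2 * (V / 2) = c / V * log J := by
    rw [hl, div_pow, ht2]; field_simp
  rw [e3, e4, Real.rpow_def_of_pos (by linarith)]
  have : log (J : ℝ) * -(c / V) = -(2 * (c / V) * log J) + c / V * log J := by ring
  rw [this, Real.exp_add, Real.exp_add]
  ring

lemma summable_tail_bound {p C : ℝ} (hp : 1 < p) : Summable fun J : ℕ => C * (J : ℝ) ^ (-p) :=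
  (Real.summable_nat_rpow.2 (by linarith)).mul_left C

/-- Upper bound on the grid along multiples of powers of two. -/
lemma ae_eventually_grid_lt {θ : ℕ} (hθ : 2 ≤ θ) {c : ℝ} (hc : limVar θ < c) (m R : ℕ) :
    ∀ᵐ x ∂unif, ∀ᶠ J : ℕ in atTop, ∀ i ∈ Finset.Icc 1 R, ∀ j ∈ Finset.range (θ ^ m),
      |ergSum θ (cent (j / (θ : ℝ) ^ m)) (i * 2 ^ J) x| < √(2 * c * (i * 2 ^ J : ℕ) * log J) := by
  have key : ∀ i ∈ Finset.Icc 1 R, ∀ j ∈ Finset.range (θ ^ m), ∀ᵐ x ∂unif, ∀ᶠ J : ℕ in atTop,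
      |ergSum θ (cent (j / (θ : ℝ) ^ m)) (i * 2 ^ J) x| < √(2 * c * (i * 2 ^ J : ℕ) * log J) := by
    intro i hi j hj
    obtain ⟨J₀, h⟩ := exists_tail_bound hθ (Finset.mem_range.1 hj) hc
    have h1 := ae_eventually_notMem_of_summable
      (s := fun J => {x | √(2 * c * (i * 2 ^ J : ℕ) * log J) ≤
        |ergSum θ (cent (j / (θ : ℝ) ^ m)) (i * 2 ^ J) x|})
      (summable_tail_bound (C := 8 * Real.exp 1) ((one_lt_div (limVar_pos hθ)).2 hc))
      ((eventually_ge_atTop J₀).mono fun J hJ => h J hJ _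
        (Nat.le_mul_of_pos_left _ (Finset.mem_Icc.1 hi).1))
    filter_upwards [h1] with x hx
    exact hx.mono fun J hJ => not_le.1 hJ
  have h2 := (ae_ball_iff (Finset.Icc 1 R).countable_toSet).2 fun i hi =>
    (ae_ball_iff (Finset.range (θ ^ m)).countable_toSet).2 fun j hj => key i hi j hj
  filter_upwards [h2] with x hx
  rw [Filter.eventually_all_finset]
  intro i hi
  rw [Filter.eventually_all_finset]
  intro j hj
  exact hx i hi j hj

lemma ae_eventually_chaining {θ : ℕ} (hθ : 2 ≤ θ) (m R : ℕ) :
    ∀ᵐ x ∂unif, ∀ᶠ J : ℕ in atTop, ∀ i ∈ Finset.Icc 1 R, ∀ a ∈ Set.Ico (0 : ℝ) 1,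
      |ergSum θ (cent a) (i * 2 ^ J) x - ergSum θ (cent (gridFloor θ m a)) (i * 2 ^ J) x| ≤
        chainTail θ m * (√(2 * log J) * √((i * 2 ^ J : ℕ) : ℝ)) + θ * √((i * 2 ^ J : ℕ) : ℝ) := by
  have key : ∀ i ∈ Finset.Icc 1 R, ∀ᵐ x ∂unif, ∀ᶠ J : ℕ in atTop, ∀ a ∈ Set.Ico (0 : ℝ) 1,
      |ergSum θ (cent a) (i * 2 ^ J) x - ergSum θ (cent (gridFloor θ m a)) (i * 2 ^ J) x| ≤
        chainTail θ m * (√(2 * log J) * √((i * 2 ^ J : ℕ) : ℝ)) + θ * √((i * 2 ^ J : ℕ) : ℝ) := by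
    intro i hi
    obtain ⟨N₀, h⟩ := exists_chaining hθ m
    have ev : ∀ᶠ J : ℕ in atTop, ∃ B : Set ℝ, MeasurableSet B ∧
        unif.real B ≤ 6 * (J : ℝ) ^ (-(2 : ℝ)) ∧ ∀ x ∉ B, ∀ a ∈ Set.Ico (0 : ℝ) 1,
        |ergSum θ (cent a) (i * 2 ^ J) x - ergSum θ (cent (gridFloor θ m a)) (i * 2 ^ J) x| ≤
        chainTail θ m * (√(2 * log J) * √((i * 2 ^ J : ℕ) : ℝ)) + θ * √((i * 2 ^ J : ℕ) : ℝ) := by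
      filter_upwards [eventually_ge_atTop N₀, eventually_ge_atTop 16] with J hJ hJ16
      have hi1 : 1 ≤ i := (Finset.mem_Icc.1 hi).1
      have hN : 2 ^ J ≤ i * 2 ^ J := Nat.le_mul_of_pos_left _ hi1
      have hJr : (16 : ℝ) ≤ J := by exact_mod_cast hJ16
      have hl1 : 1 ≤ log (J : ℝ) := by
        rw [Real.le_log_iff_exp_le (by linarith)]
        have := Real.exp_one_lt_d9
        linarith
      have hl2 : log (J : ℝ) ≤ J := log_le_self (by linarith)
      obtain ⟨B, hB, hBm, hx⟩ := h (i * 2 ^ J) (by have := @Nat.lt_two_pow_self J; lia)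
        √(2 * log J) (by rw [Real.one_le_sqrt]; linarith) (by
          have h1 : (J : ℝ) / 2 ≤ log ((i * 2 ^ J : ℕ) : ℝ) := by
            calc (J : ℝ) / 2 ≤ J * log 2 := by have := Real.log_two_gt_d9; nlinarith
              _ = log (2 ^ J) := by rw [Real.log_pow]
              _ ≤ _ := Real.log_le_log (by positivity) (by exact_mod_cast hN)
          have h2 : √(2 * log J) ≤ J := by
            rw [Real.sqrt_le_left (by linarith)]
            nlinarith
          nlinarith)
      refine ⟨B, hB, hBm.trans (le_of_eq ?_), hx⟩
      rw [Real.sq_sqrt (by linarith), Real.rpow_def_of_pos (by linarith)]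
      ring_nf
    obtain ⟨J₀, hJ₀⟩ := eventually_atTop.1 ev
    choose! B hB using hJ₀
    have h1 := ae_eventually_notMem_of_summable (s := B)
      (summable_tail_bound (C := 6) (by norm_num : (1 : ℝ) < 2))
      ((eventually_ge_atTop J₀).mono fun J hJ => (hB J hJ).2.1)
    filter_upwards [h1] with x hx
    filter_upwards [hx, eventually_ge_atTop J₀] with J hJ hJ2
    exact (hB J hJ2).2.2 x hJ
  have h2 := (ae_ball_iff (Finset.Icc 1 R).countable_toSet).2 fun i hi => key i hi
  filter_upwards [h2] with x hx
  rw [Filter.eventually_all_finset]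
  exact fun i hi => hx i hi

lemma exists_ae_eventually_maximal {θ : ℕ} (hθ : 2 ≤ θ) : ∃ C > 0, ∀ R : ℕ,
    ∀ᵐ x ∂unif, ∀ᶠ J : ℕ in atTop, ∀ i ∈ Finset.Icc 1 R, ∀ a ∈ Set.Ico (0 : ℝ) 1, ∀ l < 2 ^ J,
      |ergSum θ (cent a) l (shift θ (i * 2 ^ J) x)| ≤ C * √(2 ^ J * log J) := by
  obtain ⟨C, hC, J₀, h⟩ := exists_maximal_bound hθ
  refine ⟨C, hC, fun R => ?_⟩
  choose! B hB using h
  have key : ∀ i ∈ Finset.Icc 1 R, ∀ᵐ x ∂unif, ∀ᶠ J : ℕ in atTop,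
      ∀ a ∈ Set.Ico (0 : ℝ) 1, ∀ l < 2 ^ J,
      |ergSum θ (cent a) l (shift θ (i * 2 ^ J) x)| ≤ C * √(2 ^ J * log J) := by
    intro i hi
    have h1 := ae_eventually_notMem_of_summable (s := fun J => shift θ (i * 2 ^ J) ⁻¹' B J)
      (summable_tail_bound (C := 6) (by norm_num : (1 : ℝ) < 2))
      ((eventually_ge_atTop J₀).mono fun J hJ => by
        rw [measureReal_preimage_shift (by lia) _ (hB J hJ).1]
        refine (hB J hJ).2.1.trans (le_of_eq ?_)
        rw [Real.rpow_neg (by positivity)]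
        norm_num)
    filter_upwards [h1] with x hx
    filter_upwards [hx, eventually_ge_atTop J₀] with J hJ hJ2
    exact (hB J hJ2).2.2 _ hJ
  have h2 := (ae_ball_iff (Finset.Icc 1 R).countable_toSet).2 fun i hi => key i hi
  filter_upwards [h2] with x hx
  rw [Filter.eventually_all_finset]
  exact fun i hi => hx i hi

lemma tendsto_log_log_natCast : Tendsto (fun n : ℕ => log (log (n : ℝ))) atTop atTop :=
  tendsto_log_atTop.comp tendsto_log_natCast

/-- The upper half of the law of the iterated logarithm. -/
theorem ae_eventually_abs_ergSum_le {θ : ℕ} (hθ : 2 ≤ θ) {c : ℝ} (hc : limVar θ < c) :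
    ∀ᵐ x ∂unif, ∀ᶠ n : ℕ in atTop, ∀ a ∈ Set.Ico (0 : ℝ) 1,
      |ergSum θ (cent a) n x| ≤ √(2 * c * n * log (log n)) := by
  have hV := limVar_pos hθ
  set c₁ := (limVar θ + c) / 2 with hc₁
  have hc1 : limVar θ < c₁ := by linarith
  have hc2 : c₁ < c := by linarith
  have hlt : √(2 * c₁) < √(2 * c) := Real.sqrt_lt_sqrt (by linarith) (by linarith)
  set δ := (√(2 * c) - √(2 * c₁)) / 6 with hδ
  have hδ0 : 0 < δ := by linarith
  set B := √(2 * c₁) + 3 * δ with hB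
  have hB0 : 0 ≤ B := by positivity
  have hB2 : B ^ 2 < 2 * c := by
    rw [← Real.lt_sqrt hB0]
    linarith
  obtain ⟨m, hm⟩ := ((tendsto_chainTail θ).mul_const √2).eventually_lt_const
    (by simpa using hδ0 : 0 * √2 < δ) |>.exists
  obtain ⟨C, hC, hmax⟩ := exists_ae_eventually_maximal hθ
  obtain ⟨r, hr⟩ : ∃ r : ℕ, C ≤ δ * √(2 ^ r) := by
    obtain ⟨r, hr⟩ := pow_unbounded_of_one_lt ((C / δ) ^ 2) (by norm_num : (1 : ℝ) < 2)
    refine ⟨r, ?_⟩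
    have := Real.le_sqrt_of_sq_le hr.le
    rwa [div_le_iff₀' hδ0] at this
  have hlarge : ∀ᶠ J : ℕ in atTop, (θ : ℝ) ≤ δ * √(log J) :=
    ((tendsto_sqrt_atTop.comp tendsto_log_natCast).const_mul_atTop hδ0).eventually_ge_atTop _
  have hlog : ∀ᶠ n : ℕ in atTop, B ^ 2 * log 2 ≤ (2 * c - B ^ 2) * log (log (n : ℝ)) :=
    (tendsto_log_log_natCast.const_mul_atTop (by linarith)).eventually_ge_atTop _
  filter_upwards [ae_eventually_grid_lt hθ hc1 m (2 ^ (r + 1)),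
    ae_eventually_chaining hθ m (2 ^ (r + 1)), hmax (2 ^ (r + 1))] with x h1 h2 h3
  obtain ⟨J₀, hJ₀⟩ := eventually_atTop.1 (h1.and (h2.and (h3.and (hlarge.and
    (eventually_ge_atTop 1)))))
  filter_upwards [hlog, eventually_ge_atTop (2 ^ (J₀ + r))] with n hn1 hn2 a ha
  have hn0 : n ≠ 0 := by have := Nat.two_pow_pos (J₀ + r); lia
  have hk : J₀ + r ≤ Nat.log 2 n := Nat.le_log_of_pow_le (by norm_num) hn2
  have hk1 : 2 ^ Nat.log 2 n ≤ n := Nat.pow_log_le_self 2 hn0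
  have hk2 : n < 2 ^ (Nat.log 2 n + 1) := Nat.lt_pow_succ_log_self (by norm_num) n
  obtain ⟨J, hJ⟩ : ∃ J, Nat.log 2 n = J + r := ⟨Nat.log 2 n - r, by lia⟩
  rw [hJ] at hk hk1 hk2
  obtain ⟨g1, g2, g3, g4, g5⟩ := hJ₀ J (by lia)
  set i := n / 2 ^ J with hi
  have hJpos := Nat.two_pow_pos J
  have hi1 : 2 ^ r ≤ i := by
    rw [hi, Nat.le_div_iff_mul_le hJpos, ← pow_add, add_comm]; exact hk1
  have hi2 : i < 2 ^ (r + 1) := by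
    rw [hi, Nat.div_lt_iff_lt_mul hJpos, ← pow_add]
    convert hk2 using 2
    ring
  have him : i ∈ Finset.Icc 1 (2 ^ (r + 1)) :=
    Finset.mem_Icc.2 ⟨(Nat.two_pow_pos r).trans_le hi1, hi2.le⟩
  have hdm : i * 2 ^ J + n % 2 ^ J = n := Nat.div_add_mod' n (2 ^ J)
  have hNn : ((i * 2 ^ J : ℕ) : ℝ) ≤ n := by exact_mod_cast (Nat.le.intro hdm)
  have hlogJ : 0 ≤ log (J : ℝ) := log_natCast_nonneg J
  set N := i * 2 ^ J with hN
  have hj : ⌊(θ : ℝ) ^ m * a⌋₊ ∈ Finset.range (θ ^ m) :=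
    Finset.mem_range.2 (floor_lt_pow (by lia) m ha)
  have b1 := (g1 i him _ hj).le
  have b2 := g2 i him a ha
  have b3 := g3 i him a ha (n % 2 ^ J) (Nat.mod_lt _ hJpos)
  change |ergSum θ (cent (gridFloor θ m a)) N x| ≤ _ at b1
  rw [← hN] at b1 b2 b3
  have e0 : √((n : ℝ) * log J) = √n * √(log J) := Real.sqrt_mul (by positivity) _
  have hsN : √(N : ℝ) ≤ √n := Real.sqrt_le_sqrt hNn
  have c1 : √(2 * c₁ * N * log J) ≤ √(2 * c₁) * √(n * log J) := by
    rw [← Real.sqrt_mul (by linarith)]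
    refine Real.sqrt_le_sqrt ?_
    have : (N : ℝ) * log J ≤ n * log J := by gcongr
    have h5 : 0 ≤ 2 * c₁ := by linarith
    nlinarith
  have c2 : chainTail θ m * (√(2 * log J) * √(N : ℝ)) ≤ δ * √(n * log J) := by
    rw [Real.sqrt_mul (by norm_num), e0]
    calc chainTail θ m * (√2 * √(log J) * √(N : ℝ)) =
        (chainTail θ m * √2) * (√(N : ℝ) * √(log J)) := by ring
      _ ≤ δ * (√n * √(log J)) := by gcongr
  have c3 : θ * √(N : ℝ) ≤ δ * √(n * log J) := by
    rw [e0]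
    calc θ * √(N : ℝ) ≤ (δ * √(log J)) * √n := by gcongr
      _ = _ := by ring
  have c4 : C * √(2 ^ J * log J) ≤ δ * √(n * log J) := by
    calc C * √(2 ^ J * log J) ≤ δ * √(2 ^ r) * √(2 ^ J * log J) := by gcongr
      _ = δ * √(2 ^ (J + r) * log J) := by
        rw [mul_assoc, ← Real.sqrt_mul (by positivity), pow_add]
        ring_nf
      _ ≤ δ * √(n * log J) := by
        gcongr
        exact_mod_cast hk1
  have c5 : |ergSum θ (cent a) n x| ≤ B * √(n * log J) := by
    rw [← hdm, ergSum_add, hdm]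
    have t1 := abs_add_le (ergSum θ (cent a) N x) (ergSum θ (cent a) (n % 2 ^ J) (shift θ N x))
    have t2 := abs_sub_abs_le_abs_sub (ergSum θ (cent a) N x)
      (ergSum θ (cent (gridFloor θ m a)) N x)
    rw [hB]
    linarith
  refine c5.trans ?_
  have hlogn : log (J : ℝ) ≤ log 2 + log (log n) := by
    have hJ1 : (1 : ℝ) ≤ J := by exact_mod_cast g5
    have h2n : (2 : ℝ) ^ J ≤ n := by
      have : 2 ^ J ≤ n := (Nat.pow_le_pow_right (by norm_num) (by lia)).trans hk1
      exact_mod_cast this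
    have h5 : J * log 2 ≤ log n := by
      rw [← Real.log_pow]
      exact Real.log_le_log (by positivity) h2n
    have h6 : (J : ℝ) ≤ 2 * log n := by
      have := Real.log_two_gt_d9
      nlinarith
    have h7 : 0 < log (n : ℝ) := by linarith
    rw [← Real.log_mul (by norm_num) h7.ne']
    exact Real.log_le_log (by linarith) h6
  refine Real.le_sqrt_of_sq_le ?_
  rw [mul_pow, Real.sq_sqrt (by positivity)]
  have h8 : B ^ 2 * log (J : ℝ) ≤ 2 * c * log (log n) := by
    have := mul_le_mul_of_nonneg_left hlogn (sq_nonneg B)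
    linarith
  calc B ^ 2 * (n * log J) = n * (B ^ 2 * log J) := by ring
    _ ≤ n * (2 * c * log (log n)) := by gcongr
    _ = _ := by ring

/-- A lower tail estimate from two-sided bounds for the moment generating function. -/
lemma measureReal_ge_of_mgf {X : ℝ → ℝ} (hX : BddMeas X) {l y E δ : ℝ} (hl : 0 ≤ l)
    (hly : l * y = 2 * E) (hδ : 0 ≤ δ)
    (h0 : 1 / 4 * Real.exp (E - 1) ≤ ∫ x, Real.exp (l * X x) ∂unif)
    (h1 : ∫ x, Real.exp (((1 - δ) * l) * X x) ∂unif ≤ 4 * Real.exp ((1 - δ) ^ 2 * E + 1))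
    (h2 : ∫ x, Real.exp (((1 + δ) * l) * X x) ∂unif ≤ 4 * Real.exp ((1 + δ) ^ 2 * E + 1))
    (hE : 64 * Real.exp 2 ≤ Real.exp (δ ^ 2 * E)) :
    1 / 8 * Real.exp (-(E * (1 + 2 * δ)) - 1) ≤ unif.real {x | (1 - δ) * y ≤ X x} := by
  have hA : MeasurableSet {x | (1 - δ) * y ≤ X x} := measurableSet_le measurable_const hX.meas
  set A := {x | (1 - δ) * y ≤ X x} with hAd
  set p := Real.exp (δ * (1 - δ) * (2 * E))
  set q := Real.exp (-(δ * (1 + δ) * (2 * E)))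
  set w := Real.exp ((1 + δ) * (2 * E)) with hw
  have pt : ∀ x, Real.exp (l * X x) ≤ p * Real.exp (((1 - δ) * l) * X x) +
      q * Real.exp (((1 + δ) * l) * X x) + w * A.indicator (fun _ => 1) x := by
    intro x
    have i1 : 0 ≤ A.indicator (fun _ => (1 : ℝ)) x := Set.indicator_nonneg (by simp) x
    by_cases c1 : X x < (1 - δ) * y
    · have : Real.exp (l * X x) ≤ p * Real.exp (((1 - δ) * l) * X x) := by
        rw [← Real.exp_add, Real.exp_le_exp]
        have := mul_le_mul_of_nonneg_left c1.le (mul_nonneg hδ hl)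
        have e : δ * l * ((1 - δ) * y) = δ * (1 - δ) * (2 * E) := by rw [← hly]; ring
        linarith
      have : 0 ≤ q * Real.exp (((1 + δ) * l) * X x) := by positivity
      have : 0 ≤ w * A.indicator (fun _ => 1) x := by positivity
      linarith
    · by_cases c2 : (1 + δ) * y < X x
      · have : Real.exp (l * X x) ≤ q * Real.exp (((1 + δ) * l) * X x) := by
          rw [← Real.exp_add, Real.exp_le_exp]
          have := mul_le_mul_of_nonneg_left c2.le (mul_nonneg hδ hl)
          have e : δ * l * ((1 + δ) * y) = δ * (1 + δ) * (2 * E) := by rw [← hly]; ring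
          linarith
        have : 0 ≤ p * Real.exp (((1 - δ) * l) * X x) := by positivity
        have : 0 ≤ w * A.indicator (fun _ => 1) x := by positivity
        linarith
      · have hx : x ∈ A := not_lt.1 c1
        rw [Set.indicator_of_mem hx, mul_one]
        have : Real.exp (l * X x) ≤ w := by
          rw [hw, Real.exp_le_exp]
          have := mul_le_mul_of_nonneg_left (not_lt.1 c2) hl
          have e : l * ((1 + δ) * y) = (1 + δ) * (2 * E) := by rw [← hly]; ring
          linarith
        have : 0 ≤ p * Real.exp (((1 - δ) * l) * X x) := by positivity
        have : 0 ≤ q * Real.exp (((1 + δ) * l) * X x) := by positivity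
        linarith
  have b1 : BddMeas fun x => p * Real.exp (((1 - δ) * l) * X x) := (hX.const_mul _).exp.const_mul p
  have b2 : BddMeas fun x => q * Real.exp (((1 + δ) * l) * X x) := (hX.const_mul _).exp.const_mul q
  have b3 : BddMeas fun x => w * A.indicator (fun _ => 1) x := (BddMeas.indicator hA).const_mul w
  have hint := integral_mono (hX.const_mul l).exp.integrable ((b1.add b2).add b3).integrable pt
  rw [integral_add (b1.add b2).integrable b3.integrable, integral_add b1.integrable b2.integrable,
    integral_const_mul, integral_const_mul, integral_const_mul,
    integral_indicator_const _ hA] at hint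
  simp only [smul_eq_mul, mul_one] at hint
  have k1 : p * ∫ x, Real.exp (((1 - δ) * l) * X x) ∂unif ≤
      4 * Real.exp (E * (1 - δ ^ 2) + 1) := by
    refine (mul_le_mul_of_nonneg_left h1 (by positivity)).trans (le_of_eq ?_)
    rw [mul_left_comm, ← Real.exp_add]
    ring_nf
  have k2 : q * ∫ x, Real.exp (((1 + δ) * l) * X x) ∂unif ≤
      4 * Real.exp (E * (1 - δ ^ 2) + 1) := by
    refine (mul_le_mul_of_nonneg_left h2 (by positivity)).trans (le_of_eq ?_)
    rw [mul_left_comm, ← Real.exp_add]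
    ring_nf
  have k3 : 8 * Real.exp (E * (1 - δ ^ 2) + 1) ≤ 1 / 8 * Real.exp (E - 1) := by
    have := mul_le_mul_of_nonneg_right hE (Real.exp_nonneg (E * (1 - δ ^ 2) - 1))
    rw [mul_assoc, ← Real.exp_add, ← Real.exp_add] at this
    have e1 : 2 + (E * (1 - δ ^ 2) - 1) = E * (1 - δ ^ 2) + 1 := by ring
    have e2 : δ ^ 2 * E + (E * (1 - δ ^ 2) - 1) = E - 1 := by ring
    rw [e1, e2] at this
    linarith
  have k4 : 1 / 8 * Real.exp (E - 1) ≤ w * unif.real A := by linarith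
  have k5 : 1 / 8 * Real.exp (-(E * (1 + 2 * δ)) - 1) * w = 1 / 8 * Real.exp (E - 1) := by
    rw [hw, mul_assoc, ← Real.exp_add]
    ring_nf
  rw [← k5, mul_comm w] at k4
  exact le_of_mul_le_mul_right k4 (by positivity)

set_option maxHeartbeats 800000 in
lemma exists_lower_tail {θ : ℕ} (hθ : 2 ≤ θ) {M j : ℕ} (hj : j < θ ^ M) {c : ℝ} (hc0 : 0 < c)
    (hc : c < asympVar θ M (j / (θ : ℝ) ^ M)) :
    ∃ k₀ : ℕ, ∀ k ≥ k₀, ∀ n : ℕ, 2 ^ k ≤ n →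
      1 / (k : ℝ) ≤
        unif.real {x | √(2 * c * n * log k) ≤ ergSum θ (cent (j / (θ : ℝ) ^ M)) n x} := by
  obtain ⟨K, hK, h⟩ := exists_mgf_cent_bounds (by lia : 0 < θ) hj
  set W := asympVar θ M (j / (θ : ℝ) ^ M) with hWd
  have hW : 0 < W := hc0.trans hc
  set δ := (1 - c / W) / 5 with hδ
  have hcW : c / W < 1 := (div_lt_one hW).2 hc
  have hcW0 : 0 < c / W := by positivity
  have hδ0 : 0 < δ := by linarith
  have hδ1 : δ < 1 / 5 := by linarith
  have e1 := (tendsto_two_pow_mul_log (8 * K ^ 2 / W) 1).eventually_le_const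
    (by norm_num : (0 : ℝ) < 1)
  have e2 := (tendsto_two_pow_mul_log (512 * K ^ 2 / W ^ 3) 3).eventually_le_const
    (by norm_num : (0 : ℝ) < 1)
  have e3 : ∀ᶠ k : ℕ in atTop, log 64 + 2 ≤ δ ^ 2 * (1 - 3 * δ) * log (k : ℝ) :=
    (tendsto_log_natCast.const_mul_atTop (by
      have : 0 < 1 - 3 * δ := by linarith
      positivity)).eventually_ge_atTop _
  have e4 : ∀ᶠ k : ℕ in atTop, log 8 + 1 ≤ δ * log (k : ℝ) :=
    (tendsto_log_natCast.const_mul_atTop hδ0).eventually_ge_atTop _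
  obtain ⟨k₀, hk₀⟩ := eventually_atTop.1 (e1.and (e2.and (e3.and (e4.and (eventually_ge_atTop 2)))))
  refine ⟨k₀, fun k hk n hn => ?_⟩
  obtain ⟨b1, b2, b3, b4, b5⟩ := hk₀ k hk
  have hn2 : (2 : ℝ) ^ k ≤ n := by exact_mod_cast hn
  have hn0 : (0 : ℝ) < n := lt_of_lt_of_le (by positivity) hn2
  have hk1 : (1 : ℝ) < k := by exact_mod_cast b5
  have hlog : 0 < log (k : ℝ) := log_pos hk1
  set E := (1 - 3 * δ) * log (k : ℝ) with hE
  have hE0 : 0 < E := mul_pos (by linarith) hlog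
  have hElog : E ≤ log k := by nlinarith
  set l := √(2 * E / (n * W)) with hl
  have hl0 : 0 ≤ l := Real.sqrt_nonneg _
  have hl2 : l ^ 2 = 2 * E / (n * W) := Real.sq_sqrt (by positivity)
  have hlE : n * (l ^ 2 * (W / 2)) = E := by rw [hl2]; field_simp
  have hlK : 2 * l * K ≤ 1 := by
    rw [← sq_le_one_iff₀ (by positivity)]
    calc (2 * l * K) ^ 2 = 4 * l ^ 2 * K ^ 2 := by ring
      _ = 8 * K ^ 2 / W * E ^ 1 / n := by rw [hl2]; field_simp; norm_num
      _ ≤ 8 * K ^ 2 / W * log k ^ 1 / 2 ^ k := by gcongr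
      _ ≤ 1 := b1
  have hlN : n * (K * (2 * l) ^ 3) ≤ 1 := by
    rw [← sq_le_one_iff₀ (by positivity)]
    calc (n * (K * (2 * l) ^ 3)) ^ 2 = 64 * n ^ 2 * K ^ 2 * (l ^ 2) ^ 3 := by ring
      _ = 512 * K ^ 2 / W ^ 3 * E ^ 3 / n := by rw [hl2]; field_simp; norm_num
      _ ≤ 512 * K ^ 2 / W ^ 3 * log k ^ 3 / 2 ^ k := by gcongr
      _ ≤ 1 := b2
  have mgf : ∀ r : ℝ, 0 ≤ r → r ≤ 2 →
      1 / 4 * Real.exp (r ^ 2 * E - 1) ≤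
        ∫ x, Real.exp ((r * l) * ergSum θ (cent (j / (θ : ℝ) ^ M)) n x) ∂unif ∧
      ∫ x, Real.exp ((r * l) * ergSum θ (cent (j / (θ : ℝ) ^ M)) n x) ∂unif ≤
        4 * Real.exp (r ^ 2 * E + 1) := by
    intro r hr0 hr2
    have hrl : r * l ≤ 2 * l := by gcongr
    have habs : |r * l| = r * l := abs_of_nonneg (by positivity)
    have := h (r * l) (by
      rw [habs]
      exact (mul_le_mul_of_nonneg_right hrl hK.le).trans hlK) n
    rw [habs] at this
    have h3 : n * (K * (r * l) ^ 3) ≤ 1 := le_trans (by gcongr) hlN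
    have h4 : n * ((r * l) ^ 2 * (W / 2)) = r ^ 2 * E := by rw [← hlE]; ring
    refine ⟨le_trans ?_ this.1, this.2.trans ?_⟩ <;> gcongr <;> linarith
  have m0 := (mgf 1 (by norm_num) (by norm_num)).1
  have m1 := (mgf (1 - δ) (by linarith) (by linarith)).2
  have m2 := (mgf (1 + δ) (by linarith) (by linarith)).2
  rw [one_pow, one_mul, one_mul] at m0
  have hly : l * (l * n * W) = 2 * E := by
    have : l * (l * n * W) = l ^ 2 * (n * W) := by ring
    rw [this, hl2]; field_simp
  have main := measureReal_ge_of_mgf ((bddMeas_cent (j / (θ : ℝ) ^ M)).ergSum θ n) hl0 hly hδ0.le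
    m0 m1 m2 (by
      rw [← Real.exp_log (by norm_num : (0 : ℝ) < 64), ← Real.exp_add, Real.exp_le_exp]
      linarith)
  have hlow : 1 / (k : ℝ) ≤ 1 / 8 * Real.exp (-(E * (1 + 2 * δ)) - 1) := by
    have q1 : 1 / (k : ℝ) = Real.exp (-log k) := by
      rw [Real.exp_neg, Real.exp_log (by linarith), one_div]
    have q2 : (1 : ℝ) / 8 = Real.exp (-log 8) := by
      rw [Real.exp_neg, Real.exp_log (by norm_num), one_div]
    rw [q1, q2, ← Real.exp_add, Real.exp_le_exp]
    have : E * (1 + 2 * δ) ≤ (1 - δ) * log k := by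
      rw [hE, mul_right_comm]
      gcongr
      nlinarith
    linarith
  refine hlow.trans (main.trans ?_)
  refine measureReal_mono (fun x hx => ?_)
  refine le_trans ?_ (show (1 - δ) * (l * n * W) ≤ _ from hx)
  refine Real.sqrt_le_iff.2 ⟨mul_nonneg (by linarith) (by positivity), ?_⟩
  have q3 : ((1 - δ) * (l * n * W)) ^ 2 = (1 - δ) ^ 2 * (1 - 3 * δ) * W * (2 * n * log k) := by
    have : ((1 - δ) * (l * n * W)) ^ 2 = (1 - δ) ^ 2 * (l ^ 2 * n ^ 2 * W ^ 2) := by ring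
    rw [this, hl2, hE]; field_simp
  rw [q3]
  have q4 : c = (1 - 5 * δ) * W := by rw [hδ]; field_simp; ring
  have q5 : c ≤ (1 - δ) ^ 2 * (1 - 3 * δ) * W := by
    rw [q4]
    have q6 : 1 - 5 * δ ≤ (1 - δ) ^ 2 * (1 - 3 * δ) := by
      have : (1 - δ) ^ 2 * (1 - 3 * δ) - (1 - 5 * δ) = δ ^ 2 * (7 - 3 * δ) := by ring
      have : 0 ≤ δ ^ 2 * (7 - 3 * δ) := mul_nonneg (sq_nonneg δ) (by linarith)
      linarith
    exact mul_le_mul_of_nonneg_right q6 hW.le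
  calc 2 * c * n * log k = c * (2 * n * log k) := by ring
    _ ≤ _ := by gcongr

lemma IsLevel.finset_prod {θ m : ℕ} {ι : Type*} (s : Finset ι) {u : ι → ℝ → ℝ}
    (h : ∀ i ∈ s, IsLevel θ m (u i)) : IsLevel θ m (fun x => ∏ i ∈ s, u i x) :=
  fun x y hxy => Finset.prod_congr rfl fun i hi => h i hi x y hxy

lemma BddMeas.finset_prod {ι : Type*} (s : Finset ι) {u : ι → ℝ → ℝ}
    (h : ∀ i ∈ s, BddMeas (u i)) : BddMeas (fun x => ∏ i ∈ s, u i x) := by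
  classical
  induction s using Finset.induction_on with
  | empty => simpa using BddMeas.const 1
  | insert a s ha ih =>
    simp only [Finset.prod_insert ha]
    exact (h a (Finset.mem_insert_self _ _)).mul
      (ih fun i hi => h i (Finset.mem_insert_of_mem hi))

lemma integral_prod_shift {θ : ℕ} (hθ : 0 < θ) {N : ℕ → ℕ} (hN : Monotone N) {F : ℕ → ℝ → ℝ}
    {K : ℕ} (hF : ∀ k ≥ K, IsLevel θ (N (k + 1) - N k) (F k)) (hFb : ∀ k, BddMeas (F k)) {L : ℕ}
    (hL : K ≤ L) :
    ∫ x, ∏ k ∈ Finset.Ico K L, F k (shift θ (N k) x) ∂unif =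
      ∏ k ∈ Finset.Ico K L, ∫ x, F k x ∂unif := by
  induction L, hL using Nat.le_induction with
  | base => simp
  | succ L hL ih =>
    simp only [Finset.prod_Ico_succ_top hL]
    rw [← ih]
    refine IsLevel.integral_mul_shift hθ (IsLevel.finset_prod _ fun k hk => ?_)
      (BddMeas.finset_prod _ fun k _ => (hFb k).comp (measurable_shift θ _)) (hFb L)
    obtain ⟨h1, h2⟩ := Finset.mem_Ico.1 hk
    refine ((hF k h1).comp_shift hθ (N k)).mono hθ ?_
    rw [Nat.add_sub_cancel' (hN (Nat.le_succ k))]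
    exact hN h2

lemma ae_frequently_shift_mem {θ : ℕ} (hθ : 0 < θ) {N : ℕ → ℕ} (hN : Monotone N)
    {A : ℕ → Set ℝ} (hA : ∀ k, MeasurableSet (A k)) {K₀ : ℕ}
    (hl : ∀ k ≥ K₀, IsLevel θ (N (k + 1) - N k) (fun x => x ∈ A k))
    (hp : ∀ k ≥ K₀, 1 / (k : ℝ) ≤ unif.real (A k)) :
    ∀ᵐ x ∂unif, ∃ᶠ k in atTop, shift θ (N k) x ∈ A k := by
  classical
  have key : ∀ K ≥ K₀, ∀ᵐ x ∂unif, ∃ k ≥ K, shift θ (N k) x ∈ A k := by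
    intro K hK
    rw [ae_iff]
    set Z := {x | ¬∃ k ≥ K, shift θ (N k) x ∈ A k} with hZ
    rw [← measureReal_eq_zero_iff]
    refine le_antisymm ?_ measureReal_nonneg
    have hbound : ∀ L ≥ K, unif.real Z ≤ Real.exp (-∑ k ∈ Finset.Ico K L, 1 / (k : ℝ)) := by
      intro L hL
      have hm : MeasurableSet (⋂ k ∈ Finset.Ico K L, shift θ (N k) ⁻¹' (A k)ᶜ) :=
        Finset.measurableSet_biInter _ fun k _ => measurable_shift _ _ (hA k).compl
      have h1 : unif.real Z ≤ unif.real (⋂ k ∈ Finset.Ico K L, shift θ (N k) ⁻¹' (A k)ᶜ) := by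
        refine measureReal_mono fun x hx => ?_
        simp only [hZ, Set.mem_ofPred_eq, not_exists, not_and] at hx
        simp only [Set.mem_iInter]
        exact fun k hk => hx k (Finset.mem_Ico.1 hk).1
      refine h1.trans ?_
      have h2 : unif.real (⋂ k ∈ Finset.Ico K L, shift θ (N k) ⁻¹' (A k)ᶜ) =
          ∫ x, ∏ k ∈ Finset.Ico K L, ((A k)ᶜ.indicator fun _ => (1 : ℝ))
            (shift θ (N k) x) ∂unif := by
        rw [← integral_indicator_one hm]
        refine integral_congr_ae (ae_of_all _ fun x => ?_)
        simp only [Set.indicator_apply, Pi.one_apply]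
        rw [Finset.prod_ite_zero]
        simp
      rw [h2, integral_prod_shift hθ hN (K := K) (fun k hk => ?_)
        (fun k => BddMeas.indicator (hA k).compl) hL, ← Finset.sum_neg_distrib, Real.exp_sum]
      · refine Finset.prod_le_prod (fun k _ => integral_nonneg fun x =>
          Set.indicator_nonneg (by simp) x) fun k hk => ?_
        rw [integral_indicator_const _ (hA k).compl, smul_eq_mul, mul_one,
          probReal_compl_eq_one_sub (hA k)]
        have h3 := hp k (hK.trans (Finset.mem_Ico.1 hk).1)
        have h4 := Real.add_one_le_exp (-(1 / (k : ℝ)))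
        linarith
      · have := (hl k (hK.trans hk)).comp fun p : Prop => if p then (0 : ℝ) else 1
        convert this using 2 with x
        by_cases hx : x ∈ A k <;> simp [hx]
    have hdiv : Tendsto (fun L => ∑ k ∈ Finset.Ico K L, 1 / (k : ℝ)) atTop atTop := by
      have h1 : Tendsto (fun L => ∑ k ∈ Finset.range L, 1 / (k : ℝ)) atTop atTop := by
        rw [← not_summable_iff_tendsto_nat_atTop_of_nonneg (fun n => by positivity)]
        exact Real.not_summable_one_div_natCast
      have h2 := tendsto_atTop_add_const_right atTop (-∑ k ∈ Finset.range K, 1 / (k : ℝ)) h1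
      refine h2.congr' ?_
      filter_upwards [eventually_ge_atTop K] with L hL
      rw [Finset.sum_Ico_eq_sub _ hL, sub_eq_add_neg]
    exact ge_of_tendsto (Real.tendsto_exp_neg_atTop_nhds_zero.comp hdiv)
      ((eventually_ge_atTop K).mono hbound)
  have key2 : ∀ᵐ x ∂unif, ∀ K, ∃ k ≥ K + K₀, shift θ (N k) x ∈ A k :=
    ae_all_iff.2 fun K => key (K + K₀) (by lia)
  filter_upwards [key2] with x hx
  rw [frequently_atTop]
  intro K
  obtain ⟨k, hk, h⟩ := hx K
  exact ⟨k, by lia, h⟩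

lemma eventually_log_log_pow_le {Q : ℕ} (hQ : 3 ≤ Q) : ∀ᶠ k : ℕ in atTop,
    log (log ((Q : ℝ) ^ (k + 1))) ≤ (1 + 1 / (Q : ℝ)) * log k := by
  have hQr : (3 : ℝ) ≤ Q := by exact_mod_cast hQ
  have hlQ : 0 < log (Q : ℝ) := log_pos (by linarith)
  have e : ∀ᶠ k : ℕ in atTop, log 2 + log (log (Q : ℝ)) ≤ 1 / (Q : ℝ) * log (k : ℝ) :=
    (tendsto_log_natCast.const_mul_atTop (by positivity)).eventually_ge_atTop _
  filter_upwards [e, eventually_ge_atTop 1] with k hk hk1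
  have hk1' : (1 : ℝ) ≤ k := by exact_mod_cast hk1
  rw [Real.log_pow, Real.log_mul (by positivity) hlQ.ne']
  have h1 : log ((k + 1 : ℕ) : ℝ) ≤ log 2 + log k := by
    rw [← Real.log_mul (by norm_num) (by positivity)]
    refine Real.log_le_log (by positivity) ?_
    push_cast
    linarith
  linarith

lemma exists_ratio {c c' C : ℝ} (hc' : 0 < c') (h : c < c') :
    ∃ Q : ℕ, 3 ≤ Q ∧ √(2 * C * (1 / (Q : ℝ)) * (1 + 1 / (Q : ℝ))) + √(2 * c * (1 + 1 / (Q : ℝ))) ≤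
      √(2 * c' * (1 - 2 * (1 / (Q : ℝ)))) := by
  have hlim : Tendsto (fun Q : ℕ => 1 / (Q : ℝ)) atTop (nhds 0) :=
    tendsto_one_div_atTop_nhds_zero_nat
  have hcont : Continuous fun u : ℝ => √(2 * C * u * (1 + u)) + √(2 * c * (1 + u)) -
      √(2 * c' * (1 - 2 * u)) := by fun_prop
  have h1 := (hcont.tendsto 0).comp hlim
  have h2 : √(2 * C * 0 * (1 + 0)) + √(2 * c * (1 + 0)) - √(2 * c' * (1 - 2 * 0)) < 0 := by
    have : √(2 * c) < √(2 * c') := Real.sqrt_lt_sqrt_iff_of_pos (by linarith) |>.2 (by linarith)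
    simpa using this
  obtain ⟨Q, hQ1, hQ2⟩ := ((h1.eventually_lt_const h2).and (eventually_ge_atTop 3)).exists
  exact ⟨Q, hQ2, by simp only [Function.comp] at hQ1; linarith⟩

/-- The lower half of the law of the iterated logarithm. -/
theorem ae_frequently_le_abs_ergSum {θ : ℕ} (hθ : 2 ≤ θ) {c : ℝ} (hc0 : 0 < c)
    (hc : c < limVar θ) :
    ∀ᵐ x ∂unif, ∃ᶠ n : ℕ in atTop, ∃ a ∈ Set.Ico (0 : ℝ) 1,
      √(2 * c * n * log (log n)) ≤ |ergSum θ (cent a) n x| := by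
  have hθ0 : 0 < θ := by lia
  set c' := (c + limVar θ) / 2 with hcd
  have hcc : c < c' := by linarith
  have hcl : c' < limVar θ := by linarith
  have hc'0 : 0 < c' := by linarith
  obtain ⟨M, j, hj, hW⟩ := exists_grid_asympVar_gt hθ hcl
  set a : ℝ := j / (θ : ℝ) ^ M with ha
  have ham : a ∈ Set.Ico (0 : ℝ) 1 := by
    refine ⟨by positivity, ?_⟩
    rw [ha, div_lt_one (by positivity)]
    exact_mod_cast hj
  set C := limVar θ + 1 with hC
  have hC0 : 0 < C := by linarith
  obtain ⟨Q, hQ, hratio⟩ := exists_ratio (C := C) hc'0 hcc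
  have hQr : (3 : ℝ) ≤ Q := by exact_mod_cast hQ
  obtain ⟨k₁, hk₁⟩ := exists_lower_tail hθ hj hc'0 hW
  obtain ⟨k₂, hk₂⟩ : ∃ k₂ : ℕ, ∀ k ≥ k₂, M ≤ Q ^ k :=
    ⟨M, fun k hk => hk.trans (Nat.lt_pow_self (by lia)).le⟩
  have hsplit : ∀ k ≥ k₂, ∃ n, Q ^ (k + 1) = Q ^ k + n + M ∧ Q ^ k ≤ n ∧
      Q ^ (k + 1) ≤ n + 2 * Q ^ k := by
    intro k hk
    have h1 := hk₂ k hk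
    have h2 : 3 * Q ^ k ≤ Q ^ (k + 1) := by rw [pow_succ']; gcongr
    exact ⟨Q ^ (k + 1) - Q ^ k - M, by lia, by lia, by lia⟩
  choose! n hn1 hn2 hn3 using hsplit
  set A : ℕ → Set ℝ := fun k => {x | √(2 * c' * n k * log k) ≤ ergSum θ (cent a) (n k) x} with hA
  have hfreq := ae_frequently_shift_mem hθ0 (N := fun k => Q ^ k) (A := A) (K₀ := k₁ + k₂)
    (pow_right_mono₀ (by lia))
    (fun k => measurableSet_le measurable_const ((bddMeas_cent a).ergSum θ (n k)).meas)
    (fun k hk => by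
      have h1 := ((isLevel_cent hθ0 M j).ergSum hθ0 (n k)).comp
        fun y => √(2 * c' * n k * log k) ≤ y
      have h2 : Q ^ (k + 1) - Q ^ k = n k + M := by have := hn1 k (by lia); lia
      rw [h2]
      exact h1)
    (fun k hk => hk₁ k (by lia) (n k)
      ((Nat.pow_le_pow_left (by lia) k).trans (hn2 k (by lia))))
  filter_upwards [hfreq, ae_eventually_abs_ergSum_le hθ (show limVar θ < C by linarith)]
    with x h1 h2
  have hpow : Tendsto (fun k : ℕ => Q ^ k) atTop atTop := tendsto_pow_atTop_atTop_of_one_lt (by lia)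
  have h3 := hpow.eventually h2
  have hev := h3.and ((eventually_log_log_pow_le hQ).and (eventually_ge_atTop (k₂ + 2)))
  have htend : Tendsto (fun k : ℕ => Q ^ (k + 1) - M) atTop atTop :=
    (tendsto_sub_atTop_nat M).comp (hpow.comp (tendsto_add_atTop_nat 1))
  refine htend.frequently ((h1.and_eventually hev).mono ?_)
  rintro k ⟨g1, g2, g3, g4⟩
  refine ⟨a, ham, ?_⟩
  have g5 := g2 a ham
  have e1 := hn1 k (by lia)
  have e2 := hn2 k (by lia)
  have e3 := hn3 k (by lia)
  have en : Q ^ (k + 1) - M = Q ^ k + n k := by lia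
  rw [en, ergSum_add]
  change √(2 * c' * n k * log k) ≤ ergSum θ (cent a) (n k) (shift θ (Q ^ k) x) at g1
  set D : ℝ := (Q : ℝ) ^ (k + 1) with hD
  have hD0 : 0 < D := by positivity
  have hQk : (Q : ℝ) ^ k = D * (1 / Q) := by rw [hD, pow_succ]; field_simp
  have hk1 : (1 : ℝ) < k := by exact_mod_cast (by lia : 1 < k)
  have hlk : 0 < log (k : ℝ) := log_pos hk1
  have hQk3 : (3 : ℝ) ≤ (Q : ℝ) ^ k := by
    calc (3 : ℝ) ≤ Q := hQr
      _ = (Q : ℝ) ^ 1 := (pow_one _).symm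
      _ ≤ (Q : ℝ) ^ k := pow_le_pow_right₀ (by linarith) (by lia)
  have hll : ∀ y : ℝ, (Q : ℝ) ^ k ≤ y → y ≤ D → log (log y) ≤ (1 + 1 / (Q : ℝ)) * log k := by
    intro y hy1 hy2
    refine le_trans ?_ g3
    exact Real.log_le_log (log_pos (by linarith)) (Real.log_le_log (by linarith) hy2)
  have hu : (0 : ℝ) < 1 / Q := by positivity
  have hu3 : 1 / (Q : ℝ) ≤ 1 / 3 := one_div_le_one_div_of_le (by norm_num) hQr
  have hQD : (Q : ℝ) ^ k ≤ D := by rw [hQk]; nlinarith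
  have b1 : √(D * log k) * √(2 * c' * (1 - 2 * (1 / (Q : ℝ)))) ≤ √(2 * c' * n k * log k) := by
    rw [← Real.sqrt_mul (by positivity)]
    refine Real.sqrt_le_sqrt ?_
    have h6 : D * (1 - 2 * (1 / (Q : ℝ))) ≤ n k := by
      have : D ≤ n k + 2 * (Q : ℝ) ^ k := by rw [hD]; exact_mod_cast e3
      linarith
    calc D * log k * (2 * c' * (1 - 2 * (1 / (Q : ℝ)))) =
        2 * c' * (D * (1 - 2 * (1 / (Q : ℝ)))) * log k := by ring
      _ ≤ _ := by gcongr
  have b2 : |ergSum θ (cent a) (Q ^ k) x| ≤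
      √(D * log k) * √(2 * C * (1 / (Q : ℝ)) * (1 + 1 / (Q : ℝ))) := by
    refine g5.trans ?_
    rw [← Real.sqrt_mul (by positivity)]
    refine Real.sqrt_le_sqrt ?_
    push_cast
    calc 2 * C * (Q : ℝ) ^ k * log (log ((Q : ℝ) ^ k)) ≤
        2 * C * (Q : ℝ) ^ k * ((1 + 1 / (Q : ℝ)) * log k) := by
          gcongr
          exact hll _ le_rfl hQD
      _ = _ := by rw [hQk]; ring
  have b3 : √(2 * c * (Q ^ k + n k : ℕ) * log (log (Q ^ k + n k : ℕ))) ≤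
      √(D * log k) * √(2 * c * (1 + 1 / (Q : ℝ))) := by
    rw [← Real.sqrt_mul (by positivity)]
    refine Real.sqrt_le_sqrt ?_
    have h7 : ((Q ^ k + n k : ℕ) : ℝ) ≤ D := by
      rw [hD]; exact_mod_cast (by lia : Q ^ k + n k ≤ Q ^ (k + 1))
    have h8 : (Q : ℝ) ^ k ≤ ((Q ^ k + n k : ℕ) : ℝ) := by push_cast; simp
    calc 2 * c * ((Q ^ k + n k : ℕ) : ℝ) * log (log (Q ^ k + n k : ℕ)) ≤
        2 * c * ((Q ^ k + n k : ℕ) : ℝ) * ((1 + 1 / (Q : ℝ)) * log k) := by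
          gcongr
          exact hll _ h8 h7
      _ ≤ 2 * c * D * ((1 + 1 / (Q : ℝ)) * log k) := by gcongr
      _ = _ := by ring
  have b4 := mul_le_mul_of_nonneg_left hratio (Real.sqrt_nonneg (D * log k))
  rw [mul_add] at b4
  have b5 := neg_abs_le (ergSum θ (cent a) (Q ^ k) x)
  refine le_trans ?_ (le_abs_self _)
  linarith

lemma discrepancy_eq_ergSum (θ : ℕ) {N : ℕ} (hN : 0 < N) (a x : ℝ) :
    (∑ k ∈ Finset.Icc 1 N, (Set.Ico (0 : ℝ) a).indicator (fun _ => (1 : ℝ))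
      (Int.fract ((θ : ℝ) ^ k * x))) / N - a = ergSum θ (cent a) N (shift θ 1 x) / N := by
  have hN' : (N : ℝ) ≠ 0 := by positivity
  have h : ∑ k ∈ Finset.Icc 1 N, (Set.Ico (0 : ℝ) a).indicator (fun _ => (1 : ℝ))
      (Int.fract ((θ : ℝ) ^ k * x)) = ergSum θ (cent a) N (shift θ 1 x) + N * a := by
    unfold ergSum cent
    rw [Finset.sum_sub_distrib]
    simp only [shift_shift, Finset.sum_const, Finset.card_range, nsmul_eq_mul, sub_add_cancel]
    rw [← Finset.Ico_add_one_right_eq_Icc, Finset.sum_Ico_eq_sum_range]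
    refine Finset.sum_congr (by simp) fun k _ => ?_
    rw [add_comm 1 k]
    rfl
  rw [h]
  field_simp
  ring

lemma abs_ergSum_cent_one (θ N : ℕ) (x : ℝ) : ergSum θ (cent 1) N x = 0 := by
  refine Finset.sum_eq_zero fun k _ => ?_
  rw [cent_of_nonneg 1 (shift_nonneg θ k x), if_pos (shift_lt_one θ k x), sub_self]

lemma mul_starDiscrepancy_le {θ N : ℕ} (hN : 0 < N) {x B : ℝ} (hB : 0 ≤ B)
    (h : ∀ a ∈ Set.Ico (0 : ℝ) 1, |ergSum θ (cent a) N (shift θ 1 x)| ≤ B) :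
    N * starDiscrepancy N (fun k => Int.fract ((θ : ℝ) ^ k * x)) ≤ B := by
  have hN' : (0 : ℝ) < N := by positivity
  rw [← le_div_iff₀' hN']
  have : Nonempty (Set.Icc (0 : ℝ) 1) := ⟨⟨0, by simp⟩⟩
  refine ciSup_le fun a => ?_
  rw [discrepancy_eq_ergSum θ hN, abs_div, abs_of_pos hN']
  gcongr
  rcases a.2.2.eq_or_lt with h1 | h1
  · rw [h1, abs_ergSum_cent_one, abs_zero]; exact hB
  · exact h a ⟨a.2.1, h1⟩

lemma abs_ergSum_le_mul_starDiscrepancy {θ N : ℕ} (hN : 0 < N) (x : ℝ) {a : ℝ}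
    (ha : a ∈ Set.Ico (0 : ℝ) 1) : |ergSum θ (cent a) N (shift θ 1 x)| ≤
      N * starDiscrepancy N (fun k => Int.fract ((θ : ℝ) ^ k * x)) := by
  have hN' : (0 : ℝ) < N := by positivity
  rw [← div_le_iff₀' hN']
  have hb : BddAbove (Set.range fun a : Set.Icc (0 : ℝ) 1 => |(∑ k ∈ Finset.Icc 1 N,
      (Set.Ico (0 : ℝ) (a : ℝ)).indicator (fun _ => (1 : ℝ)) (Int.fract ((θ : ℝ) ^ k * x))) / N -
        (a : ℝ)|) := by
    refine ⟨1, ?_⟩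
    rintro _ ⟨b, rfl⟩
    dsimp only
    rw [discrepancy_eq_ergSum θ hN, abs_div, abs_of_pos hN', div_le_one hN']
    exact abs_ergSum_le_card θ (fun y => abs_cent_le b.2 y) N _
  have h := le_ciSup hb ⟨a, ha.1, ha.2.le⟩
  rwa [discrepancy_eq_ergSum θ hN, abs_div, abs_of_pos hN'] at h

lemma sqrt_limVar {θ : ℕ} (hθ : 2 ≤ θ) : √(limVar θ) =
    if θ = 2 then √42 / 9
    else if Even θ then √(((θ : ℝ) + 1) * (θ : ℝ) * ((θ : ℝ) - 2)) / (2 * √(((θ : ℝ) - 1) ^ 3))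
    else √((θ : ℝ) + 1) / (2 * √((θ : ℝ) - 1)) := by
  have hθ' : (2 : ℝ) ≤ θ := by exact_mod_cast hθ
  have h4 : √(4 : ℝ) = 2 := by
    rw [show (4 : ℝ) = 2 ^ 2 by norm_num]; exact Real.sqrt_sq (by norm_num)
  unfold limVar
  split_ifs
  · have h81 : √(81 : ℝ) = 9 := by
      rw [show (81 : ℝ) = 9 ^ 2 by norm_num]; exact Real.sqrt_sq (by norm_num)
    rw [← h81, ← Real.sqrt_div (by norm_num)]
    norm_num
  · rw [Real.sqrt_div (mul_nonneg (by positivity) (by linarith)),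
      Real.sqrt_mul (by norm_num : (0 : ℝ) ≤ 4), h4]
  · rw [Real.sqrt_div (by positivity), Real.sqrt_mul (by norm_num), h4]

/-- A limsup is determined by its rational upper and lower approximations. -/
lemma limsup_eq_sqrt {g : ℕ → ℝ} {V : ℝ} (hV : 0 < V) (hg : ∀ n, 0 ≤ g n)
    (hup : ∀ c : ℚ, V < c → ∀ᶠ n in atTop, g n ≤ √c)
    (hlow : ∀ c : ℚ, 0 < (c : ℝ) ∧ (c : ℝ) < V → ∃ᶠ n in atTop, √c ≤ g n) :
    limsup g atTop = √V := by
  obtain ⟨q, hq⟩ := exists_rat_gt V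
  have hbdd : IsBoundedUnder (· ≤ ·) atTop g := ⟨√q, hup q hq⟩
  have hcob : IsCoboundedUnder (· ≤ ·) atTop g :=
    isCoboundedUnder_le_of_eventually_le atTop (Eventually.of_forall hg)
  refine le_antisymm ?_ ?_
  · refine le_of_forall_gt_imp_ge_of_dense fun y hy => ?_
    have hy0 : 0 < y := (Real.sqrt_nonneg V).trans_lt hy
    obtain ⟨c, hc1, hc2⟩ := exists_rat_btwn ((Real.sqrt_lt' hy0).1 hy)
    refine (limsup_le_of_le hcob (hup c hc1)).trans ?_
    exact Real.sqrt_le_iff.2 ⟨hy0.le, hc2.le⟩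
  · refine le_of_forall_lt_imp_le_of_dense fun y hy => ?_
    have h0 : max y 0 < √V := max_lt hy (Real.sqrt_pos.2 hV)
    have h1 : (max y 0) ^ 2 < V := (Real.lt_sqrt (le_max_right _ _)).1 h0
    obtain ⟨c, hc1, hc2⟩ := exists_rat_btwn h1
    have hc0 : 0 < (c : ℝ) := (sq_nonneg _).trans_lt hc1
    refine le_trans ?_ (le_limsup_of_frequently_le (hlow c ⟨hc0, hc2⟩) hbdd)
    exact (le_max_left _ _).trans (Real.le_sqrt_of_sq_le hc1.le)

end Fukuyama

/-- (Fukuyama's theorem) Let `θ ≥ 2` be an integer. For almost every `x ∈ [0,1]`,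
`limsup_{N → ∞} N D_N^*(⟨θ x⟩, …, ⟨θ^N x⟩) / √(2 N log log N)` equals `√42/9` if `θ = 2`,
`√((θ+1)θ(θ-2)) / (2√((θ-1)³))` if `θ ≥ 4` is even, and `√(θ+1)/(2√(θ-1))` if `θ ≥ 3` is odd. -/
theorem fukuyama_lil_powers (θ : ℕ) (hθ : 2 ≤ θ) :
    ∀ᵐ x ∂(volume.restrict (Set.Icc (0 : ℝ) 1)),
      Filter.limsup
        (fun N : ℕ =>
          (N : ℝ) * starDiscrepancy N (fun k => Int.fract ((θ : ℝ) ^ k * x))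
            / Real.sqrt (2 * N * Real.log (Real.log N)))
        atTop
      = if θ = 2 then Real.sqrt 42 / 9
        else if Even θ then
          Real.sqrt (((θ : ℝ) + 1) * (θ : ℝ) * ((θ : ℝ) - 2))
            / (2 * Real.sqrt (((θ : ℝ) - 1) ^ 3))
        else Real.sqrt ((θ : ℝ) + 1) / (2 * Real.sqrt ((θ : ℝ) - 1)) := by
  rw [← Fukuyama.sqrt_limVar hθ, ← Measure.restrict_congr_set Ico_ae_eq_Icc]
  change ∀ᵐ x ∂Fukuyama.unif, _
  have hV := Fukuyama.limVar_pos hθ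
  have hup : ∀ᵐ x ∂Fukuyama.unif, ∀ c : ℚ, Fukuyama.limVar θ < c → ∀ᶠ n : ℕ in atTop,
      ∀ a ∈ Set.Ico (0 : ℝ) 1, |Fukuyama.ergSum θ (Fukuyama.cent a) n x| ≤
        √(2 * c * n * log (log n)) :=
    ae_all_iff.2 fun c => by
      by_cases hc : Fukuyama.limVar θ < c
      · filter_upwards [Fukuyama.ae_eventually_abs_ergSum_le hθ hc] with x hx _ using hx
      · exact ae_of_all _ fun x h => absurd h hc
  have hlow : ∀ᵐ x ∂Fukuyama.unif, ∀ c : ℚ, 0 < (c : ℝ) ∧ (c : ℝ) < Fukuyama.limVar θ →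
      ∃ᶠ n : ℕ in atTop, ∃ a ∈ Set.Ico (0 : ℝ) 1, √(2 * c * n * log (log n)) ≤
        |Fukuyama.ergSum θ (Fukuyama.cent a) n x| :=
    ae_all_iff.2 fun c => by
      by_cases hc : 0 < (c : ℝ) ∧ (c : ℝ) < Fukuyama.limVar θ
      · filter_upwards [Fukuyama.ae_frequently_le_abs_ergSum hθ hc.1 hc.2] with x hx _ using hx
      · exact ae_of_all _ fun x h => absurd h hc
  have hmp := (Fukuyama.measurePreserving_shift (by lia : 0 < θ) 1).quasiMeasurePreserving
  have hpos : ∀ᶠ n : ℕ in atTop, 0 < n ∧ 0 < log (log (n : ℝ)) :=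
    (eventually_gt_atTop 0).and (Fukuyama.tendsto_log_log_natCast.eventually_gt_atTop 0)
  have hsplit : ∀ (c : ℚ) (n : ℕ), 0 < (c : ℝ) →
      √(2 * c * n * log (log n)) = √(c : ℝ) * √(2 * n * log (log n)) := by
    intro c n hc
    rw [← Real.sqrt_mul hc.le]
    ring_nf
  filter_upwards [hmp.ae hup, hmp.ae hlow] with x h1 h2
  refine Fukuyama.limsup_eq_sqrt hV (fun n => ?_) (fun c hc => ?_) (fun c hc => ?_)
  · refine div_nonneg (mul_nonneg (by positivity) ?_) (Real.sqrt_nonneg _)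
    exact Real.iSup_nonneg fun a => abs_nonneg _
  · filter_upwards [h1 c hc, hpos] with n hn hn0
    obtain ⟨hn1, hn2⟩ := hn0
    rw [div_le_iff₀ (by positivity), ← hsplit c n (hV.trans hc)]
    exact Fukuyama.mul_starDiscrepancy_le hn1 (Real.sqrt_nonneg _) hn
  · refine ((h2 c hc).and_eventually hpos).mono ?_
    rintro n ⟨⟨a, ha, hn⟩, hn1, hn2⟩
    rw [le_div_iff₀ (by positivity), ← hsplit c n hc.1]
    exact hn.trans (Fukuyama.abs_ergSum_le_mul_starDiscrepancy hn1 x ha)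
end

section
/- (Franel–Landau formula) For all positive integers m and n, ∫_0^1 ( ⟨m x⟩ − 1/2 )( ⟨n x⟩ − 1/2 ) dx = (1/12) · gcd(m,n)² / (m n). -/
open MeasureTheory

/-- The fractional part of a real number divided by `m`, shifted by `a / m`. -/
lemma fract_add_intCast_div (m : ℕ) (hm : 0 < m) (y : ℝ) (a : ℤ) :
    Int.fract ((y + a) / m) = (Int.fract y + ((⌊y⌋ + a) % (m : ℤ) : ℤ)) / m := by
  have hm' : (0 : ℝ) < m := by exact_mod_cast hm
  have hmz : (0 : ℤ) < m := by exact_mod_cast hm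
  rw [Int.fract_eq_iff]
  have h0 : (0 : ℝ) ≤ ((⌊y⌋ + a) % (m : ℤ) : ℤ) := by
    exact_mod_cast Int.emod_nonneg _ hmz.ne'
  have h1 : (((⌊y⌋ + a) % (m : ℤ) : ℤ) : ℝ) + 1 ≤ m := by
    exact_mod_cast Int.emod_lt_of_pos (⌊y⌋ + a) hmz
  refine ⟨by have := Int.fract_nonneg y; positivity, ?_, (⌊y⌋ + a) / m, ?_⟩
  · rw [div_lt_one hm']
    linarith [Int.fract_lt_one y]
  · have h2 : ((m : ℝ) * ((⌊y⌋ + a) / (m : ℤ) : ℤ)) + ((⌊y⌋ + a) % (m : ℤ) : ℤ) = ⌊y⌋ + a := by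
      exact_mod_cast Int.mul_ediv_add_emod (⌊y⌋ + a) m
    field_simp
    linarith [Int.floor_add_fract y]

/-- An affine map with slope coprime to `m` permutes the residues modulo `m`. -/
lemma sum_affine_emod {m n : ℕ} (hm : 0 < m) (h : Nat.Coprime m n) (q : ℤ) :
    ∑ k ∈ Finset.range m, (((q + n * k) % (m : ℤ) : ℤ) : ℝ) = ∑ k ∈ Finset.range m, (k : ℝ) := by
  have hmz : (0 : ℤ) < m := by exact_mod_cast hm
  have key : ∀ k, ((((q + n * k) % (m : ℤ)).toNat : ℕ) : ℤ) = (q + n * k) % (m : ℤ) :=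
    fun k => Int.toNat_of_nonneg (Int.emod_nonneg _ hmz.ne')
  have hmaps : Set.MapsTo (fun k : ℕ => ((q + n * k) % (m : ℤ)).toNat)
      (Finset.range m) (Finset.range m) := by
    intro k _
    have := Int.emod_lt_of_pos (q + n * k) hmz
    simp only [Finset.coe_range, Set.mem_Iio]
    have := key k
    omega
  have hinj : Set.InjOn (fun k : ℕ => ((q + n * k) % (m : ℤ)).toNat) (Finset.range m) := by
    intro a ha b hb hab
    simp only [Finset.coe_range, Set.mem_Iio] at ha hb
    have hmod : q + n * a ≡ q + n * b [ZMOD m] := by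
      have := congrArg (Nat.cast : ℕ → ℤ) hab
      simp only [key] at this
      exact this
    have hmod' : n * a ≡ n * b [MOD m] :=
      Int.natCast_modEq_iff.1 (by exact_mod_cast Int.ModEq.add_left_cancel' q hmod)
    exact (Nat.ModEq.cancel_left_of_coprime h hmod').eq_of_lt_of_lt ha hb
  refine Finset.sum_nbij (fun k : ℕ => ((q + n * k) % (m : ℤ)).toNat) hmaps hinj
    (Finset.surjOn_of_injOn_of_card_le _ hmaps hinj le_rfl) fun k _ => ?_
  exact_mod_cast (key k).symm

/-- The distribution relation for the sawtooth function. -/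
lemma sum_fract_sub_half {m n : ℕ} (hm : 0 < m) (h : Nat.Coprime m n) (y : ℝ) :
    ∑ k ∈ Finset.range m, (Int.fract ((y + n * k) / m) - 1 / 2) = Int.fract y - 1 / 2 := by
  have hm' : (m : ℝ) ≠ 0 := by exact_mod_cast hm.ne'
  have hterm (k : ℕ) : Int.fract ((y + n * k) / m) - 1 / 2 =
      (Int.fract y + ((⌊y⌋ + n * k) % (m : ℤ) : ℤ)) / m - 1 / 2 := by
    simpa using congrArg (· - (1 / 2 : ℝ)) (fract_add_intCast_div m hm y (n * k))
  have hgauss : ∀ N : ℕ, ∑ k ∈ Finset.range N, (k : ℝ) = N * (N - 1) / 2 := fun N => by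
    induction N with
    | zero => simp
    | succ N ih => rw [Finset.sum_range_succ, ih]; push_cast; ring
  simp only [hterm, Finset.sum_sub_distrib, ← Finset.sum_div, Finset.sum_add_distrib,
    sum_affine_emod hm h, hgauss, Finset.sum_const, Finset.card_range, nsmul_eq_mul]
  field_simp
  ring

lemma integral_comp_natCast_mul {m : ℕ} (hm : 0 < m) {g : ℝ → ℝ}
    (hg : ∀ a b, IntervalIntegrable g volume a b) :
    ∫ x in (0 : ℝ)..1, g (m * x) =
      (m : ℝ)⁻¹ * ∫ x in (0 : ℝ)..1, ∑ k ∈ Finset.range m, g (x + k) := by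
  have hm' : (m : ℝ) ≠ 0 := by exact_mod_cast hm.ne'
  rw [intervalIntegral.integral_comp_mul_left g hm', smul_eq_mul,
    intervalIntegral.integral_finsetSum]
  · congr 1
    have := intervalIntegral.sum_integral_adjacent_intervals (f := g) (μ := volume)
      (a := fun k : ℕ => (k : ℝ)) (n := m) fun k _ => hg _ _
    simp only [mul_zero, mul_one]
    rw [Nat.cast_zero] at this
    rw [← this]
    refine Finset.sum_congr rfl fun k _ => ?_
    rw [intervalIntegral.integral_comp_add_right, zero_add, Nat.cast_succ, add_comm]
  · intro k _
    simpa using (hg (0 + k) (1 + k)).comp_add_right (k : ℝ)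

lemma intervalIntegrable_fract_mul_fract (r s a b : ℝ) :
    IntervalIntegrable (fun x => (Int.fract (r * x) - 1 / 2) * (Int.fract (s * x) - 1 / 2))
      volume a b := by
  have hbound (y : ℝ) : |Int.fract y - 1 / 2| ≤ 1 := by
    rw [abs_le]
    constructor <;> linarith [Int.fract_nonneg y, Int.fract_lt_one y]
  refine (intervalIntegrable_const (c := (1 : ℝ))).mono_fun
    (Measurable.aestronglyMeasurable ?_) (Filter.Eventually.of_forall fun x => ?_)
  · exact (((measurable_id.const_mul r).fract).sub_const _).mul
      (((measurable_id.const_mul s).fract).sub_const _)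
  · simp only [norm_mul, norm_one]
    exact mul_le_one₀ (hbound _) (norm_nonneg _) (hbound _)

lemma integral_fract_mul_fract_of_coprime {m n : ℕ} (hm : 0 < m) (h : Nat.Coprime m n) :
    ∫ x in (0 : ℝ)..1, (Int.fract (m * x) - 1 / 2) * (Int.fract (n * x) - 1 / 2) =
      (m : ℝ)⁻¹ * ∫ x in (0 : ℝ)..1, (Int.fract x - 1 / 2) * (Int.fract (n * x) - 1 / 2) := by
  have hm' : (m : ℝ) ≠ 0 := by exact_mod_cast hm.ne'
  have hg : ∀ a b, IntervalIntegrable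
      (fun x : ℝ => (Int.fract x - 1 / 2) * (Int.fract (n / m * x) - 1 / 2)) volume a b := by
    simpa using intervalIntegrable_fract_mul_fract 1 (n / m)
  have hscale := integral_comp_natCast_mul hm hg
  have hcancel (x : ℝ) : (n : ℝ) / m * (m * x) = n * x := by field_simp
  simp only [hcancel] at hscale
  rw [hscale]
  congr 1
  refine intervalIntegral.integral_congr fun x _ => ?_
  simp only [Int.fract_add_natCast, ← Finset.mul_sum]
  rw [← sum_fract_sub_half hm h (n * x)]
  congr 1
  refine Finset.sum_congr rfl fun k _ => ?_
  congr 2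
  ring

lemma integral_fract_sub_half_sq :
    ∫ x in (0 : ℝ)..1, (Int.fract x - 1 / 2) * (Int.fract x - 1 / 2) = 1 / 12 := by
  have hcongr : ∫ x in (0 : ℝ)..1, (Int.fract x - 1 / 2) * (Int.fract x - 1 / 2) =
      ∫ x in (0 : ℝ)..1, (x - 1 / 2) ^ 2 := by
    refine intervalIntegral.integral_congr_Ioo_of_le zero_le_one fun x hx => ?_
    simp only [Int.fract_eq_self.2 ⟨hx.1.le, hx.2⟩]
    ring
  rw [hcongr, intervalIntegral.integral_comp_sub_right (fun x : ℝ => x ^ 2), integral_pow]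
  norm_num

/-- (Franel–Landau formula) For all positive integers `m` and `n`,
`∫₀¹ (⟨m x⟩ - 1/2)(⟨n x⟩ - 1/2) dx = (1/12) gcd(m,n)² / (m n)`. -/
theorem franel_landau (m n : ℕ) (hm : 0 < m) (hn : 0 < n) :
    (∫ x in (0:ℝ)..1, (Int.fract ((m : ℝ) * x) - 1/2) * (Int.fract ((n : ℝ) * x) - 1/2))
      = 1/12 * (Nat.gcd m n : ℝ) ^ 2 / ((m : ℝ) * (n : ℝ)) := by
  obtain ⟨a, b, hab, ha, hb⟩ := Nat.exists_coprime m n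
  have hd : 0 < Nat.gcd m n := Nat.gcd_pos_of_pos_left n hm
  generalize Nat.gcd m n = d at *
  subst ha hb
  have ha : 0 < a := Nat.pos_of_mul_pos_right hm
  have hb : 0 < b := Nat.pos_of_mul_pos_right hn
  have hd' : (d : ℝ) ≠ 0 := by exact_mod_cast hd.ne'
  have ha' : (a : ℝ) ≠ 0 := by exact_mod_cast ha.ne'
  have hb' : (b : ℝ) ≠ 0 := by exact_mod_cast hb.ne'
  have hshift (c k : ℕ) (x : ℝ) : Int.fract ((c : ℝ) * (x + k)) = Int.fract (c * x) := by
    rw [mul_add, ← Nat.cast_mul, Int.fract_add_natCast]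
  have hcoprime : ∫ x in (0 : ℝ)..1, (Int.fract (a * x) - 1 / 2) * (Int.fract (b * x) - 1 / 2) =
      (a : ℝ)⁻¹ * ((b : ℝ)⁻¹ * (1 / 12)) := by
    have hone := integral_fract_mul_fract_of_coprime hb (Nat.coprime_one_right b)
    simp only [Nat.cast_one, one_mul, integral_fract_sub_half_sq] at hone
    rw [integral_fract_mul_fract_of_coprime ha hab, ← hone]
    simp only [mul_comm]
  have hscale := integral_comp_natCast_mul hd (intervalIntegrable_fract_mul_fract a b)
  simp only [hshift, Finset.sum_const, Finset.card_range, nsmul_eq_mul,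
    intervalIntegral.integral_const_mul, hcoprime] at hscale
  simp only [← mul_assoc] at hscale
  push_cast
  rw [hscale]
  field_simp
end
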